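/- arXiv:2007.03957 — 3 statements merged into one kernel-verified Lean document; each statement's English description precedes it below -/
import Mathlib

section
/- Let (t₁,…,t_m) be a (possibly empty) tuple of positive integers with t₁+⋯+t_m = u, and let s > 1 be an integer. Then the convergent series ∑_{n=1}^∞ (H_{n-1}^{(t₁,…,t_m)}/n^s)·4^n·binom(2n,n)^{-1} belongs to CMZV²_{s+u}, the ℚ-linear span in ℂ of colored multiple zeta values of level 2 and weight s+u. -/
open scoped BigOperators

/-- Partial multiple sum `∑_{M ≥ n₁ > ⋯ > n_k ≥ 1} ∏ᵢ aᵢ^{nᵢ} / nᵢ^{sᵢ}`. -/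
noncomputable def multiplePartialSum (k : ℕ) (s : Fin k → ℕ) (a : Fin k → ℂ) (M : ℕ) : ℂ :=
  ∑ n : Fin k → Fin (M + 1),
    if (∀ i j : Fin k, i < j → (n j : ℕ) < (n i : ℕ)) ∧ (∀ i, 0 < (n i : ℕ)) then
      ∏ i, (a i) ^ (n i : ℕ) / ((n i : ℕ) : ℂ) ^ (s i)
    else 0

/-- `z` is a colored multiple zeta value of level `N` and weight `w`:
`z = ∑_{n₁ > ⋯ > n_k ≥ 1} a₁^{n₁} ⋯ a_k^{n_k} / (n₁^{s₁} ⋯ n_k^{s_k})` (as a limit of the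
partial sums over `M ≥ n₁ > ⋯ > n_k ≥ 1` as `M → ∞`), where the `sᵢ` are positive integers
with `s₁ + ⋯ + s_k = w`, each `aᵢ` is an `N`-th root of unity, and `(s₁, a₁) ≠ (1, 1)`. -/
def IsCMZV (N w : ℕ) (z : ℂ) : Prop :=
  ∃ (k : ℕ) (hk : 0 < k) (s : Fin k → ℕ) (a : Fin k → ℂ),
    (∀ i, 0 < s i) ∧ (∑ i, s i) = w ∧ (∀ i, (a i) ^ N = 1) ∧
    ¬(s ⟨0, hk⟩ = 1 ∧ a ⟨0, hk⟩ = 1) ∧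
    Filter.Tendsto (multiplePartialSum k s a) Filter.atTop (nhds z)

/-- The ℚ-linear span in ℂ of the colored multiple zeta values of level `N` and weight `w`. -/
noncomputable def CMZV (N w : ℕ) : Submodule ℚ ℂ :=
  Submodule.span ℚ {z : ℂ | IsCMZV N w z}

/-- The multiple harmonic number `H_n^{(t₁,…,t_m)} = ∑_{n ≥ n₁ > ⋯ > n_m ≥ 1} ∏ᵢ 1/nᵢ^{tᵢ}`;
it equals `1` for the empty tuple. -/
noncomputable def multiHarmonic {m : ℕ} (t : Fin m → ℕ) (n : ℕ) : ℝ :=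
  ∑ x : Fin m → Fin (n + 1),
    if (∀ i j : Fin m, i < j → (x j : ℕ) < (x i : ℕ)) ∧ (∀ i, 0 < (x i : ℕ)) then
      ∏ i, 1 / ((x i : ℕ) : ℝ) ^ (t i)
    else 0

open Filter Topology Finset
open scoped NNReal ENNReal

/-- The nested sum `∑_{M > j₁ > j₂ > ⋯ ≥ 0} f₁(j₁) f₂(j₂) ⋯` of a list of functions. -/
def nestedSum {R : Type*} [Semiring R] : List (ℕ → R) → ℕ → R
  | [], _ => 1
  | f :: fs, M => ∑ j ∈ range M, f j * nestedSum fs j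

theorem map_nestedSum {R S : Type*} [Semiring R] [Semiring S] (φ : R →+* S)
    (l : List (ℕ → R)) (M : ℕ) :
    φ (nestedSum l M) = nestedSum (l.map fun f j => φ (f j)) M := by
  induction l generalizing M with
  | nil => simp [nestedSum]
  | cons f fs ih => simp [nestedSum, ih]

theorem sum_tuple_bounded_eq_nestedSum {R : Type*} [CommSemiring R] (N k : ℕ) (f : Fin k → ℕ → R)
    (M : ℕ) (hM : M < N) :
    (∑ n : Fin k → Fin N,
      if (∀ i j : Fin k, i < j → (n j : ℕ) < (n i : ℕ)) ∧ (∀ i, 0 < (n i : ℕ)) ∧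
          ∀ i, (n i : ℕ) ≤ M then
        ∏ i, f i (n i : ℕ) else 0) =
      nestedSum (List.ofFn fun i j => f i (j + 1)) M := by
  induction k generalizing M with
  | zero => simp [nestedSum]
  | succ k ih =>
    rw [← (Fin.consEquiv fun _ : Fin (k + 1) => Fin N).sum_comp, Fintype.sum_prod_type,
      List.ofFn_succ]
    simp only [nestedSum, Fin.consEquiv_apply, Fin.prod_univ_succ, Fin.cons_zero, Fin.cons_succ]
    have key : ∀ j : Fin N, (∑ y : Fin k → Fin N,
        if (∀ a b : Fin (k + 1), a < b →
              ((Fin.cons j y : Fin (k + 1) → Fin N) b : ℕ) <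
                ((Fin.cons j y : Fin (k + 1) → Fin N) a : ℕ)) ∧
            (∀ a, 0 < ((Fin.cons j y : Fin (k + 1) → Fin N) a : ℕ)) ∧
            (∀ a, ((Fin.cons j y : Fin (k + 1) → Fin N) a : ℕ) ≤ M) then
          f 0 (j : ℕ) * ∏ i : Fin k, f i.succ (y i : ℕ) else 0) =
        if 0 < (j : ℕ) ∧ (j : ℕ) ≤ M then
          f 0 (j : ℕ) * nestedSum (List.ofFn fun (i : Fin k) m => f i.succ (m + 1)) (j - 1)
        else 0 := by
      intro j
      by_cases hj : 0 < (j : ℕ) ∧ (j : ℕ) ≤ M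
      · rw [if_pos hj, ← ih (fun i => f i.succ) (j - 1) (by omega), mul_sum]
        refine sum_congr rfl fun y _ => ?_
        rw [mul_ite, mul_zero]
        refine if_congr ?_ rfl rfl
        simp only [Fin.forall_fin_succ, Fin.cons_zero, Fin.cons_succ, Fin.succ_lt_succ_iff,
          Fin.succ_pos, Fin.not_lt_zero, false_imp_iff, true_imp_iff, true_and]
        constructor
        · rintro ⟨⟨h1, h2⟩, ⟨h3, h4⟩, h5, h6⟩
          exact ⟨h2, h4, fun i => by have := h1 i; omega⟩
        · rintro ⟨h1, h2, h3⟩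
          refine ⟨⟨fun i => ?_, h1⟩, ⟨hj.1, h2⟩, hj.2, fun i => ?_⟩ <;>
          · have := h3 i
            omega
      · rw [if_neg hj]
        refine sum_eq_zero fun y _ => if_neg ?_
        rintro ⟨-, h1, h2⟩
        exact hj ⟨by simpa using h1 0, by simpa using h2 0⟩
    rw [sum_congr rfl fun j _ => key j, Fin.sum_univ_eq_sum_range (fun j => if 0 < j ∧ j ≤ M then
      f 0 j * nestedSum (List.ofFn fun (i : Fin k) m => f i.succ (m + 1)) (j - 1) else 0) N]
    obtain ⟨d, rfl⟩ := Nat.exists_eq_add_of_lt hM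
    rw [add_assoc, add_comm d 1, ← add_assoc, sum_range_add, sum_range_succ']
    rw [sum_eq_zero (s := range d) fun x _ => if_neg (by omega)]
    simp only [lt_irrefl, false_and, if_false, add_zero]
    exact sum_congr rfl fun j hj => by
      rw [if_pos ⟨by omega, by simpa [Nat.succ_le_iff] using hj⟩, Nat.add_sub_cancel]

theorem sum_tuple_eq_nestedSum {R : Type*} [CommSemiring R] (k : ℕ) (f : Fin k → ℕ → R) (M : ℕ) :
    (∑ n : Fin k → Fin (M + 1),
      if (∀ i j : Fin k, i < j → (n j : ℕ) < (n i : ℕ)) ∧ (∀ i, 0 < (n i : ℕ)) then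
        ∏ i, f i (n i : ℕ) else 0) =
      nestedSum (List.ofFn fun i j => f i (j + 1)) M := by
  rw [← sum_tuple_bounded_eq_nestedSum (M + 1) k f M M.lt_succ_self]
  refine sum_congr rfl fun n _ => if_congr ?_ rfl rfl
  have : ∀ i, (n i : ℕ) ≤ M := fun i => by omega
  tauto

/-! ### The connector -/

/-- The connector `∏_{j < n} (j + 1) / (j + k + 1/2) = n! Γ(k + 1/2) / Γ(n + k + 1/2)`. -/
noncomputable def connector (n k : ℕ) : ℝ≥0 :=
  ∏ j ∈ range n, ((j : ℝ≥0) + 1) / (j + k + 1 / 2)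

theorem connector_zero_left (k : ℕ) : connector 0 k = 1 := by simp [connector]

theorem connector_succ_left (n k : ℕ) :
    connector (n + 1) k = connector n k * (((n : ℝ≥0) + 1) / (n + k + 1 / 2)) :=
  prod_range_succ _ _

theorem connector_succ_right (n k : ℕ) :
    connector n (k + 1) * ((n : ℝ≥0) + k + 1 / 2) = connector n k * (k + 1 / 2) := by
  induction n with
  | zero => simp [connector_zero_left]
  | succ n ih =>
    have h : connector n k = connector n (k + 1) * ((n : ℝ≥0) + k + 1 / 2) / (k + 1 / 2) := by
      rw [ih]; field_simp
    rw [connector_succ_left, connector_succ_left, h]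
    push_cast
    field_simp
    ring

theorem connector_zero_right (n : ℕ) :
    connector n 0 = 4 ^ n / ((2 * n).choose n : ℝ≥0) := by
  induction n with
  | zero => simp [connector_zero_left]
  | succ n ih =>
    have h := congrArg (Nat.cast : ℕ → ℝ≥0) (Nat.succ_mul_centralBinom_succ n)
    have h0 : (n.centralBinom : ℝ≥0) ≠ 0 := by exact_mod_cast n.centralBinom_ne_zero
    have h1 : ((n + 1).centralBinom : ℝ≥0) ≠ 0 := by exact_mod_cast (n + 1).centralBinom_ne_zero
    rw [connector_succ_left, ih, ← Nat.centralBinom_eq_two_mul_choose,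
      ← Nat.centralBinom_eq_two_mul_choose]
    push_cast at h ⊢
    rw [add_zero, div_mul_div_comm, div_eq_div_iff (by positivity) h1]
    calc 4 ^ n * ((n : ℝ≥0) + 1) * (n + 1).centralBinom
        = 4 ^ n * (((n : ℝ≥0) + 1) * (n + 1).centralBinom) := by ring
      _ = 4 ^ (n + 1) * (n.centralBinom * (n + 1 / 2)) := by rw [h]; field_simp; ring

theorem connector_sq_le (n k : ℕ) : connector n (k + 1) ^ 2 ≤ ((n : ℝ≥0) + 1)⁻¹ := by
  induction n with
  | zero => simp [connector_zero_left]
  | succ n ih =>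
    rw [connector_succ_left, mul_pow]
    refine (mul_le_mul_left ih _).trans ?_
    rw [← NNReal.coe_le_coe]
    push_cast
    rw [div_pow, inv_mul_eq_div, div_div, inv_eq_one_div, div_le_div_iff₀ (by positivity)
      (by positivity)]
    have : (0 : ℝ) ≤ n := n.cast_nonneg
    have : (0 : ℝ) ≤ k := k.cast_nonneg
    nlinarith [mul_nonneg ‹(0 : ℝ) ≤ n› ‹(0 : ℝ) ≤ k›, sq_nonneg (k : ℝ),
      mul_nonneg (mul_nonneg ‹(0 : ℝ) ≤ n› ‹(0 : ℝ) ≤ n›) ‹(0 : ℝ) ≤ k›,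
      mul_nonneg ‹(0 : ℝ) ≤ n› (sq_nonneg (k : ℝ))]

theorem connector_succ_le (n k : ℕ) : connector (n + 1) (k + 1) ≤ ((k : ℝ≥0) + 1)⁻¹ := by
  induction n with
  | zero =>
    rw [connector_succ_left, connector_zero_left, one_mul, ← NNReal.coe_le_coe]
    push_cast
    rw [inv_eq_one_div, div_le_div_iff₀ (by positivity) (by positivity)]
    linarith
  | succ n ih =>
    rw [connector_succ_left]
    refine (mul_le_of_le_one_right' ?_).trans ih
    rw [← NNReal.coe_le_coe]
    push_cast
    rw [div_le_one (by positivity)]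
    have : (0 : ℝ) ≤ k := k.cast_nonneg
    linarith

theorem tendsto_inv_natCast_add_one :
    Tendsto (fun n : ℕ => ((n : ℝ≥0) + 1)⁻¹) atTop (𝓝 0) := by
  rw [← NNReal.tendsto_coe]
  simpa using tendsto_one_div_add_atTop_nhds_zero_nat (𝕜 := ℝ)

theorem tendsto_connector_left (k : ℕ) :
    Tendsto (fun n => connector n (k + 1)) atTop (𝓝 0) := by
  have h := tendsto_of_tendsto_of_tendsto_of_le_of_le tendsto_const_nhds
    tendsto_inv_natCast_add_one (fun _ => zero_le) fun n => connector_sq_le n k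
  have h2 := (NNReal.continuous_sqrt.tendsto 0).comp h
  simpa [Function.comp_def] using h2

theorem tendsto_connector_right (n : ℕ) :
    Tendsto (fun k => connector (n + 1) k) atTop (𝓝 0) :=
  (tendsto_add_atTop_iff_nat 1).1 <| tendsto_of_tendsto_of_tendsto_of_le_of_le tendsto_const_nhds
    tendsto_inv_natCast_add_one (fun _ => zero_le) fun k => connector_succ_le n k

theorem NNReal.hasSum_of_add_succ_eq {u v : ℕ → ℝ≥0} (h : ∀ d, v d + u (d + 1) = u d)
    (hu : Tendsto u atTop (𝓝 0)) : HasSum v (u 0) := by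
  rw [NNReal.hasSum_iff_tendsto_nat]
  have hs : ∀ n, ∑ i ∈ range n, v i = u 0 - u n := fun n => by
    refine (tsub_eq_of_eq_add ?_).symm
    induction n with
    | zero => simp
    | succ n ih => rw [sum_range_succ, add_assoc, h, ← ih]
  simp_rw [hs]
  simpa using tendsto_const_nhds.sub hu

theorem hasSum_connector_left (n k : ℕ) :
    HasSum (fun d : ℕ => ((n + d : ℕ) + 1 : ℝ≥0)⁻¹ * connector (n + d + 1) (k + 1))
      (((k : ℝ≥0) + 1 / 2)⁻¹ * connector n (k + 1)) := by
  refine NNReal.hasSum_of_add_succ_eq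
    (u := fun d => ((k : ℝ≥0) + 1 / 2)⁻¹ * connector (n + d) (k + 1)) (fun d => ?_) ?_
  · rw [← add_assoc, connector_succ_left]
    push_cast
    field_simp
    ring
  · have := ((tendsto_add_atTop_iff_nat n).2 (tendsto_connector_left k)).const_mul
      (((k : ℝ≥0) + 1 / 2)⁻¹)
    simpa [add_comm n] using this

theorem hasSum_connector_right (n k : ℕ) :
    HasSum (fun d : ℕ => ((k + d : ℕ) + 1 / 2 : ℝ≥0)⁻¹ * connector (n + 1) (k + d + 1))
      (((n : ℝ≥0) + 1)⁻¹ * connector (n + 1) k) := by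
  refine NNReal.hasSum_of_add_succ_eq
    (u := fun d => ((n : ℝ≥0) + 1)⁻¹ * connector (n + 1) (k + d)) (fun d => ?_) ?_
  · have h : connector (n + 1) (k + d) = connector (n + 1) (k + d + 1) *
        (((n + 1 : ℕ) : ℝ≥0) + (k + d : ℕ) + 1 / 2) / ((k + d : ℕ) + 1 / 2) := by
      rw [connector_succ_right]; field_simp
    rw [h, ← add_assoc]
    push_cast
    field_simp
    ring
  · have := ((tendsto_add_atTop_iff_nat k).2 (tendsto_connector_right n)).const_mul
      (((n : ℝ≥0) + 1)⁻¹)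
    simpa [add_comm k] using this

/-! ### Transport of the series to a sum over half-integers -/

/-- The summand `1 / (j + 1) ^ t` of a multiple harmonic sum. -/
noncomputable def integerWeight (t j : ℕ) : ℝ≥0 := (((j : ℝ≥0) + 1)⁻¹) ^ t

/-- The summand `1 / (j + 1/2) ^ q` of a half-integer harmonic sum. -/
noncomputable def halfIntegerWeight (q j : ℕ) : ℝ≥0 := (((j : ℝ≥0) + 1 / 2)⁻¹) ^ q

/-- The series `∑_{n₁ > n₂ > ⋯ ≥ 1} n₁^{-s} n₂^{-t₁} ⋯ C(n₁, k)` over the exponents `(s, t₁, …)`,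
where `C` is the connector. -/
noncomputable def connectedSeries : List ℕ → ℕ → ℝ≥0∞
  | [], _ => 1
  | s :: ts, k => ∑' n, ((integerWeight s n * connector (n + 1) k *
      nestedSum (ts.map integerWeight) n : ℝ≥0) : ℝ≥0∞)

/-- The sum `∑_i (i + 1/2)^{-q₀} H_i(q) Z(l, i + 1)`, where `H` is the half-integer harmonic sum
and `Z` the connected series. -/
noncomputable def mixedSeries (q₀ : ℕ) (q l : List ℕ) : ℝ≥0∞ :=
  ∑' i, ((halfIntegerWeight q₀ i * nestedSum (q.map halfIntegerWeight) i : ℝ≥0) : ℝ≥0∞) *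
    connectedSeries l (i + 1)

theorem ENNReal.tsum_sum_range (f : ℕ → ℕ → ℝ≥0∞) :
    ∑' n, ∑ j ∈ range n, f n j = ∑' j, ∑' d, f (j + 1 + d) j := by
  have h1 : ∀ n, ∑ j ∈ range n, f n j = ∑' j, if j < n then f n j else 0 := fun n => by
    rw [tsum_eq_sum (s := range n) fun j hj => if_neg (by simpa using hj)]
    exact sum_congr rfl fun j hj => (if_pos (mem_range.1 hj)).symm
  simp_rw [h1]
  rw [ENNReal.tsum_comm]
  refine tsum_congr fun j => ?_
  rw [← ENNReal.summable.sum_add_tsum_nat_add' (k := j + 1)]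
  rw [sum_eq_zero fun n hn => if_neg (by simpa [Nat.lt_succ_iff] using hn), zero_add]
  exact tsum_congr fun d => by rw [if_pos (by omega), add_comm d]

theorem connectedSeries_one_cons (ts : List ℕ) (k : ℕ) :
    connectedSeries (1 :: ts) (k + 1) =
      ((halfIntegerWeight 1 k : ℝ≥0) : ℝ≥0∞) * connectedSeries ts (k + 1) := by
  cases ts with
  | nil =>
    have h := ENNReal.hasSum_coe.2 (hasSum_connector_left 0 k)
    simp only [zero_add, connector_zero_left, mul_one] at h
    simpa [connectedSeries, nestedSum, integerWeight, halfIntegerWeight] using h.tsum_eq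
  | cons t ts =>
    simp only [connectedSeries, List.map_cons, nestedSum, mul_sum, ENNReal.ofNNReal_finsetSum]
    rw [ENNReal.tsum_sum_range, ← ENNReal.tsum_mul_left]
    refine tsum_congr fun j => ?_
    have h := (ENNReal.hasSum_coe.2 (hasSum_connector_left (j + 1) k)).tsum_eq
    calc _ = ∑' d : ℕ, ((integerWeight t j * nestedSum (ts.map integerWeight) j : ℝ≥0) : ℝ≥0∞) *
          ((((j + 1 + d : ℕ) + 1 : ℝ≥0)⁻¹ * connector (j + 1 + d + 1) (k + 1) : ℝ≥0) : ℝ≥0∞) :=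
          tsum_congr fun d => by
            rw [← ENNReal.coe_mul, integerWeight, pow_one]
            congr 1
            ring
      _ = _ := by
          rw [ENNReal.tsum_mul_left, h, ← ENNReal.coe_mul, ← ENNReal.coe_mul,
            halfIntegerWeight, pow_one]
          congr 1
          ring

theorem connectedSeries_succ_cons (s : ℕ) (ts : List ℕ) (k : ℕ) :
    connectedSeries ((s + 1) :: ts) k =
      ∑' d, ((halfIntegerWeight 1 (k + d) : ℝ≥0) : ℝ≥0∞) *
        connectedSeries (s :: ts) (k + d + 1) := by
  simp only [connectedSeries, ← ENNReal.tsum_mul_left]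
  rw [ENNReal.tsum_comm]
  refine tsum_congr fun n => ?_
  have h := (ENNReal.hasSum_coe.2 (hasSum_connector_right n k)).tsum_eq
  calc _ = ((integerWeight s n * nestedSum (ts.map integerWeight) n : ℝ≥0) : ℝ≥0∞) *
        (((((n : ℝ≥0) + 1)⁻¹ * connector (n + 1) k : ℝ≥0)) : ℝ≥0∞) := by
        rw [← ENNReal.coe_mul, integerWeight, integerWeight, pow_succ]
        congr 1
        ring
    _ = _ := by
        rw [← h, ← ENNReal.tsum_mul_left]
        refine tsum_congr fun d => ?_
        rw [← ENNReal.coe_mul, ← ENNReal.coe_mul, halfIntegerWeight, pow_one]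
        congr 1
        ring

theorem mixedSeries_one_cons (q₀ : ℕ) (q ts : List ℕ) :
    mixedSeries q₀ q (1 :: ts) = mixedSeries (q₀ + 1) q ts := by
  refine tsum_congr fun i => ?_
  rw [connectedSeries_one_cons, ← mul_assoc, ← ENNReal.coe_mul]
  congr 2
  rw [halfIntegerWeight, halfIntegerWeight, halfIntegerWeight]
  ring

theorem mixedSeries_succ_cons (q₀ : ℕ) (q : List ℕ) (s : ℕ) (ts : List ℕ) :
    mixedSeries q₀ q ((s + 1) :: ts) = mixedSeries 1 (q₀ :: q) (s :: ts) := by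
  simp only [mixedSeries, connectedSeries_succ_cons, List.map_cons, nestedSum, mul_sum,
    ENNReal.ofNNReal_finsetSum, sum_mul]
  rw [ENNReal.tsum_sum_range]
  refine tsum_congr fun i => ?_
  rw [← ENNReal.tsum_mul_left]
  refine tsum_congr fun d => ?_
  rw [ENNReal.coe_mul (halfIntegerWeight 1 (i + 1 + d))]
  ring

/-- Every mixed series is a half-integer multiple zeta series of the same weight, whose leading
exponent is at least two. -/
theorem exists_mixedSeries_eq (l : List ℕ) (hl : ∀ x ∈ l, 0 < x) (q₀ : ℕ) (q : List ℕ)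
    (hq₀ : 0 < q₀) (hq : ∀ x ∈ q, 0 < x) (h : 2 ≤ q₀ ∨ l ≠ []) :
    ∃ r₀ r, 2 ≤ r₀ ∧ (∀ x ∈ r, 0 < x) ∧ r₀ + r.sum = q₀ + q.sum + l.sum ∧
      mixedSeries q₀ q l = mixedSeries r₀ r [] := by
  induction l generalizing q₀ q with
  | nil => exact ⟨q₀, q, by simpa using h, hq, by simp, rfl⟩
  | cons s ts ih =>
    have hts : ∀ x ∈ ts, 0 < x := fun x hx => hl x (List.mem_cons_of_mem _ hx)
    have hs : 1 ≤ s := hl s List.mem_cons_self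
    clear hl h
    induction s, hs using Nat.le_induction generalizing q₀ q with
    | base =>
      obtain ⟨r₀, r, h1, h2, h3, h4⟩ := ih hts (q₀ + 1) q (by omega) hq (Or.inl (by omega))
      exact ⟨r₀, r, h1, h2, by rw [h3, List.sum_cons]; ring, by rw [mixedSeries_one_cons, h4]⟩
    | succ s hs ihs =>
      obtain ⟨r₀, r, h1, h2, h3, h4⟩ := ihs 1 (q₀ :: q) one_pos
        (by simpa using ⟨hq₀, hq⟩)
      exact ⟨r₀, r, h1, h2, by rw [h3]; simp only [List.sum_cons]; ring,
        by rw [mixedSeries_succ_cons, h4]⟩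

theorem exists_connectedSeries_zero_eq (s : ℕ) (hs : 1 < s) (ts : List ℕ)
    (hts : ∀ x ∈ ts, 0 < x) :
    ∃ r₀ r, 2 ≤ r₀ ∧ (∀ x ∈ r, 0 < x) ∧ r₀ + r.sum = s + ts.sum ∧
      connectedSeries (s :: ts) 0 = mixedSeries r₀ r [] := by
  obtain ⟨s, rfl⟩ := Nat.exists_eq_add_of_lt hs
  obtain ⟨r₀, r, h1, h2, h3, h4⟩ := exists_mixedSeries_eq ((1 + s) :: ts)
    (List.forall_mem_cons.2 ⟨by omega, hts⟩) 1 [] one_pos (by simp) (Or.inr (by simp))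
  refine ⟨r₀, r, h1, h2, by rw [h3]; simp only [List.sum_cons, List.sum_nil]; ring, ?_⟩
  rw [← h4, connectedSeries_succ_cons, mixedSeries]
  simp [nestedSum]

/-! ### Half-integer sums as alternating multiple zeta values -/

/-- The summand `a ^ n / n ^ s` at `n = j + 1` of a colored multiple zeta value. -/
noncomputable def coloredWeight (p : ℕ × ℂ) (j : ℕ) : ℂ := p.2 ^ (j + 1) / ((j + 1 : ℕ) : ℂ) ^ p.1

theorem norm_coloredWeight_le {p : ℕ × ℂ} (h : p.2 ^ 2 = 1) {e : ℕ} (he : e ≤ p.1) (j : ℕ) :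
    ‖coloredWeight p j‖ ≤ 1 / ((j : ℝ) + 1) ^ e := by
  have h1 : ‖p.2‖ = 1 := by
    rcases sq_eq_one_iff.1 h with h | h <;> simp [h]
  rw [coloredWeight, norm_div, norm_pow, norm_pow, h1, one_pow, Complex.norm_natCast]
  push_cast
  exact one_div_le_one_div_of_le (by positivity) (pow_le_pow_right₀ (by simp) he)

theorem norm_nestedSum_coloredWeight_le (L : List (ℕ × ℂ)) (h : ∀ p ∈ L, 0 < p.1 ∧ p.2 ^ 2 = 1)
    (M : ℕ) : ‖nestedSum (L.map coloredWeight) M‖ ≤ 2 ^ L.length * √((M : ℝ) + 1) := by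
  induction L generalizing M with
  | nil => simp [nestedSum]
  | cons p L ih =>
    simp only [List.map_cons, nestedSum, List.length_cons]
    have hp := h p List.mem_cons_self
    have hb : ∀ j : ℕ, ‖coloredWeight p j * nestedSum (L.map coloredWeight) j‖ ≤
        2 ^ L.length * (2 * (√((j : ℝ) + 1) - √j)) := fun j => by
      rw [norm_mul]
      have h1 := ih (fun q hq => h q (List.mem_cons_of_mem _ hq)) j
      have h2 := norm_coloredWeight_le hp.2 hp.1 j
      have hj : (0 : ℝ) ≤ j := j.cast_nonneg
      have hr : √((j : ℝ) + 1) ^ 2 = j + 1 := Real.sq_sqrt (by positivity)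
      have hr' : √(j : ℝ) ^ 2 = j := Real.sq_sqrt hj
      have hpos : 0 < √((j : ℝ) + 1) := Real.sqrt_pos.2 (by positivity)
      have h3 : 1 / ((j : ℝ) + 1) ^ 1 * √((j : ℝ) + 1) ≤ 2 * (√((j : ℝ) + 1) - √j) := by
        have key : ((j : ℝ) + 1) * (2 * (√((j : ℝ) + 1) - √j)) - √((j : ℝ) + 1) =
            √((j : ℝ) + 1) * (√((j : ℝ) + 1) - √j) ^ 2 := by
          linear_combination (-(2 * (√((j : ℝ) + 1) - √j)) + √((j : ℝ) + 1)) * hr -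
            √((j : ℝ) + 1) * hr'
        rw [pow_one, one_div, inv_mul_le_iff₀ (by positivity), ← sub_nonneg, key]
        positivity
      calc _ ≤ 1 / ((j : ℝ) + 1) ^ 1 * (2 ^ L.length * √((j : ℝ) + 1)) := by gcongr
        _ = 2 ^ L.length * (1 / ((j : ℝ) + 1) ^ 1 * √((j : ℝ) + 1)) := by ring
        _ ≤ _ := by gcongr
    refine (norm_sum_le_of_le _ fun j _ => hb j).trans ?_
    rw [← mul_sum, ← mul_sum]
    have ht := sum_range_sub (fun j : ℕ => √(j : ℝ)) M
    push_cast at ht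
    rw [ht, Real.sqrt_zero, sub_zero, pow_succ, mul_assoc]
    gcongr
    linarith

theorem exists_tendsto_nestedSum_coloredWeight (p : ℕ × ℂ) (hp : 2 ≤ p.1) (hp2 : p.2 ^ 2 = 1)
    (L : List (ℕ × ℂ)) (h : ∀ p ∈ L, 0 < p.1 ∧ p.2 ^ 2 = 1) :
    ∃ z, Tendsto (nestedSum ((p :: L).map coloredWeight)) atTop (𝓝 z) := by
  have hs : Summable fun j => coloredWeight p j * nestedSum (L.map coloredWeight) j := by
    have h1 : Summable fun j : ℕ => 2 ^ L.length * (1 / ((j + 1 : ℕ) : ℝ) ^ (3 / 2 : ℝ)) :=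
      (((summable_nat_add_iff 1).2
        (Real.summable_one_div_nat_rpow.2 (by norm_num : (1 : ℝ) < 3 / 2)))).mul_left _
    refine Summable.of_norm_bounded h1 fun j => ?_
    rw [norm_mul]
    have h2 := norm_coloredWeight_le hp2 hp j
    have h3 := norm_nestedSum_coloredWeight_le L h j
    have hj : (0 : ℝ) < (j : ℝ) + 1 := by positivity
    calc _ ≤ 1 / ((j : ℝ) + 1) ^ 2 * (2 ^ L.length * √((j : ℝ) + 1)) := by gcongr
      _ = _ := by
        push_cast
        have : ((j : ℝ) + 1) ^ 2 = ((j : ℝ) + 1) ^ (3 / 2 : ℝ) * √((j : ℝ) + 1) := by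
          rw [Real.sqrt_eq_rpow, ← Real.rpow_add hj, ← Real.rpow_natCast]
          norm_num
        rw [this]
        have := Real.sqrt_pos.2 hj
        field_simp
  exact ⟨_, hs.hasSum.tendsto_sum_nat⟩

theorem multiplePartialSum_get (L : List (ℕ × ℂ)) (M : ℕ) :
    multiplePartialSum L.length (fun i => (L.get i).1) (fun i => (L.get i).2) M =
      nestedSum (L.map coloredWeight) M := by
  have h := sum_tuple_eq_nestedSum L.length
    (fun i n => (L.get i).2 ^ n / ((n : ℕ) : ℂ) ^ (L.get i).1) M
  rw [multiplePartialSum, h]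
  congr 1
  exact List.ofFn_getElem_eq_map L coloredWeight

theorem exists_tendsto_mem_CMZV (p : ℕ × ℂ) (hp : 2 ≤ p.1) (hp2 : p.2 ^ 2 = 1)
    (L : List (ℕ × ℂ)) (h : ∀ p ∈ L, 0 < p.1 ∧ p.2 ^ 2 = 1) :
    ∃ z ∈ CMZV 2 (p.1 + (L.map Prod.fst).sum),
      Tendsto (nestedSum ((p :: L).map coloredWeight)) atTop (𝓝 z) := by
  obtain ⟨z, hz⟩ := exists_tendsto_nestedSum_coloredWeight p hp hp2 L h
  have hall : ∀ x ∈ p :: L, 0 < x.1 ∧ x.2 ^ 2 = 1 :=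
    List.forall_mem_cons.2 ⟨⟨by omega, hp2⟩, h⟩
  refine ⟨z, Submodule.subset_span ⟨(p :: L).length, by simp, fun i => ((p :: L).get i).1,
    fun i => ((p :: L).get i).2, fun i => (hall _ (List.get_mem _ i)).1, ?_,
    fun i => (hall _ (List.get_mem _ i)).2, ?_, ?_⟩, hz⟩
  · rw [← List.sum_ofFn]
    have := List.ofFn_getElem_eq_map (p :: L) Prod.fst
    simp only [List.get_eq_getElem]
    rw [this]
    simp
  · rintro ⟨h1, -⟩
    simp at h1
    omega
  · simpa only [funext (multiplePartialSum_get (p :: L))] using hz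

/-- The summand `1 / n ^ q` at `n = j + 1` restricted to odd `n`. -/
noncomputable def oddWeight (q j : ℕ) : ℂ :=
  2⁻¹ * coloredWeight (q, 1) j - 2⁻¹ * coloredWeight (q, -1) j

theorem oddWeight_even (q i : ℕ) : oddWeight q (2 * i) = 1 / ((2 * i + 1 : ℕ) : ℂ) ^ q := by
  simp only [oddWeight, coloredWeight, pow_succ (-1 : ℂ), pow_mul, one_pow]
  norm_num
  ring

theorem oddWeight_odd (q i : ℕ) : oddWeight q (2 * i + 1) = 0 := by
  simp [oddWeight, coloredWeight, pow_succ (-1 : ℂ), pow_mul]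

theorem nestedSum_halfIntegerWeight (r : List ℕ) (M : ℕ) :
    ((nestedSum (r.map halfIntegerWeight) M : ℝ≥0) : ℂ) =
      2 ^ r.sum * nestedSum (r.map oddWeight) (2 * M) := by
  induction r generalizing M with
  | nil => simp [nestedSum]
  | cons q r ih =>
    simp only [List.map_cons, nestedSum, List.sum_cons]
    induction M with
    | zero => simp
    | succ M ihM =>
      rw [sum_range_succ, mul_add, mul_one, sum_range_succ, sum_range_succ, oddWeight_odd,
        oddWeight_even, zero_mul, add_zero, mul_add, ← ihM]
      push_cast
      rw [ih, halfIntegerWeight]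
      congr 1
      have h0 : (2 * (M : ℂ) + 1) ≠ 0 := by exact_mod_cast (2 * M).succ_ne_zero
      have : ((M : ℂ) + 1 / 2)⁻¹ = 2 / (2 * M + 1) := by
        rw [show (M : ℂ) + 1 / 2 = (2 * M + 1) / 2 by ring, inv_div]
      push_cast
      rw [this, div_pow]
      ring

/-- Nested alternating sums with prescribed exponents. -/
def alternatingSums (r : List ℕ) : Set (ℕ → ℂ) :=
  {g | ∃ L : List (ℕ × ℂ), L.map Prod.fst = r ∧ (∀ p ∈ L, p.2 ^ 2 = 1) ∧
    g = nestedSum (L.map coloredWeight)}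

theorem sum_coloredWeight_mul_mem_span (r : List ℕ) (p : ℕ × ℂ) (hp : p.2 ^ 2 = 1) (g : ℕ → ℂ)
    (hg : g ∈ Submodule.span ℚ (alternatingSums r)) :
    (fun M => ∑ j ∈ range M, coloredWeight p j * g j) ∈
      Submodule.span ℚ (alternatingSums (p.1 :: r)) := by
  induction hg using Submodule.span_induction with
  | mem g hg =>
    obtain ⟨L, h1, h2, rfl⟩ := hg
    exact Submodule.subset_span ⟨p :: L, by simp [h1], List.forall_mem_cons.2 ⟨hp, h2⟩,
      rfl⟩
  | zero =>
    simp only [Pi.zero_apply, mul_zero, sum_const_zero]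
    exact Submodule.zero_mem _
  | add f g _ _ hf hg =>
    convert Submodule.add_mem _ hf hg using 1
    ext M
    simp [mul_add, sum_add_distrib]
  | smul c f _ hf =>
    convert Submodule.smul_mem _ c hf using 1
    ext M
    simp [smul_sum]

theorem nestedSum_oddWeight_mem_span (r : List ℕ) :
    nestedSum (r.map oddWeight) ∈ Submodule.span ℚ (alternatingSums r) := by
  induction r with
  | nil => exact Submodule.subset_span ⟨[], by simp, by simp, rfl⟩
  | cons q r ih =>
    convert Submodule.smul_mem _ (2⁻¹ : ℚ) (Submodule.sub_mem _
      (sum_coloredWeight_mul_mem_span r (q, 1) (by simp) _ ih)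
      (sum_coloredWeight_mul_mem_span r (q, -1) (by simp) _ ih)) using 1
    ext M
    simp only [List.map_cons, nestedSum, oddWeight, Pi.smul_apply, Pi.sub_apply, Rat.smul_def,
      ← sum_sub_distrib, mul_sum]
    push_cast
    exact sum_congr rfl fun j _ => by ring

theorem exists_tendsto_of_mem_span (r₀ : ℕ) (hr₀ : 2 ≤ r₀) (r : List ℕ) (hr : ∀ x ∈ r, 0 < x)
    (g : ℕ → ℂ) (hg : g ∈ Submodule.span ℚ (alternatingSums (r₀ :: r))) :
    ∃ z ∈ CMZV 2 (r₀ + r.sum), Tendsto g atTop (𝓝 z) := by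
  induction hg using Submodule.span_induction with
  | mem g hg =>
    obtain ⟨L, h1, h2, rfl⟩ := hg
    obtain ⟨p, L, rfl, rfl, rfl⟩ := List.map_eq_cons_iff.1 h1
    refine exists_tendsto_mem_CMZV p hr₀ (h2 p List.mem_cons_self) L fun x hx =>
      ⟨hr _ (List.mem_map_of_mem hx), h2 x (List.mem_cons_of_mem _ hx)⟩
  | zero => exact ⟨0, Submodule.zero_mem _, tendsto_const_nhds⟩
  | add f g _ _ hf hg =>
    obtain ⟨z, hz, hf⟩ := hf
    obtain ⟨w, hw, hg⟩ := hg
    exact ⟨z + w, Submodule.add_mem _ hz hw, hf.add hg⟩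
  | smul c f _ hf =>
    obtain ⟨z, hz, hf⟩ := hf
    exact ⟨c • z, Submodule.smul_mem _ c hz, hf.const_smul c⟩

theorem exists_mixedSeries_nil_eq (r₀ : ℕ) (hr₀ : 2 ≤ r₀) (r : List ℕ) (hr : ∀ x ∈ r, 0 < x) :
    ∃ x : ℝ≥0, mixedSeries r₀ r [] = x ∧ ((x : ℝ) : ℂ) ∈ CMZV 2 (r₀ + r.sum) := by
  obtain ⟨z, hz, ht⟩ := exists_tendsto_of_mem_span r₀ hr₀ r hr _
    (nestedSum_oddWeight_mem_span (r₀ :: r))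
  have ht2 : Tendsto (fun M => ((nestedSum ((r₀ :: r).map halfIntegerWeight) M : ℝ≥0) : ℂ)) atTop
      (𝓝 (2 ^ (r₀ :: r).sum * z)) := by
    simp_rw [nestedSum_halfIntegerWeight]
    exact (ht.comp (tendsto_id.const_mul_atTop' two_pos)).const_mul _
  have hre := (Complex.continuous_re.tendsto _).comp ht2
  obtain ⟨x, hx⟩ : ∃ x : ℝ≥0,
      Tendsto (nestedSum ((r₀ :: r).map halfIntegerWeight)) atTop (𝓝 x) := by
    have h0 : 0 ≤ (2 ^ (r₀ :: r).sum * z).re :=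
      ge_of_tendsto' hre fun M => by simp
    exact ⟨⟨_, h0⟩, NNReal.tendsto_coe.1 (hre)⟩
  refine ⟨x, ?_, ?_⟩
  · have hs := (NNReal.hasSum_iff_tendsto_nat (f := fun i => halfIntegerWeight r₀ i *
      nestedSum (r.map halfIntegerWeight) i)).2 hx
    simpa [mixedSeries, connectedSeries] using (ENNReal.hasSum_coe.2 hs).tsum_eq
  · have hxz : ((x : ℝ) : ℂ) = 2 ^ (r₀ :: r).sum * z :=
      tendsto_nhds_unique ((Complex.continuous_ofReal.tendsto _).comp (NNReal.tendsto_coe.2 hx)) ht2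
    have := Submodule.smul_mem _ ((2 : ℚ) ^ (r₀ :: r).sum) hz
    rw [Rat.smul_def] at this
    rw [hxz]
    simpa using this

theorem multiHarmonic_eq_nestedSum {m : ℕ} (t : Fin m → ℕ) (n : ℕ) :
    multiHarmonic t n = (nestedSum ((List.ofFn t).map integerWeight) n : ℝ≥0) := by
  rw [multiHarmonic, sum_tuple_eq_nestedSum m (fun i n => 1 / (n : ℝ) ^ t i)]
  have := map_nestedSum NNReal.toRealHom ((List.ofFn t).map integerWeight) n
  rw [NNReal.coe_toRealHom] at this
  rw [this, List.map_map, List.map_ofFn]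
  congr 2
  ext i j
  simp [integerWeight]

/-- For a tuple `(t₁,…,t_m)` of positive integers with sum `u` and an
integer `s > 1`, the convergent series `∑_{n=1}^∞ (H_{n-1}^{(t₁,…,t_m)}/n^s) · 4^n · C(2n,n)⁻¹`
belongs to `CMZV²_{s+u}`. -/
theorem statement0 (m : ℕ) (t : Fin m → ℕ) (ht : ∀ i, 0 < t i) (u : ℕ) (hu : ∑ i, t i = u)
    (s : ℕ) (hs : 1 < s) :
    Summable (fun n : ℕ =>
      multiHarmonic t n / ((n + 1 : ℕ) : ℝ) ^ s * 4 ^ (n + 1)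
        / (Nat.choose (2 * (n + 1)) (n + 1) : ℝ)) ∧
    ((↑(∑' n : ℕ, multiHarmonic t n / ((n + 1 : ℕ) : ℝ) ^ s * 4 ^ (n + 1)
        / (Nat.choose (2 * (n + 1)) (n + 1) : ℝ)) : ℂ) ∈ CMZV 2 (s + u)) := by
  obtain ⟨r₀, r, hr₀, hr, hsum, heq⟩ := exists_connectedSeries_zero_eq s hs (List.ofFn t)
    (by simpa [List.forall_mem_ofFn_iff] using ht)
  obtain ⟨x, hx, hmem⟩ := exists_mixedSeries_nil_eq r₀ hr₀ r hr
  rw [hsum, List.sum_ofFn, hu] at hmem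
  rw [hx] at heq
  have hterm : ∀ n : ℕ, multiHarmonic t n / ((n + 1 : ℕ) : ℝ) ^ s * 4 ^ (n + 1)
      / (Nat.choose (2 * (n + 1)) (n + 1) : ℝ) =
      ((integerWeight s n * connector (n + 1) 0 *
        nestedSum ((List.ofFn t).map integerWeight) n : ℝ≥0) : ℝ) := fun n => by
    rw [multiHarmonic_eq_nestedSum, connector_zero_right, integerWeight]
    push_cast
    rw [inv_pow]
    ring
  have hsum' : HasSum (fun n => integerWeight s n * connector (n + 1) 0 *
      nestedSum ((List.ofFn t).map integerWeight) n) x := by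
    rw [← ENNReal.hasSum_coe, ← heq]
    exact ENNReal.summable.hasSum
  have hfin := NNReal.hasSum_coe.2 hsum'
  simp_rw [hterm]
  exact ⟨hfin.summable, hfin.tsum_eq ▸ hmem⟩
end

section
/- Let (t₁,…,t_m) be a (possibly empty) tuple of positive integers with t₁+⋯+t_m = u, and let s ≥ 1 be an integer. Then the convergent series ∑_{n=1}^∞ (H_{n-1}^{(t₁,…,t_m)}/n^s)·4^{-n}·binom(2n,n) belongs to CMZV²_{s+u}, the ℚ-linear span in ℂ of colored multiple zeta values of level 2 and weight s+u. -/
open scoped BigOperators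

namespace CentralBinomialSum

open Finset Filter Topology Asymptotics

/-! ### Nested sums -/

/-- The nested sum `∑_{M ≥ n₁ > ⋯ > n_k ≥ 1} ∏ᵢ fᵢ(nᵢ)`. -/
def nestedSum {R : Type*} [CommSemiring R] (k : ℕ) (f : Fin k → ℕ → R) (M : ℕ) : R :=
  ∑ n : Fin k → Fin (M + 1),
    if (∀ i j : Fin k, i < j → (n j : ℕ) < (n i : ℕ)) ∧ (∀ i, 0 < (n i : ℕ)) then
      ∏ i, f i (n i)
    else 0

lemma nestedSum_eq_sum_filter {R : Type*} [CommSemiring R] (k : ℕ) (f : Fin k → ℕ → R) (M : ℕ) :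
    nestedSum k f M = ∑ x ∈ (Fintype.piFinset fun _ : Fin k => range (M + 1)) with
      (∀ i j : Fin k, i < j → x j < x i) ∧ (∀ i, 0 < x i), ∏ i, f i (x i) := by
  rw [sum_filter, nestedSum]
  refine sum_bij (fun x _ i => (x i : ℕ)) ?_ ?_ ?_ ?_
  · intro x _
    simp only [Fintype.mem_piFinset, mem_range]
    exact fun i => (x i).2
  · intro x _ y _ h
    funext i
    exact Fin.ext (congrFun h i)
  · intro y hy
    simp only [Fintype.mem_piFinset, mem_range] at hy
    exact ⟨fun i => ⟨y i, hy i⟩, mem_univ _, rfl⟩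
  · intro x _
    rfl

lemma nestedSum_zero {R : Type*} [CommSemiring R] (f : Fin 0 → ℕ → R) (M : ℕ) :
    nestedSum 0 f M = 1 := by
  simp [nestedSum]

lemma nestedSum_succ {R : Type*} [CommSemiring R] (k : ℕ) (f : Fin (k + 1) → ℕ → R) (M : ℕ) :
    nestedSum (k + 1) f M =
      ∑ n ∈ range M, f 0 (n + 1) * nestedSum k (fun i => f i.succ) n := by
  simp only [nestedSum_eq_sum_filter, mul_sum]
  rw [sum_sigma']
  symm
  refine sum_nbij' (fun p => Fin.cons (p.1 + 1) p.2) (fun x => ⟨x 0 - 1, Fin.tail x⟩)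
    ?_ ?_ ?_ ?_ ?_
  · rintro ⟨n, y⟩ h
    simp only [mem_sigma, mem_range, mem_filter, Fintype.mem_piFinset] at h ⊢
    obtain ⟨hn, hy, hlt, hpos⟩ := h
    refine ⟨?_, ?_, ?_⟩
    · intro i
      refine Fin.cases ?_ (fun i => ?_) i
      · simpa using hn
      · simpa using (hy i).trans (Nat.succ_lt_succ hn)
    · intro i j
      refine Fin.cases ?_ (fun i => ?_) i <;> refine Fin.cases ?_ (fun j => ?_) j
      · simp
      · intro _
        simpa using hy j
      · intro h
        exact absurd h (by simp)
      · intro h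
        simpa using hlt i j (by simpa using h)
    · intro i
      refine Fin.cases ?_ (fun i => ?_) i
      · simp
      · simpa using hpos i
  · intro x h
    simp only [mem_sigma, mem_range, mem_filter, Fintype.mem_piFinset] at h ⊢
    obtain ⟨hx, hlt, hpos⟩ := h
    have h0 := hx 0
    have h1 := hpos 0
    refine ⟨by omega, fun i => ?_, fun i j hij => hlt _ _ (by simpa using hij),
      fun i => hpos _⟩
    have := hlt 0 i.succ (Fin.succ_pos i)
    simp only [Fin.tail]
    omega
  · rintro ⟨n, y⟩ _
    simp
  · intro x h
    simp only [mem_filter] at h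
    have h1 := h.2.2 0
    have : x 0 - 1 + 1 = x 0 := by omega
    simp only [this]
    exact Fin.cons_self_tail x
  · rintro ⟨n, y⟩ _
    simp [Fin.prod_univ_succ]

/-- The operator sending `f` to `M ↦ ∑_{1 ≤ n ≤ M} εⁿ n⁻ˢ f(n-1)`. -/
noncomputable def nest (s : ℕ) (ε : ℂ) : (ℕ → ℂ) →ₗ[ℂ] (ℕ → ℂ) where
  toFun f M := ∑ n ∈ range M, ε ^ (n + 1) / ((n + 1 : ℕ) : ℂ) ^ s * f n
  map_add' f g := by
    funext M
    simp [mul_add, sum_add_distrib]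
  map_smul' c f := by
    funext M
    simp only [Pi.smul_apply, smul_eq_mul, RingHom.id_apply, mul_sum]
    exact sum_congr rfl fun n _ => by ring

lemma nest_apply (s : ℕ) (ε : ℂ) (f : ℕ → ℂ) (M : ℕ) :
    nest s ε f M = ∑ n ∈ range M, ε ^ (n + 1) / ((n + 1 : ℕ) : ℂ) ^ s * f n := rfl

lemma nest_zero (s : ℕ) (ε : ℂ) (f : ℕ → ℂ) : nest s ε f 0 = 0 := by
  simp [nest_apply]

lemma nest_succ (s : ℕ) (ε : ℂ) (f : ℕ → ℂ) (M : ℕ) :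
    nest s ε f (M + 1) = nest s ε f M + ε ^ (M + 1) / ((M + 1 : ℕ) : ℂ) ^ s * f M := by
  rw [nest_apply, sum_range_succ, ← nest_apply]

lemma nest_mul_nest (s r : ℕ) (ε η : ℂ) (f g : ℕ → ℂ) :
    nest s ε f * nest r η g = nest s ε (f * nest r η g) + nest r η (nest s ε f * g) +
      nest (s + r) (ε * η) (f * g) := by
  funext M
  induction M with
  | zero => simp [nest_zero]
  | succ M ih =>
    simp only [Pi.mul_apply, Pi.add_apply, nest_succ] at ih ⊢
    have h : ((M + 1 : ℕ) : ℂ) ≠ 0 := by exact_mod_cast M.succ_ne_zero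
    rw [mul_pow, pow_add _ s r]
    generalize ((M + 1 : ℕ) : ℂ) = x at *
    field_simp
    linear_combination x ^ s * x ^ r * ih

lemma nest_shift_nest (s r : ℕ) (ε η : ℂ) (f : ℕ → ℂ) :
    nest s ε (fun n => nest r η f (n + 1)) =
      nest s ε (nest r η f) + nest (s + r) (ε * η) f := by
  funext M
  simp only [Pi.add_apply, nest_apply s, nest_apply (s + r), nest_succ, ← sum_add_distrib]
  refine sum_congr rfl fun n _ => ?_
  have h : ((n + 1 : ℕ) : ℂ) ≠ 0 := by exact_mod_cast n.succ_ne_zero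
  rw [mul_pow, pow_add _ s r]
  field_simp

lemma nest_smul_rat (s : ℕ) (ε : ℂ) (q : ℚ) (f : ℕ → ℂ) : nest s ε (q • f) = q • nest s ε f :=
  map_rat_smul _ _ _

/-- The rational combinations of partial sums of colored multiple zeta values of level `2` and
weight `w`. -/
inductive ColoredSum : ℕ → (ℕ → ℂ) → Prop
  | one : ColoredSum 0 1
  | nest {w s : ℕ} {ε : ℂ} {f : ℕ → ℂ} (hf : ColoredSum w f) (hs : 0 < s) (hε : ε ^ 2 = 1) :
      ColoredSum (w + s) (nest s ε f)
  | add {w : ℕ} {f g : ℕ → ℂ} (hf : ColoredSum w f) (hg : ColoredSum w g) : ColoredSum w (f + g)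
  | smul {w : ℕ} {f : ℕ → ℂ} (q : ℚ) (hf : ColoredSum w f) : ColoredSum w (q • f)

namespace ColoredSum

lemma sub {w : ℕ} {f g : ℕ → ℂ} (hf : ColoredSum w f) (hg : ColoredSum w g) :
    ColoredSum w (f - g) := by
  have := hf.add (hg.smul (-1))
  rwa [neg_one_smul, ← sub_eq_add_neg] at this

lemma of_eq {w v : ℕ} {f : ℕ → ℂ} (hf : ColoredSum w f) (h : w = v) : ColoredSum v f := h ▸ hf

lemma mul {w v : ℕ} {f g : ℕ → ℂ} (hf : ColoredSum w f) (hg : ColoredSum v g) :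
    ColoredSum (w + v) (f * g) := by
  induction hf generalizing v g with
  | one => simpa using hg
  | add _ _ ih₁ ih₂ => rw [add_mul]; exact (ih₁ hg).add (ih₂ hg)
  | smul q _ ih => rw [smul_mul_assoc]; exact (ih hg).smul q
  | @nest w s ε f hf hs hε ih =>
    induction hg with
    | one => simpa using hf.nest hs hε
    | add _ _ ih₁ ih₂ => rw [mul_add]; exact ih₁.add ih₂
    | smul q _ ih => rw [mul_smul_comm]; exact ih.smul q
    | @nest v r η g hg hr hη ih' =>
      rw [nest_mul_nest]
      refine ((((ih (hg.nest hr hη)).nest hs hε).of_eq ?_).add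
        ((ih'.nest hr hη).of_eq ?_)).add
        (((ih hg).nest (ε := ε * η) (Nat.add_pos_left hs r) ?_).of_eq ?_)
      · ring
      · ring
      · rw [mul_pow, hε, hη, one_mul]
      · ring

lemma nest_shift {w s : ℕ} {ε : ℂ} {f : ℕ → ℂ} (hf : ColoredSum w f) (hs : 0 < s)
    (hε : ε ^ 2 = 1) : ColoredSum (w + s) (CentralBinomialSum.nest s ε fun n => f (n + 1)) := by
  induction hf with
  | one => exact one.nest hs hε
  | @add w f g _ _ ih₁ ih₂ =>
    have := ih₁.add ih₂
    rwa [← map_add] at this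
  | @smul w f q _ ih =>
    have := ih.smul q
    rwa [← nest_smul_rat] at this
  | @nest v r η g hg hr hη =>
    rw [nest_shift_nest]
    refine ((hg.nest hr hη).nest hs hε).add ((hg.nest (ε := ε * η) (Nat.add_pos_left hs r)
      ?_).of_eq ?_)
    · rw [mul_pow, hε, hη, one_mul]
    · ring

end ColoredSum

/-! ### Growth -/

/-- The comparison function `1 + log (n + 1)`. -/
noncomputable def logScale (n : ℕ) : ℝ := 1 + Real.log (n + 1)

lemma one_le_logScale (n : ℕ) : 1 ≤ logScale n := by
  have : (0 : ℝ) ≤ n := n.cast_nonneg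
  have := Real.log_nonneg (x := n + 1) (by linarith)
  rw [logScale]
  linarith

lemma logScale_mono : Monotone logScale := by
  intro a b h
  have ha : (0 : ℝ) ≤ a := a.cast_nonneg
  have hb : (a : ℝ) ≤ b := by exact_mod_cast h
  have := Real.log_le_log (x := (a : ℝ) + 1) (y := b + 1) (by linarith) (by linarith)
  rw [logScale, logScale]
  linarith

lemma sum_inv_le_logScale (n : ℕ) : ∑ k ∈ range n, 1 / ((k : ℝ) + 1) ≤ logScale n := by
  have h := harmonic_le_one_add_log n
  rw [harmonic] at h
  push_cast at h
  simp only [one_div]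
  refine h.trans ?_
  rw [logScale]
  rcases Nat.eq_zero_or_pos n with rfl | hn
  · simp
  · have : (0 : ℝ) < n := by exact_mod_cast hn
    have := Real.log_le_log (x := (n : ℝ)) (y := n + 1) this (by linarith)
    linarith

lemma tendsto_natCast_add_one : Tendsto (fun n : ℕ => (n : ℝ) + 1) atTop atTop :=
  tendsto_atTop_add_const_right _ _ tendsto_natCast_atTop_atTop

/-- `(log n)^k n^a`, suitably shifted. -/
noncomputable def scale (k : ℕ) (a : ℝ) (n : ℕ) : ℝ := logScale n ^ k * ((n : ℝ) + 1) ^ a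

lemma scale_pos (k : ℕ) (a : ℝ) (n : ℕ) : 0 < scale k a n :=
  mul_pos (pow_pos (by linarith [one_le_logScale n]) _) (Real.rpow_pos_of_pos (by positivity) _)

lemma scale_mul (k l : ℕ) (a b : ℝ) (n : ℕ) :
    scale k a n * scale l b n = scale (k + l) (a + b) n := by
  simp only [scale]
  rw [pow_add, Real.rpow_add (by positivity)]
  ring

lemma scale_zero_zero (n : ℕ) : scale 0 0 n = 1 := by simp [scale]

lemma scale_isBigO_of_le {k l : ℕ} {a b : ℝ} (hk : k ≤ l) (hab : a ≤ b) :
    scale k a =O[atTop] scale l b := by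
  refine IsBigO.of_bound 1 (Eventually.of_forall fun n => ?_)
  rw [one_mul, Real.norm_of_nonneg (scale_pos ..).le, Real.norm_of_nonneg (scale_pos ..).le]
  have hn : (0 : ℝ) ≤ n := n.cast_nonneg
  exact mul_le_mul (pow_le_pow_right₀ (one_le_logScale n) hk)
    (Real.rpow_le_rpow_of_exponent_le (by linarith) hab)
    (Real.rpow_nonneg (by linarith) _) (pow_nonneg (by linarith [one_le_logScale n]) _)

lemma scale_isLittleO {k : ℕ} {a b : ℝ} (hab : a < b) :
    scale k a =o[atTop] scale 0 b := by
  have h1 : (fun x : ℝ => (1 + Real.log x) ^ k) =o[atTop] fun x => x ^ (b - a) := by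
    have h0 : (fun x : ℝ => 1 + Real.log x) =O[atTop] Real.log := by
      refine IsBigO.add ?_ (isBigO_refl _ _)
      exact Real.isLittleO_const_log_atTop.isBigO
    have h2 := isLittleO_log_rpow_rpow_atTop (s := b - a) k (sub_pos.2 hab)
    simp only [Real.rpow_natCast] at h2
    exact (h0.pow k).trans_isLittleO h2
  have h2 := h1.comp_tendsto tendsto_natCast_add_one
  have h3 := h2.mul_isBigO (isBigO_refl (fun n : ℕ => ((n : ℝ) + 1) ^ a) atTop)
  refine h3.congr (fun n => rfl) fun n => ?_
  simp only [Function.comp, scale, pow_zero, one_mul]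
  rw [← Real.rpow_add (by positivity)]
  ring_nf

lemma scale_tendsto_zero (k : ℕ) {a : ℝ} (ha : a < 0) :
    Tendsto (scale k a) atTop (𝓝 0) := by
  have := scale_isLittleO (k := k) ha
  have h := this.congr_right (g₂ := fun _ => (1 : ℝ)) scale_zero_zero
  exact (isLittleO_one_iff ℝ).1 h

lemma scale_shift_isTheta (k : ℕ) (a : ℝ) :
    (fun n => scale k a (n + 1)) =Θ[atTop] scale k a := by
  have h1 : (fun n => logScale (n + 1)) =Θ[atTop] logScale := by
    constructor
    · refine IsBigO.of_bound 2 (Eventually.of_forall fun n => ?_)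
      have h := one_le_logScale n
      rw [Real.norm_of_nonneg (by linarith [one_le_logScale (n + 1)]),
        Real.norm_of_nonneg (by linarith)]
      have hn : (0 : ℝ) ≤ n := n.cast_nonneg
      have h2 : logScale (n + 1) ≤ logScale n + Real.log 2 := by
        rw [logScale, logScale, add_assoc, ← Real.log_mul (by linarith) (by norm_num)]
        have := Real.log_le_log (x := ((n + 1 : ℕ) : ℝ) + 1) (y := ((n : ℝ) + 1) * 2)
          (by positivity) (by push_cast; linarith)
        linarith
      have := Real.log_two_lt_d9
      linarith
    · refine IsBigO.of_bound 1 (Eventually.of_forall fun n => ?_)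
      rw [one_mul, Real.norm_of_nonneg (by linarith [one_le_logScale n]),
        Real.norm_of_nonneg (by linarith [one_le_logScale (n + 1)])]
      exact logScale_mono n.le_succ
  have h2 : (fun n : ℕ => ((n + 1 : ℕ) : ℝ) + 1) =Θ[atTop] fun n : ℕ => (n : ℝ) + 1 := by
    constructor
    · refine IsBigO.of_bound 2 (Eventually.of_forall fun n => ?_)
      rw [Real.norm_of_nonneg (by positivity), Real.norm_of_nonneg (by positivity)]
      push_cast
      linarith [n.cast_nonneg (α := ℝ)]
    · refine IsBigO.of_bound 1 (Eventually.of_forall fun n => ?_)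
      rw [Real.norm_of_nonneg (by positivity), Real.norm_of_nonneg (by positivity)]
      push_cast
      linarith [n.cast_nonneg (α := ℝ)]
  have h3 := h2.rpow (r := a) (Eventually.of_forall fun n => by simp only [Pi.zero_apply]; positivity)
    (Eventually.of_forall fun n => by simp only [Pi.zero_apply]; positivity)
  exact (h1.pow k).mul h3

/-- `f` is bounded by a power of the logarithm times `n ^ a`. -/
def LogBigO {E : Type*} [NormedField E] (a : ℝ) (f : ℕ → E) : Prop := ∃ k, f =O[atTop] scale k a

namespace LogBigO

variable {E : Type*} [NormedField E] {a b : ℝ} {f g : ℕ → E}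

lemma add (hf : LogBigO a f) (hg : LogBigO a g) : LogBigO a (f + g) := by
  obtain ⟨k, hk⟩ := hf
  obtain ⟨l, hl⟩ := hg
  exact ⟨max k l, (hk.trans (scale_isBigO_of_le (le_max_left _ _) le_rfl)).add
    (hl.trans (scale_isBigO_of_le (le_max_right _ _) le_rfl))⟩

lemma neg (hf : LogBigO a f) : LogBigO a (-f) := by
  obtain ⟨k, hk⟩ := hf
  exact ⟨k, hk.neg_left⟩

lemma sub (hf : LogBigO a f) (hg : LogBigO a g) : LogBigO a (f - g) := by
  rw [sub_eq_add_neg]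
  exact hf.add hg.neg

lemma mul (hf : LogBigO a f) (hg : LogBigO b g) : LogBigO (a + b) (f * g) := by
  obtain ⟨k, hk⟩ := hf
  obtain ⟨l, hl⟩ := hg
  exact ⟨k + l, (hk.mul hl).congr_right fun n => scale_mul ..⟩

lemma shift (hf : LogBigO a f) : LogBigO a fun n => f (n + 1) := by
  obtain ⟨k, hk⟩ := hf
  exact ⟨k, (hk.comp_tendsto (tendsto_add_atTop_nat 1)).trans (scale_shift_isTheta k a).isBigO⟩

lemma of_shift (hf : LogBigO a fun n => f (n + 1)) : LogBigO a f := by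
  obtain ⟨k, hk⟩ := hf
  refine ⟨k, ?_⟩
  rw [← map_add_atTop_eq_nat 1, isBigO_map]
  exact hk.trans (scale_shift_isTheta k a).symm.isBigO

lemma isBigO (hf : LogBigO a f) (hab : a < b) : f =O[atTop] scale 0 b := by
  obtain ⟨k, hk⟩ := hf
  exact hk.trans (scale_isLittleO hab).isBigO

lemma of_norm_le {F : Type*} [NormedField F] {h : ℕ → F} (hf : LogBigO a f)
    (hle : ∀ n, ‖h n‖ ≤ ‖f n‖) : LogBigO a h := by
  obtain ⟨k, hk⟩ := hf
  exact ⟨k, (IsBigO.of_norm_le hle).trans hk.norm_left⟩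

lemma const (c : E) : LogBigO 0 (fun _ => c) :=
  ⟨0, (isBigO_const_const c one_ne_zero _).congr_right fun n => (scale_zero_zero n).symm⟩

lemma smul {c : E} (hf : LogBigO a f) : LogBigO a (c • f) := by
  have := (const c).mul hf
  rwa [zero_add] at this

lemma tendsto_zero (hf : LogBigO a f) (ha : a < 0) : Tendsto f atTop (𝓝 0) := by
  obtain ⟨k, hk⟩ := hf
  exact hk.trans_tendsto (scale_tendsto_zero k ha)

lemma mono (hf : LogBigO a f) (hab : a ≤ b) : LogBigO b f := by
  obtain ⟨k, hk⟩ := hf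
  exact ⟨k, hk.trans (scale_isBigO_of_le le_rfl hab)⟩

end LogBigO

lemma logBigO_inv_natCast_add_one (E : Type*) [RCLike E] :
    LogBigO (-1) fun n : ℕ => (1 / ((n + 1 : ℕ) : E)) := by
  refine ⟨0, IsBigO.of_bound 1 (Eventually.of_forall fun n => ?_)⟩
  rw [one_mul, Real.norm_of_nonneg (scale_pos ..).le, norm_div, norm_one, RCLike.norm_natCast]
  simp [scale, Real.rpow_neg_one]

lemma logBigO_sum_div {f : ℕ → ℝ} (hf : LogBigO 0 f) :
    LogBigO 0 fun M => ∑ n ∈ range M, f n / (n + 1) := by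
  obtain ⟨k, hk⟩ := hf
  obtain ⟨C, hC, h⟩ := bound_of_isBigO_nat_atTop hk
  refine ⟨k + 1, IsBigO.of_bound C (Eventually.of_forall fun M => ?_)⟩
  have hb : ∀ n, ‖f n‖ ≤ C * logScale n ^ k := fun n => by
    have := h (x := n) (scale_pos ..).ne'
    rwa [Real.norm_of_nonneg (scale_pos ..).le, scale, Real.rpow_zero, mul_one] at this
  rw [Real.norm_of_nonneg (scale_pos ..).le, scale, Real.rpow_zero, mul_one]
  have hM := one_le_logScale M
  calc ‖∑ n ∈ range M, f n / (n + 1)‖ ≤ ∑ n ∈ range M, C * logScale M ^ k * (1 / (n + 1)) := by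
        refine norm_sum_le_of_le _ fun n hn => ?_
        rw [norm_div, div_eq_mul_one_div, Real.norm_of_nonneg (r := (n : ℝ) + 1) (by positivity)]
        refine mul_le_mul_of_nonneg_right ((hb n).trans ?_) (by positivity)
        refine mul_le_mul_of_nonneg_left (pow_le_pow_left₀ (by linarith [one_le_logScale n])
          (logScale_mono (mem_range.1 hn).le) _) hC.le
    _ ≤ C * logScale M ^ k * logScale M := by
        rw [← mul_sum]
        exact mul_le_mul_of_nonneg_left (sum_inv_le_logScale M)
          (mul_nonneg hC.le (pow_nonneg (by linarith) _))
    _ = C * logScale M ^ (k + 1) := by ring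

/-- A sequence whose increments are `O(n ^ (-3/2))` converges at rate `O(n ^ (-1/2))`. -/
lemma exists_limit_of_increment {f : ℕ → ℂ}
    (hf : (fun n => f (n + 1) - f n) =O[atTop] scale 0 (-3 / 2)) :
    ∃ L : ℂ, LogBigO (-1 / 2) fun n => f n - L := by
  obtain ⟨C, hC, h⟩ := bound_of_isBigO_nat_atTop hf
  set g : ℕ → ℝ := fun n => 4 * C * ((n : ℝ) + 1) ^ (-1 / 2 : ℝ) with hg
  have hstep : ∀ n, ‖f (n + 1) - f n‖ ≤ g n - g (n + 1) := by
    intro n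
    have h1 := h (x := n) (scale_pos ..).ne'
    rw [Real.norm_of_nonneg (scale_pos ..).le, scale, pow_zero, one_mul] at h1
    refine h1.trans ?_
    simp only [hg]
    rw [← mul_sub, mul_comm 4 C, mul_assoc]
    refine mul_le_mul_of_nonneg_left ?_ hC.le
    have hx : (0 : ℝ) < n + 1 := by positivity
    have e1 : ((n : ℝ) + 1) ^ (-3 / 2 : ℝ) = 1 / (((n : ℝ) + 1) * √(n + 1)) := by
      rw [show (-3 / 2 : ℝ) = -(1 + 1 / 2) by norm_num, Real.rpow_neg hx.le, Real.rpow_add hx,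
        Real.rpow_one, Real.sqrt_eq_rpow, one_div ((_ : ℝ) * _)]
    have e2 : ∀ y : ℝ, 0 < y → y ^ (-1 / 2 : ℝ) = 1 / √y := fun y hy => by
      rw [show (-1 / 2 : ℝ) = -(1 / 2) by norm_num, Real.rpow_neg hy.le, Real.sqrt_eq_rpow,
        one_div (_ ^ _)]
    rw [e1, e2 _ hx, e2 _ (by positivity)]
    push_cast
    have hxs := Real.sq_sqrt hx.le
    have hys := Real.sq_sqrt (show (0 : ℝ) ≤ n + 1 + 1 by positivity)
    have hxp := Real.sqrt_pos.2 hx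
    have hyp := Real.sqrt_pos.2 (show (0 : ℝ) < n + 1 + 1 by positivity)
    have hn : (0 : ℝ) ≤ n := n.cast_nonneg
    generalize hp : √((n : ℝ) + 1) = p at *
    generalize hq : √((n : ℝ) + 1 + 1) = q at *
    have hx' : (n : ℝ) + 1 = p ^ 2 := hxs.symm
    have hqp : q ^ 2 = p ^ 2 + 1 := by rw [hys, ← hx']
    have hp1 : 1 ≤ p ^ 2 := by rw [← hx']; linarith
    rw [hx', div_sub_div _ _ hxp.ne' hyp.ne', mul_div_assoc', div_le_div_iff₀ (by positivity)
      (by positivity)]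
    have hq2 : q ≤ 2 * p := by nlinarith
    have hq3 : (q - p) * (q + p) = 1 := by nlinarith
    have hq4 : 1 ≤ (q - p) * (3 * p) := by
      have : p < q := by nlinarith
      nlinarith
    have h5 : q ≤ 4 * (q - p) * p ^ 2 := by
      have : p < q := by nlinarith
      nlinarith [mul_le_mul_of_nonneg_left hq4 hxp.le]
    nlinarith [mul_le_mul_of_nonneg_right h5 hxp.le]
  have hg0 : Tendsto g atTop (𝓝 0) := by
    have := (scale_tendsto_zero 0 (a := -1 / 2) (by norm_num)).const_mul (4 * C)
    simpa [scale, hg] using this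
  have htail : ∀ n m, ‖f (n + m) - f n‖ ≤ g n - g (n + m) := by
    intro n m
    induction m with
    | zero => simp
    | succ m ih =>
      calc ‖f (n + (m + 1)) - f n‖ = ‖(f (n + m + 1) - f (n + m)) + (f (n + m) - f n)‖ := by
            rw [sub_add_sub_cancel]; rfl
        _ ≤ (g (n + m) - g (n + m + 1)) + (g n - g (n + m)) :=
            (norm_add_le _ _).trans (add_le_add (hstep _) ih)
        _ = g n - g (n + (m + 1)) := by rw [← add_assoc]; ring
  have hgn : ∀ n, 0 ≤ g n := fun n => by positivity
  have hcauchy : CauchySeq f := by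
    refine cauchySeq_of_le_tendsto_0 (fun n => 2 * g n) (fun n m N hn hm => ?_)
      (by simpa using hg0.const_mul 2)
    obtain ⟨i, rfl⟩ := Nat.exists_eq_add_of_le hn
    obtain ⟨j, rfl⟩ := Nat.exists_eq_add_of_le hm
    have hi := htail N i
    have hj := htail N j
    have := dist_triangle_right (f (N + i)) (f (N + j)) (f N)
    rw [dist_eq_norm, dist_eq_norm (f (N + i)), dist_eq_norm (f (N + j))] at this
    rw [dist_eq_norm]
    linarith [hgn (N + i), hgn (N + j)]
  obtain ⟨L, hL⟩ := cauchySeq_tendsto_of_complete hcauchy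
  refine ⟨L, 0, IsBigO.of_bound (4 * C) (Eventually.of_forall fun n => ?_)⟩
  rw [Real.norm_of_nonneg (scale_pos ..).le, scale, pow_zero, one_mul]
  have h1 : Tendsto (fun m => ‖f (n + m) - f n‖) atTop (𝓝 ‖L - f n‖) := by
    refine Tendsto.norm (Tendsto.sub_const ?_ _)
    have := (tendsto_add_atTop_iff_nat (f := f) n).2 hL
    simpa [add_comm] using this
  rw [norm_sub_rev]
  exact le_of_tendsto h1 (Eventually.of_forall fun m =>
    (htail n m).trans (sub_le_self _ (hgn _)))

/-! ### Growth and convergence of colored sums -/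

lemma norm_eq_one_of_sq_eq_one {ε : ℂ} (hε : ε ^ 2 = 1) : ‖ε‖ = 1 := by
  have h : ‖ε‖ ^ 2 = 1 := by rw [← norm_pow, hε, norm_one]
  exact (pow_eq_one_iff_of_nonneg (norm_nonneg _) two_ne_zero).1 h

lemma logBigO_inv_pow (s : ℕ) : LogBigO (-(s : ℝ)) fun n : ℕ => (1 / ((n + 1 : ℕ) : ℂ)) ^ s := by
  induction s with
  | zero => simpa using LogBigO.const (1 : ℂ)
  | succ s ih =>
    have h := ih.mul (logBigO_inv_natCast_add_one ℂ)
    have e : -(s : ℝ) + -1 = -((s + 1 : ℕ) : ℝ) := by push_cast; ring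
    rw [e] at h
    exact h.of_norm_le fun n => by simp [pow_succ]

lemma LogBigO.nest_term {f : ℕ → ℂ} (hf : LogBigO 0 f) {ε : ℂ} (hε : ε ^ 2 = 1) (s : ℕ) :
    LogBigO (-(s : ℝ)) fun n => ε ^ (n + 1) / ((n + 1 : ℕ) : ℂ) ^ s * f n := by
  have h := (logBigO_inv_pow s).mul hf
  rw [add_zero] at h
  refine h.of_norm_le fun n => ?_
  rw [Pi.mul_apply, norm_mul, norm_mul, norm_div, norm_pow, norm_eq_one_of_sq_eq_one hε, one_pow,
    one_div_pow, norm_div, norm_one]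

lemma LogBigO.nest {f : ℕ → ℂ} (hf : LogBigO 0 f) {ε : ℂ} (hε : ε ^ 2 = 1) {s : ℕ} (hs : 0 < s) :
    LogBigO 0 (nest s ε f) := by
  have h1 : LogBigO 0 fun n => ‖f n‖ := hf.of_norm_le fun n => by simp
  refine (logBigO_sum_div h1).of_norm_le fun M => ?_
  rw [Real.norm_of_nonneg (sum_nonneg fun n _ => by positivity), nest_apply]
  refine norm_sum_le_of_le _ fun n _ => ?_
  rw [norm_mul, norm_div, norm_pow, norm_pow, norm_eq_one_of_sq_eq_one hε, one_pow,
    Complex.norm_natCast, div_eq_mul_one_div ‖f n‖, mul_comm]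
  refine mul_le_mul_of_nonneg_left ?_ (norm_nonneg _)
  push_cast
  have hn : (1 : ℝ) ≤ n + 1 := by linarith [n.cast_nonneg (α := ℝ)]
  exact one_div_le_one_div_of_le (by linarith) (le_self_pow₀ hn hs.ne')

lemma rat_smul_eq (q : ℚ) (f : ℕ → ℂ) : q • f = (q : ℂ) • f := by
  funext n
  simp [Rat.smul_def]

namespace ColoredSum

lemma logBigO {w : ℕ} {f : ℕ → ℂ} (hf : ColoredSum w f) : LogBigO 0 f := by
  induction hf with
  | one => exact LogBigO.const 1
  | nest _ hs hε ih => exact ih.nest hε hs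
  | add _ _ ih₁ ih₂ => exact ih₁.add ih₂
  | smul q _ ih => rw [rat_smul_eq]; exact ih.smul

lemma logBigO_increment {w : ℕ} {f : ℕ → ℂ} (hf : ColoredSum w f) :
    LogBigO (-1) fun n => f (n + 1) - f n := by
  induction hf with
  | one => exact (logBigO_inv_natCast_add_one ℂ).of_norm_le fun n => by simp
  | nest hf hs hε =>
    simp only [nest_succ, add_sub_cancel_left]
    refine (hf.logBigO.nest_term hε _).mono ?_
    have : (1 : ℝ) ≤ (_ : ℕ) := Nat.one_le_cast.2 hs
    linarith
  | add _ _ ih₁ ih₂ =>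
    refine (ih₁.add ih₂).of_norm_le fun n => le_of_eq ?_
    simp only [Pi.add_apply]
    ring_nf
  | @smul w f q _ ih =>
    rw [rat_smul_eq q f]
    simp only [Pi.smul_apply, ← smul_sub]
    exact ih.smul (c := (q : ℂ))

end ColoredSum

lemma eq_neg_one_of_sq_eq_one {ε : ℂ} (hε : ε ^ 2 = 1) (h : ε ≠ 1) : ε = -1 :=
  (sq_eq_one_iff.1 hε).resolve_left h

lemma exists_limit_nest {w s : ℕ} {ε : ℂ} {f : ℕ → ℂ} (hf : ColoredSum w f) (hs : 0 < s)
    (hε : ε ^ 2 = 1) (h : ¬(s = 1 ∧ ε = 1)) :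
    ∃ L : ℂ, LogBigO (-1 / 2) fun n => nest s ε f n - L := by
  by_cases hs1 : s = 1
  · subst hs1
    obtain rfl := eq_neg_one_of_sq_eq_one hε fun h' => h ⟨rfl, h'⟩
    set u : ℕ → ℂ := fun n => f n / ((n + 1 : ℕ) : ℂ) with hu
    have hub : LogBigO (-1) u := by
      have := hf.logBigO.mul (logBigO_inv_natCast_add_one ℂ)
      rw [zero_add] at this
      exact this.of_norm_le fun n => by simp [hu, div_eq_mul_inv]
    have hdu : LogBigO (-2) fun n => u n - u (n + 1) := by
      have h1 := (hf.logBigO_increment.mul (logBigO_inv_natCast_add_one ℂ).shift).neg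
      have h2 := hf.logBigO.mul ((logBigO_inv_natCast_add_one ℂ).mul
        (logBigO_inv_natCast_add_one ℂ).shift)
      norm_num at h1 h2
      refine (h1.add h2).of_norm_le fun n => le_of_eq ?_
      congr 1
      simp only [hu, Pi.add_apply, Pi.neg_apply, Pi.mul_apply]
      have e1 : ((n : ℂ) + 1) ≠ 0 := by exact_mod_cast n.succ_ne_zero
      have e2 : ((n : ℂ) + 1 + 1) ≠ 0 := by exact_mod_cast (n + 1).succ_ne_zero
      push_cast
      field_simp
      ring
    have hstep : ∀ n, (2 * nest 1 (-1) f (n + 1) - (-1) ^ (n + 1) * u (n + 1)) -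
        (2 * nest 1 (-1) f n - (-1) ^ n * u n) = (-1) ^ (n + 1) * (u n - u (n + 1)) := fun n => by
      rw [nest_succ, pow_one, show (-1 : ℂ) ^ (n + 1) / ((n + 1 : ℕ) : ℂ) * f n =
        (-1) ^ (n + 1) * u n by simp only [hu]; ring]
      ring
    obtain ⟨L, hL⟩ := exists_limit_of_increment
      (f := fun n => 2 * nest 1 (-1) f n - (-1) ^ n * u n) (by
        simp only [hstep]
        refine LogBigO.isBigO (a := -2) (hdu.of_norm_le fun n => ?_) (by norm_num)
        simp)
    refine ⟨L / 2, ?_⟩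
    have h3 : LogBigO (-1 / 2) fun n => (-1) ^ n * u n :=
      (hub.of_norm_le fun n => by simp).mono (by norm_num)
    refine ((hL.add h3).smul (c := (1 / 2 : ℂ))).of_norm_le fun n => le_of_eq ?_
    simp only [Pi.smul_apply, Pi.add_apply, smul_eq_mul]
    ring_nf
  · refine exists_limit_of_increment ?_
    simp only [nest_succ, add_sub_cancel_left]
    refine (hf.logBigO.nest_term hε _).isBigO ?_
    have : (2 : ℝ) ≤ s := by exact_mod_cast (by omega : 2 ≤ s)
    linarith

/-! ### Membership of limits in the span of colored multiple zeta values -/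

lemma multiplePartialSum_succ (k : ℕ) (s : Fin (k + 1) → ℕ) (a : Fin (k + 1) → ℂ) :
    multiplePartialSum (k + 1) s a =
      nest (s 0) (a 0) (multiplePartialSum k (fun i => s i.succ) fun i => a i.succ) := by
  funext M
  exact nestedSum_succ k (fun i n => a i ^ n / (n : ℂ) ^ s i) M

/-- `f` is the sequence of partial sums of a colored multiple zeta series of level `2` and
weight `w`. -/
def IsMultiplePartialSum (w : ℕ) (f : ℕ → ℂ) : Prop :=
  ∃ (k : ℕ) (s : Fin k → ℕ) (a : Fin k → ℂ), (∀ i, 0 < s i) ∧ (∑ i, s i) = w ∧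
    (∀ i, (a i) ^ 2 = 1) ∧ f = multiplePartialSum k s a

lemma isMultiplePartialSum_one : IsMultiplePartialSum 0 1 :=
  ⟨0, Fin.elim0, Fin.elim0, fun i => i.elim0, by simp, fun i => i.elim0,
    funext fun _ => by simp [multiplePartialSum]⟩

lemma IsMultiplePartialSum.nest {w s : ℕ} {ε : ℂ} {f : ℕ → ℂ} (hf : IsMultiplePartialSum w f)
    (hs : 0 < s) (hε : ε ^ 2 = 1) : IsMultiplePartialSum (w + s) (nest s ε f) := by
  obtain ⟨k, t, a, ht, hw, ha, rfl⟩ := hf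
  refine ⟨k + 1, Fin.cons s t, Fin.cons ε a, ?_, ?_, ?_, ?_⟩
  · exact Fin.cases (by simpa using hs) (by simpa using ht)
  · rw [Fin.sum_univ_succ]
    simp [hw, add_comm]
  · exact Fin.cases (by simpa using hε) (by simpa using ha)
  · rw [multiplePartialSum_succ]
    simp

lemma IsMultiplePartialSum.isCMZV {w s : ℕ} {ε : ℂ} {f : ℕ → ℂ} (hf : IsMultiplePartialSum w f)
    (hs : 0 < s) (hε : ε ^ 2 = 1) (h : ¬(s = 1 ∧ ε = 1)) {L : ℂ}
    (hL : Tendsto (CentralBinomialSum.nest s ε f) atTop (𝓝 L)) : IsCMZV 2 (w + s) L := by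
  obtain ⟨k, t, a, ht, hw, ha, rfl⟩ := hf
  refine ⟨k + 1, k.succ_pos, Fin.cons s t, Fin.cons ε a, ?_, ?_, ?_, h, ?_⟩
  · exact Fin.cases (by simpa using hs) (by simpa using ht)
  · rw [Fin.sum_univ_succ]
    simp [hw, add_comm]
  · exact Fin.cases (by simpa using hε) (by simpa using ha)
  · rw [multiplePartialSum_succ]
    simpa using hL

lemma ColoredSum.mem_span {w : ℕ} {f : ℕ → ℂ} (hf : ColoredSum w f) :
    f ∈ Submodule.span ℚ {g | IsMultiplePartialSum w g ∧ ColoredSum w g} := by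
  induction hf with
  | one => exact Submodule.subset_span ⟨isMultiplePartialSum_one, one⟩
  | add _ _ ih₁ ih₂ => exact Submodule.add_mem _ ih₁ ih₂
  | smul q _ ih => exact Submodule.smul_mem _ q ih
  | @nest w s ε f _ hs hε ih =>
    clear * - ih hs hε
    induction ih using Submodule.span_induction with
    | mem g hg => exact Submodule.subset_span ⟨hg.1.nest hs hε, hg.2.nest hs hε⟩
    | zero => rw [map_zero]; exact Submodule.zero_mem _
    | add _ _ _ _ ih₁ ih₂ => rw [map_add]; exact Submodule.add_mem _ ih₁ ih₂
    | smul q _ _ ih => rw [nest_smul_rat]; exact Submodule.smul_mem _ q ih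

lemma exists_limit_nest_mem_CMZV {w s : ℕ} {ε : ℂ} {f : ℕ → ℂ} (hf : ColoredSum w f) (hs : 0 < s)
    (hε : ε ^ 2 = 1) (h : ¬(s = 1 ∧ ε = 1)) :
    ∃ L ∈ CMZV 2 (w + s), LogBigO (-1 / 2) fun n => nest s ε f n - L := by
  have hspan := hf.mem_span
  clear hf
  induction hspan using Submodule.span_induction with
  | mem g hg =>
    obtain ⟨L, hL⟩ := exists_limit_nest hg.2 hs hε h
    refine ⟨L, Submodule.subset_span (hg.1.isCMZV hs hε h ?_), hL⟩
    simpa using (hL.tendsto_zero (by norm_num)).add_const L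
  | zero =>
    refine ⟨0, Submodule.zero_mem _, ((logBigO_inv_natCast_add_one ℂ).mono
      (by norm_num : (-1 : ℝ) ≤ -1 / 2)).of_norm_le fun n => ?_⟩
    rw [map_zero]
    simp
  | add f g _ _ ih₁ ih₂ =>
    obtain ⟨L₁, h₁, h₁'⟩ := ih₁
    obtain ⟨L₂, h₂, h₂'⟩ := ih₂
    refine ⟨L₁ + L₂, Submodule.add_mem _ h₁ h₂, (h₁'.add h₂').of_norm_le fun n => le_of_eq ?_⟩
    rw [map_add]
    simp only [Pi.add_apply]
    ring_nf
  | smul q f _ ih =>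
    obtain ⟨L, h, h'⟩ := ih
    refine ⟨q • L, Submodule.smul_mem _ q h, (h'.smul (c := (q : ℂ))).of_norm_le
      fun n => le_of_eq ?_⟩
    rw [nest_smul_rat, rat_smul_eq]
    simp only [Pi.smul_apply, Rat.smul_def, smul_eq_mul]
    ring_nf

/-! ### Regularization -/

/-- The harmonic numbers, as a colored sum. -/
noncomputable def harmonicSum : ℕ → ℂ := nest 1 1 1

lemma coloredSum_harmonicSum : ColoredSum 1 harmonicSum :=
  (ColoredSum.one.nest one_pos (one_pow 2)).of_eq (zero_add 1)

lemma tendsto_norm_harmonicSum : Tendsto (fun n => ‖harmonicSum n‖) atTop atTop := by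
  refine Real.tendsto_sum_range_one_div_nat_succ_atTop.congr fun n => ?_
  have : harmonicSum n = ((∑ i ∈ range n, 1 / ((i : ℝ) + 1) : ℝ) : ℂ) := by
    simp [harmonicSum, nest_apply]
  rw [this, Complex.norm_real, Real.norm_of_nonneg (sum_nonneg fun i _ => by positivity)]

/-- Combinations of colored sums of weight `w` in which all leading `1/n` factors not attached to a
convergent sum number at most `k`. -/
inductive LeadingOnes : ℕ → ℕ → (ℕ → ℂ) → Prop
  | one (k : ℕ) : LeadingOnes k 0 1
  | nest (k : ℕ) {w s : ℕ} {ε : ℂ} {f : ℕ → ℂ} (hf : ColoredSum w f) (hs : 0 < s)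
      (hε : ε ^ 2 = 1) (h : ¬(s = 1 ∧ ε = 1)) : LeadingOnes k (w + s) (nest s ε f)
  | lead {k w : ℕ} {f : ℕ → ℂ} (hf : LeadingOnes k w f) :
      LeadingOnes (k + 1) (w + 1) (CentralBinomialSum.nest 1 1 f)
  | add {k w : ℕ} {f g : ℕ → ℂ} (hf : LeadingOnes k w f) (hg : LeadingOnes k w g) :
      LeadingOnes k w (f + g)
  | smul {k w : ℕ} {f : ℕ → ℂ} (q : ℚ) (hf : LeadingOnes k w f) : LeadingOnes k w (q • f)

namespace LeadingOnes

lemma of_eq {k w v : ℕ} {f : ℕ → ℂ} (hf : LeadingOnes k w f) (h : w = v) : LeadingOnes k v f :=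
  h ▸ hf

lemma mono {k l w : ℕ} {f : ℕ → ℂ} (hf : LeadingOnes k w f) (h : k ≤ l) : LeadingOnes l w f := by
  induction hf generalizing l with
  | one => exact one l
  | nest _ hf hs hε h' => exact nest l hf hs hε h'
  | lead _ ih =>
    obtain ⟨l, rfl⟩ := Nat.exists_eq_add_of_lt h
    exact (ih (by omega)).lead
  | add _ _ ih₁ ih₂ => exact (ih₁ h).add (ih₂ h)
  | smul q _ ih => exact (ih h).smul q

lemma harmonicSum_mul_sub {k w : ℕ} {f : ℕ → ℂ} (hf : LeadingOnes k w f) :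
    LeadingOnes k (w + 1)
      (harmonicSum * f - ((k + 1 : ℕ) : ℚ) • CentralBinomialSum.nest 1 1 f) := by
  have key : ∀ {k w : ℕ} {f r : ℕ → ℂ}, LeadingOnes 0 w f → LeadingOnes 0 (w + 1) r →
      harmonicSum * f = CentralBinomialSum.nest 1 1 f + r →
      LeadingOnes k (w + 1)
        (harmonicSum * f - ((k + 1 : ℕ) : ℚ) • CentralBinomialSum.nest 1 1 f) := by
    intro k w f r hf hr h
    rcases k with _ | k
    · rw [h]
      simpa using hr
    · have h1 := ((hf.mono k.zero_le).lead.smul (-((k + 1 : ℕ) : ℚ))).add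
        (hr.mono (Nat.zero_le (k + 1)))
      convert! h1 using 1
      rw [h]
      push_cast
      module
  induction hf with
  | one k =>
    refine key (LeadingOnes.one 0) (r := 0) ?_ (by simp [harmonicSum])
    simpa using (nest 0 (s := 1) (ε := -1) ColoredSum.one one_pos (by norm_num)
      (by norm_num)).smul 0
  | @nest k w s ε f hf hs hε h =>
    have e : harmonicSum * CentralBinomialSum.nest s ε f =
        CentralBinomialSum.nest 1 1 (CentralBinomialSum.nest s ε f) +
        (CentralBinomialSum.nest s ε (harmonicSum * f) +
          CentralBinomialSum.nest (1 + s) ε f) := by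
      rw [harmonicSum, nest_mul_nest, one_mul, one_mul, one_mul, add_assoc]
    refine key (nest 0 hf hs hε h) (add ?_ ?_) e
    · exact (nest 0 (coloredSum_harmonicSum.mul hf) hs hε h).of_eq (by ring)
    · exact (nest 0 (s := 1 + s) hf (by omega) hε (by omega)).of_eq (by ring)
  | @lead k w f hf ih =>
    have h2 : LeadingOnes (k + 1) (w + 1 + 1) (CentralBinomialSum.nest (1 + 1) 1 f) := by
      have hc : ∀ {k w : ℕ} {f : ℕ → ℂ}, LeadingOnes k w f → ColoredSum w f := by
        intro k w f hf
        induction hf with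
        | one => exact ColoredSum.one
        | nest _ hf hs hε _ => exact hf.nest hs hε
        | lead _ ih => exact ih.nest one_pos (one_pow 2)
        | add _ _ ih₁ ih₂ => exact ih₁.add ih₂
        | smul q _ ih => exact ih.smul q
      exact nest _ (s := 1 + 1) (hc hf) (by omega) (one_pow 2) (by omega)
    convert! ih.lead.add h2 using 1
    rw [map_sub, nest_smul_rat]
    conv_lhs => rw [harmonicSum, nest_mul_nest, one_mul, one_mul, one_mul]
    rw [harmonicSum]
    push_cast
    module
  | @add k w f g _ _ ih₁ ih₂ =>
    convert! ih₁.add ih₂ using 1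
    rw [map_add, mul_add]
    module
  | @smul k w f q _ ih =>
    convert! ih.smul q using 1
    rw [nest_smul_rat, mul_smul_comm]
    module

end LeadingOnes

lemma ColoredSum.exists_leadingOnes {w : ℕ} {f : ℕ → ℂ} (hf : ColoredSum w f) :
    ∃ k, LeadingOnes k w f := by
  induction hf with
  | one => exact ⟨0, .one 0⟩
  | @nest w s ε f hf hs hε ih =>
    by_cases h : s = 1 ∧ ε = 1
    · obtain ⟨rfl, rfl⟩ := h
      obtain ⟨k, hk⟩ := ih
      exact ⟨k + 1, hk.lead⟩
    · exact ⟨0, .nest 0 hf hs hε h⟩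
  | add _ _ ih₁ ih₂ =>
    obtain ⟨k, hk⟩ := ih₁
    obtain ⟨l, hl⟩ := ih₂
    exact ⟨max k l, (hk.mono (le_max_left _ _)).add (hl.mono (le_max_right _ _))⟩
  | smul q _ ih =>
    obtain ⟨k, hk⟩ := ih
    exact ⟨k, hk.smul q⟩

/-- `f` is asymptotic to a polynomial in the harmonic numbers whose constant term is a combination
of colored multiple zeta values of weight `w`. -/
def Regularizable (w : ℕ) (f : ℕ → ℂ) : Prop :=
  ∃ p : Polynomial ℂ, (0 < w → p.coeff 0 ∈ CMZV 2 w) ∧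
    LogBigO (-1 / 2) fun n => f n - p.eval (harmonicSum n)

namespace Regularizable

lemma add {w : ℕ} {f g : ℕ → ℂ} (hf : Regularizable w f) (hg : Regularizable w g) :
    Regularizable w (f + g) := by
  obtain ⟨p, hp, hp'⟩ := hf
  obtain ⟨q, hq, hq'⟩ := hg
  refine ⟨p + q, fun h => ?_, (hp'.add hq').of_norm_le fun n => le_of_eq ?_⟩
  · rw [Polynomial.coeff_add]
    exact Submodule.add_mem _ (hp h) (hq h)
  · simp only [Pi.add_apply, Polynomial.eval_add]
    ring_nf

lemma smul {w : ℕ} {f : ℕ → ℂ} (q : ℚ) (hf : Regularizable w f) : Regularizable w (q • f) := by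
  obtain ⟨p, hp, hp'⟩ := hf
  refine ⟨Polynomial.C (q : ℂ) * p, fun h => ?_,
    (hp'.smul (c := (q : ℂ))).of_norm_le fun n => le_of_eq ?_⟩
  · rw [Polynomial.coeff_C_mul, ← Rat.smul_def]
    exact Submodule.smul_mem _ q (hp h)
  · simp only [Pi.smul_apply, Polynomial.eval_mul, Polynomial.eval_C, Rat.smul_def, smul_eq_mul]
    ring_nf

lemma harmonicSum_mul {w : ℕ} {f : ℕ → ℂ} (hf : Regularizable w f) :
    Regularizable (w + 1) (harmonicSum * f) := by
  obtain ⟨p, hp, hp'⟩ := hf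
  refine ⟨Polynomial.X * p, fun _ => ?_, ?_⟩
  · simp
  · have h := coloredSum_harmonicSum.logBigO.mul hp'
    rw [zero_add] at h
    refine h.of_norm_le fun n => le_of_eq ?_
    simp only [Pi.mul_apply, Polynomial.eval_mul, Polynomial.eval_X]
    ring_nf

end Regularizable

lemma LeadingOnes.regularizable {k w : ℕ} {f : ℕ → ℂ} (hf : LeadingOnes k w f) :
    Regularizable w f := by
  have h_one : Regularizable 0 1 := by
    refine ⟨1, fun h => absurd h (lt_irrefl 0), ((logBigO_inv_natCast_add_one ℂ).mono
      (by norm_num : (-1 : ℝ) ≤ -1 / 2)).of_norm_le fun n => ?_⟩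
    simp
  have h_nest : ∀ {w s : ℕ} {ε : ℂ} {f : ℕ → ℂ}, ColoredSum w f → 0 < s → ε ^ 2 = 1 →
      ¬(s = 1 ∧ ε = 1) → Regularizable (w + s) (CentralBinomialSum.nest s ε f) := by
    intro w s ε f hf hs hε h
    obtain ⟨L, hL, hL'⟩ := exists_limit_nest_mem_CMZV hf hs hε h
    exact ⟨Polynomial.C L, fun _ => by simpa using hL, by simpa using hL'⟩
  induction k generalizing w f with
  | zero =>
    generalize hk : 0 = k at hf
    induction hf with
    | one => exact h_one
    | nest _ hf hs hε h => exact h_nest hf hs hε h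
    | lead => exact absurd hk (by omega)
    | add _ _ ih₁ ih₂ => exact (ih₁ hk).add (ih₂ hk)
    | smul q _ ih => exact (ih hk).smul q
  | succ k ih =>
    generalize hk : k + 1 = l at hf
    induction hf with
    | one => exact h_one
    | nest _ hf hs hε h => exact h_nest hf hs hε h
    | @lead l w f hf =>
      obtain rfl : k = l := by omega
      have h := ((ih hf).harmonicSum_mul.add
        ((ih hf.harmonicSum_mul_sub).smul (-1))).smul (((k + 1 : ℕ) : ℚ)⁻¹)
      convert! h using 1
      have hk0 : ((k + 1 : ℕ) : ℚ) ≠ 0 := by exact_mod_cast k.succ_ne_zero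
      rw [neg_one_smul, neg_sub, add_sub_cancel, inv_smul_smul₀ hk0]
    | add _ _ ih₁ ih₂ => exact (ih₁ hk).add (ih₂ hk)
    | smul q _ ih => exact (ih hk).smul q

/-- A constant that is approximated by a colored sum of weight `w` lies in the span of colored
multiple zeta values. -/
lemma mem_CMZV_of_approx {w : ℕ} (hw : 0 < w) {c : ℂ} {f : ℕ → ℂ} (hf : ColoredSum w f)
    (hc : LogBigO (-1 / 2) fun n => c - f n) : c ∈ CMZV 2 w := by
  obtain ⟨k, hk⟩ := hf.exists_leadingOnes
  obtain ⟨p, hp, hp'⟩ := hk.regularizable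
  have h0 : Tendsto (fun n => p.eval (harmonicSum n)) atTop (𝓝 c) := by
    have h := (((hc.add hp').tendsto_zero (by norm_num)).neg).add_const c
    rw [neg_zero, zero_add] at h
    refine h.congr fun n => ?_
    simp only [Pi.add_apply]
    ring
  have hdeg : p.degree ≤ 0 := by
    by_contra h
    exact not_tendsto_nhds_of_tendsto_atTop
      (p.tendsto_norm_atTop (not_le.1 h) tendsto_norm_harmonicSum) _ h0.norm
  rw [Polynomial.eq_C_of_degree_le_zero hdeg] at h0
  simp only [Polynomial.eval_C] at h0
  rw [← tendsto_nhds_unique tendsto_const_nhds h0]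
  exact hp hw

/-! ### Approximable constants -/

/-- `c` is approximated by a colored sum of weight `w`. -/
def Approximable (w : ℕ) (c : ℂ) : Prop :=
  ∃ f, ColoredSum w f ∧ LogBigO (-1 / 2) fun n => c - f n

/-- Combinations of colored sums with approximable coefficients, of total weight `w`. -/
inductive ScaledSum : ℕ → (ℕ → ℂ) → Prop
  | mk {v u : ℕ} {c : ℂ} {f : ℕ → ℂ} (hc : Approximable v c) (hf : ColoredSum u f) :
      ScaledSum (v + u) (c • f)
  | add {w : ℕ} {f g : ℕ → ℂ} (hf : ScaledSum w f) (hg : ScaledSum w g) : ScaledSum w (f + g)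

lemma logBigO_zero (a : ℝ) : LogBigO a fun _ => (0 : ℂ) :=
  ⟨0, isBigO_zero _ _⟩

namespace ScaledSum

lemma of_eq {w v : ℕ} {f : ℕ → ℂ} (hf : ScaledSum w f) (h : w = v) : ScaledSum v f := h ▸ hf

lemma const {w : ℕ} {c : ℂ} (hc : Approximable w c) : ScaledSum w fun _ => c := by
  convert! (mk hc .one).of_eq (add_zero w) using 1
  funext n
  simp

lemma of_coloredSum {w : ℕ} {f : ℕ → ℂ} (hf : ColoredSum w f) : ScaledSum w f := by
  have h : Approximable 0 1 := ⟨1, .one, by simpa using logBigO_zero _⟩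
  simpa using (mk h hf).of_eq (zero_add w)

lemma smul {w : ℕ} {f : ℕ → ℂ} (q : ℚ) (hf : ScaledSum w f) : ScaledSum w (q • f) := by
  induction hf with
  | mk hc hf => rw [smul_comm]; exact mk hc (hf.smul q)
  | add _ _ ih₁ ih₂ => rw [smul_add]; exact ih₁.add ih₂

lemma sub {w : ℕ} {f g : ℕ → ℂ} (hf : ScaledSum w f) (hg : ScaledSum w g) :
    ScaledSum w (f - g) := by
  have := hf.add (hg.smul (-1))
  rwa [neg_one_smul, ← sub_eq_add_neg] at this

lemma nest {w s : ℕ} {ε : ℂ} {f : ℕ → ℂ} (hf : ScaledSum w f) (hs : 0 < s) (hε : ε ^ 2 = 1) :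
    ScaledSum (w + s) (nest s ε f) := by
  induction hf with
  | mk hc hf => rw [map_smul]; exact (mk hc (hf.nest hs hε)).of_eq (by ring)
  | add _ _ ih₁ ih₂ => rw [map_add]; exact ih₁.add ih₂

lemma nest_shift {w s : ℕ} {ε : ℂ} {f : ℕ → ℂ} (hf : ScaledSum w f) (hs : 0 < s)
    (hε : ε ^ 2 = 1) : ScaledSum (w + s) (CentralBinomialSum.nest s ε fun n => f (n + 1)) := by
  induction hf with
  | @mk v u c f hc hf =>
    have h := (mk hc (hf.nest_shift hs hε)).of_eq (add_assoc v u s).symm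
    rwa [← map_smul] at h
  | add _ _ ih₁ ih₂ =>
    have := ih₁.add ih₂
    rwa [← map_add] at this

lemma exists_approx {w : ℕ} {f : ℕ → ℂ} (hf : ScaledSum w f) :
    ∃ g, ColoredSum w g ∧ LogBigO (-1 / 2) fun n => f n - g n := by
  induction hf with
  | @mk v u c f hc hf =>
    obtain ⟨g, hg, hcg⟩ := hc
    refine ⟨g * f, hg.mul hf, ?_⟩
    have h := hcg.mul hf.logBigO
    rw [add_zero] at h
    refine h.of_norm_le fun n => le_of_eq ?_
    simp only [Pi.mul_apply, Pi.smul_apply, smul_eq_mul]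
    ring_nf
  | add _ _ ih₁ ih₂ =>
    obtain ⟨g₁, h₁, h₁'⟩ := ih₁
    obtain ⟨g₂, h₂, h₂'⟩ := ih₂
    refine ⟨g₁ + g₂, h₁.add h₂, (h₁'.add h₂').of_norm_le fun n => le_of_eq ?_⟩
    simp only [Pi.add_apply]
    ring_nf

end ScaledSum

lemma approximable_of_asymptotic {w : ℕ} {c : ℂ} {f h : ℕ → ℂ} (hf : ColoredSum w f)
    (hh : ScaledSum w h) (hfh : LogBigO (-1 / 2) fun n => f n - (c + h n)) :
    Approximable w c := by
  obtain ⟨g, hg, hhg⟩ := hh.exists_approx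
  refine ⟨f - g, hf.sub hg, (hfh.add hhg).of_norm_le fun n => ?_⟩
  rw [← norm_neg]
  refine le_of_eq ?_
  simp only [Pi.sub_apply, Pi.add_apply]
  ring_nf

/-! ### Difference tables and Newton series at half-integers -/

/-- The table of iterated differences of a sequence. -/
def diffTable (A : ℕ → ℝ) : ℕ → ℕ → ℝ
  | 0, n => A n
  | K + 1, n => diffTable A K n - diffTable A K (n + 1)

lemma diffTable_succ (A : ℕ → ℝ) (K n : ℕ) :
    diffTable A (K + 1) n = diffTable A K n - diffTable A K (n + 1) := rfl

lemma diffTable_sub_shift (c : ℕ → ℝ) (K n : ℕ) :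
    diffTable (fun n => c n - c (n + 1)) K n = diffTable c (K + 1) n := by
  induction K generalizing n with
  | zero => rfl
  | succ K ih => rw [diffTable_succ, ih, ih, ← diffTable_succ]

lemma diffTable_neg_shift (c : ℕ → ℝ) (K n : ℕ) :
    diffTable (fun n => -c (n + 1)) K n = -diffTable c K (n + 1) := by
  induction K generalizing n with
  | zero => rfl
  | succ K ih => rw [diffTable_succ, ih, ih, diffTable_succ]; ring

/-- The sequence whose difference table governs the recursion for the table of `b`. -/
def weightedDiff (b : ℕ → ℝ) (n : ℕ) : ℝ := n * b n - (n + 1) * b (n + 1)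

lemma diffTable_weightedDiff (b : ℕ → ℝ) (K n : ℕ) :
    diffTable (weightedDiff b) K n = n * diffTable b K n - (n + K + 1) * diffTable b K (n + 1) := by
  induction K generalizing n with
  | zero => simp [diffTable, weightedDiff]
  | succ K ih =>
    rw [diffTable_succ, ih, ih, diffTable_succ, diffTable_succ]
    push_cast
    ring

lemma diffTable_nonneg_of_weightedDiff_nonneg {b : ℕ → ℝ} (hb : ∀ n, 0 ≤ b (n + 1))
    (hd : ∀ K n, 0 ≤ diffTable (weightedDiff b) K (n + 1)) (K n : ℕ) :
    0 ≤ diffTable b K (n + 1) := by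
  induction K generalizing n with
  | zero => exact hb n
  | succ K ih =>
    have h := hd K n
    rw [diffTable_weightedDiff] at h
    have h1 := ih n
    push_cast at h
    rw [diffTable_succ]
    have hK : (0 : ℝ) ≤ K := K.cast_nonneg
    have hpos : (0 : ℝ) < n + 1 + K + 1 := by positivity
    refine (mul_nonneg_iff_of_pos_left hpos).1 ?_
    linarith [mul_nonneg hK h1]

lemma diffTable_nonneg_of_weightedDiff_nonpos {b : ℕ → ℝ}
    (hd : ∀ K n, diffTable (weightedDiff b) K n ≤ 0) (K n : ℕ) :
    0 ≤ diffTable b K (n + 1) := by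
  have hpos : (0 : ℝ) < n + K + 1 := by positivity
  refine (mul_nonneg_iff_of_pos_left hpos).1 ?_
  have h := hd K n
  rw [diffTable_weightedDiff] at h
  have h1 : 0 ≤ (n : ℝ) * diffTable b K n := by
    cases n with
    | zero => simp
    | succ n =>
      exact mul_nonneg (by positivity) (diffTable_nonneg_of_weightedDiff_nonpos hd K n)
  linarith

lemma LogBigO.diffTable {A : ℕ → ℝ} {a : ℝ} (hA : LogBigO a A) (K : ℕ) :
    LogBigO a (diffTable A K) := by
  induction K with
  | zero => exact hA
  | succ K ih => exact ih.sub ih.shift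

/-- The normalized central binomial coefficient `4⁻ⁿ C(2n,n)`. -/
noncomputable def centralWeight (n : ℕ) : ℝ := (Nat.centralBinom n : ℝ) / 4 ^ n

lemma centralWeight_zero : centralWeight 0 = 1 := by simp [centralWeight]

lemma centralWeight_nonneg (n : ℕ) : 0 ≤ centralWeight n := by
  rw [centralWeight]
  positivity

lemma succ_mul_centralWeight_succ (n : ℕ) :
    ((n : ℝ) + 1) * centralWeight (n + 1) = (n + 1 / 2) * centralWeight n := by
  have h : ((n : ℝ) + 1) * (Nat.centralBinom (n + 1) : ℝ) =
      2 * (2 * n + 1) * Nat.centralBinom n := by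
    exact_mod_cast Nat.succ_mul_centralBinom_succ n
  rw [centralWeight, centralWeight, ← mul_div_assoc, h, pow_succ]
  field_simp
  ring

lemma centralWeight_sq_le (n : ℕ) : centralWeight n ^ 2 * (2 * n + 1) ≤ 1 := by
  induction n with
  | zero => simp [centralWeight_zero]
  | succ n ih =>
    have h := succ_mul_centralWeight_succ n
    have hn : (0 : ℝ) ≤ n := n.cast_nonneg
    have e : centralWeight (n + 1) = (n + 1 / 2) * centralWeight n / (n + 1) := by
      rw [← h]
      field_simp
    rw [e, div_pow, div_mul_eq_mul_div, div_le_one (by positivity)]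
    push_cast
    nlinarith [mul_le_mul_of_nonneg_left ih (by positivity :
      (0 : ℝ) ≤ (n + 1 / 2) * (n + 3 / 2)), sq_nonneg (centralWeight n)]

lemma centralWeight_le_one (n : ℕ) : centralWeight n ≤ 1 := by
  have h := centralWeight_sq_le n
  have hn : (0 : ℝ) ≤ n := n.cast_nonneg
  nlinarith [sq_nonneg (centralWeight n), centralWeight_nonneg n]

lemma logBigO_centralWeight : LogBigO (-1 / 2) centralWeight := by
  refine ⟨0, IsBigO.of_bound 1 (Eventually.of_forall fun n => ?_)⟩
  have hn : (0 : ℝ) < n + 1 := by positivity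
  rw [one_mul, Real.norm_of_nonneg (centralWeight_nonneg n),
    Real.norm_of_nonneg (scale_pos ..).le, scale, pow_zero, one_mul,
    show (-1 / 2 : ℝ) = -(1 / 2) by norm_num, Real.rpow_neg hn.le, ← Real.sqrt_eq_rpow,
    ← Real.sqrt_inv]
  refine Real.le_sqrt_of_sq_le ?_
  rw [← one_div, le_div_iff₀ hn]
  have h := centralWeight_sq_le n
  nlinarith [sq_nonneg (centralWeight n), n.cast_nonneg (α := ℝ)]

lemma summable_of_logBigO {f : ℕ → ℝ} {a : ℝ} (hf : LogBigO a f) (ha : a < -1) :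
    Summable f := by
  obtain ⟨b, hab, hb⟩ := exists_between ha
  refine summable_of_isBigO_nat ?_ (hf.isBigO hab)
  have h := (summable_nat_add_iff 1).2 (Real.summable_nat_rpow.2 hb)
  refine h.congr fun n => ?_
  simp [scale]

lemma summable_centralWeight_mul {f : ℕ → ℝ} (hf : LogBigO (-1) f) :
    Summable fun n => centralWeight n * f n :=
  summable_of_logBigO (logBigO_centralWeight.mul hf) (by norm_num)

/-- The value at `K - 1/2` of the Newton series with coefficients `A`. -/
noncomputable def halfValue (A : ℕ → ℝ) (K : ℕ) : ℝ := ∑' n, centralWeight n * diffTable A K n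

lemma halfValue_succ_sub {b : ℕ → ℝ} (hb : LogBigO (-1) b) (hd : LogBigO (-1) (weightedDiff b))
    (K : ℕ) : ((K : ℝ) + 1 / 2) * (halfValue b (K + 1) - halfValue b K) =
      ∑' n, centralWeight n * diffTable (weightedDiff b) K n := by
  have h1 := summable_centralWeight_mul (hb.diffTable K)
  have h2 := summable_centralWeight_mul (hb.diffTable (K + 1))
  have h3 := summable_centralWeight_mul (hd.diffTable K)
  have h4 := h3.hasSum.sub ((h2.hasSum.sub h1.hasSum).mul_left ((K : ℝ) + 1 / 2))
  have hu : Tendsto (fun n : ℕ => (n : ℝ) * (centralWeight n * diffTable b K n)) atTop (𝓝 0) := by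
    have hn : LogBigO 1 fun n : ℕ => (n : ℝ) := by
      refine ⟨0, IsBigO.of_bound 1 (Eventually.of_forall fun n => ?_)⟩
      rw [one_mul, Real.norm_of_nonneg (scale_pos ..).le, scale, pow_zero, one_mul, Real.rpow_one,
        Real.norm_of_nonneg n.cast_nonneg]
      linarith
    exact (hn.mul (logBigO_centralWeight.mul (hb.diffTable K))).tendsto_zero (by norm_num)
  have h5 := h4.tendsto_sum_nat
  have h6 : ∀ N : ℕ, ∑ n ∈ range N, (centralWeight n * diffTable (weightedDiff b) K n -
      ((K : ℝ) + 1 / 2) * (centralWeight n * diffTable b (K + 1) n -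
        centralWeight n * diffTable b K n)) = -(N * (centralWeight N * diffTable b K N)) := by
    intro N
    induction N with
    | zero => simp
    | succ N ih =>
      rw [sum_range_succ, ih, diffTable_weightedDiff, diffTable_succ]
      have := succ_mul_centralWeight_succ N
      push_cast
      linear_combination diffTable b K (N + 1) * this
  simp only [h6] at h5
  have h7 := tendsto_nhds_unique h5 hu.neg
  rw [halfValue, halfValue]
  linarith

lemma halfValue_succ_bounds {b : ℕ → ℝ} (hb : LogBigO (-1) b)
    (hpos : ∀ K n, 0 ≤ diffTable b K (n + 1)) (K : ℕ) :
    0 ≤ halfValue b (K + 1) - diffTable b (K + 1) 0 ∧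
      halfValue b (K + 1) - diffTable b (K + 1) 0 ≤ diffTable b K 1 := by
  have h := (summable_centralWeight_mul (hb.diffTable (K + 1))).tsum_eq_zero_add
  rw [centralWeight_zero, one_mul] at h
  rw [halfValue, h, add_sub_cancel_left]
  refine ⟨tsum_nonneg fun n => mul_nonneg (centralWeight_nonneg _) (hpos _ _), ?_⟩
  refine Real.tsum_le_of_sum_range_le
    (fun n => mul_nonneg (centralWeight_nonneg _) (hpos _ _)) fun N => ?_
  calc ∑ n ∈ range N, centralWeight (n + 1) * diffTable b (K + 1) (n + 1)
      ≤ ∑ n ∈ range N, (diffTable b K (n + 1) - diffTable b K (n + 1 + 1)) :=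
        sum_le_sum fun n _ => by
          rw [← diffTable_succ]
          exact mul_le_of_le_one_left (hpos _ _) (centralWeight_le_one _)
    _ = diffTable b K 1 - diffTable b K (N + 1) := by
        rw [sum_range_sub' fun n => diffTable b K (n + 1)]
    _ ≤ diffTable b K 1 := sub_le_self _ (hpos K N)

/-! ### Star sums -/

/-- The first entries of the rows of the difference table, indexed by the floor of half the
argument. -/
noncomputable def evenPart (A : ℕ → ℝ) (M : ℕ) : ℂ := (diffTable A (M / 2) 0 : ℝ)

/-- The values of the Newton series at half-integers, indexed by the ceiling of half the
argument. -/
noncomputable def oddPart (A : ℕ → ℝ) (M : ℕ) : ℂ := (halfValue A ((M + 1) / 2) : ℝ)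

lemma evenPart_two_mul (A : ℕ → ℝ) (K : ℕ) : evenPart A (2 * K) = (diffTable A K 0 : ℝ) := by
  rw [evenPart, Nat.mul_div_cancel_left K two_pos]

lemma evenPart_two_mul_add_one (A : ℕ → ℝ) (K : ℕ) :
    evenPart A (2 * K + 1) = (diffTable A K 0 : ℝ) := by
  rw [evenPart, show (2 * K + 1) / 2 = K by omega]

lemma oddPart_two_mul (A : ℕ → ℝ) (K : ℕ) : oddPart A (2 * K) = (halfValue A K : ℝ) := by
  rw [oddPart, show (2 * K + 1) / 2 = K by omega]

lemma oddPart_two_mul_add_one (A : ℕ → ℝ) (K : ℕ) :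
    oddPart A (2 * K + 1) = (halfValue A (K + 1) : ℝ) := by
  rw [oddPart, show (2 * K + 1 + 1) / 2 = K + 1 by omega]

/-- Sequences vanishing at `0` whose difference table and half-integral Newton series are described
by colored sums of weight `w`. -/
structure Tame (w : ℕ) (A : ℕ → ℝ) : Prop where
  zero : A 0 = 0
  logBigO : LogBigO (-1) A
  nonneg : ∀ K n, 0 ≤ diffTable A K (n + 1)
  coloredSum : ColoredSum w (evenPart A)
  scaledSum : ScaledSum w (oddPart A)
  approximable : Approximable w (halfValue A 0 : ℝ)

lemma logBigO_of_weightedDiff {b : ℕ → ℝ} (hd : LogBigO (-1) (weightedDiff b)) :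
    LogBigO (-1) b := by
  have hn : LogBigO 1 fun n : ℕ => (n : ℝ) + 1 := by
    refine ⟨0, IsBigO.of_bound 1 (Eventually.of_forall fun n => ?_)⟩
    rw [one_mul, Real.norm_of_nonneg (scale_pos ..).le, scale, pow_zero, one_mul, Real.rpow_one,
      Real.norm_of_nonneg (by positivity)]
  have h := hd.mul hn
  rw [neg_add_cancel] at h
  have h1 := (logBigO_inv_natCast_add_one ℝ).mul (logBigO_sum_div h).shift
  rw [add_zero] at h1
  refine LogBigO.of_shift (h1.of_norm_le fun n => ?_)
  have key : ∀ N : ℕ, (N : ℝ) * b N = -∑ k ∈ range N, (weightedDiff b * fun n : ℕ => (n : ℝ) + 1) k /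
      ((k : ℝ) + 1) := by
    intro N
    induction N with
    | zero => simp
    | succ N ih =>
      have hN : (N : ℝ) + 1 ≠ 0 := by positivity
      rw [sum_range_succ, neg_add, ← ih, Pi.mul_apply, mul_div_cancel_right₀ _ hN, weightedDiff]
      push_cast
      ring
  have hn0 : ((n + 1 : ℕ) : ℝ) ≠ 0 := by positivity
  rw [Pi.mul_apply, ← norm_neg (_ * _), ← mul_neg, ← key, one_div, inv_mul_cancel_left₀ hn0]

lemma evenPart_eq_nest {b : ℕ → ℝ} {φ : ℕ → ℂ} (h0 : b 0 = 0)
    (hφ : ∀ K, φ (2 * K + 1) = (diffTable (weightedDiff b) K 0 : ℝ)) :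
    evenPart b = nest 1 1 φ + nest 1 (-1) φ := by
  funext M
  induction M with
  | zero => simp [evenPart, diffTable, h0, nest_zero]
  | succ M ih =>
    rw [Pi.add_apply] at ih ⊢
    rw [nest_succ, nest_succ, add_add_add_comm, ← ih]
    obtain ⟨K, rfl | rfl⟩ := M.even_or_odd'
    · rw [evenPart_two_mul_add_one, evenPart_two_mul, one_pow, (odd_two_mul_add_one K).neg_one_pow]
      ring
    · rw [show 2 * K + 1 + 1 = 2 * (K + 1) by ring, evenPart_two_mul_add_one, evenPart_two_mul,
        one_pow, (even_two_mul (K + 1)).neg_one_pow, hφ, diffTable_weightedDiff, diffTable_succ]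
      have hK : (K : ℂ) + 1 ≠ 0 := by exact_mod_cast K.succ_ne_zero
      push_cast
      field_simp
      ring

lemma oddPart_eq_nest {b : ℕ → ℝ} {ψ : ℕ → ℂ} (hd : LogBigO (-1) (weightedDiff b))
    (hψ : ∀ K, ψ (2 * K) = (∑' n, centralWeight n * diffTable (weightedDiff b) K n : ℝ)) :
    oddPart b = (fun _ => ((halfValue b 0 : ℝ) : ℂ)) + (nest 1 1 ψ - nest 1 (-1) ψ) := by
  funext M
  induction M with
  | zero => simp [oddPart, nest_zero]
  | succ M ih =>
    rw [Pi.add_apply, Pi.sub_apply] at ih ⊢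
    rw [nest_succ, nest_succ, add_sub_add_comm, ← add_assoc, ← ih]
    obtain ⟨K, rfl | rfl⟩ := M.even_or_odd'
    · rw [oddPart_two_mul_add_one, oddPart_two_mul, one_pow, (odd_two_mul_add_one K).neg_one_pow,
        hψ, ← halfValue_succ_sub (logBigO_of_weightedDiff hd) hd]
      have hK : 2 * (K : ℂ) + 1 ≠ 0 := by exact_mod_cast (2 * K).succ_ne_zero
      push_cast
      field_simp
      ring
    · rw [show 2 * K + 1 + 1 = 2 * (K + 1) by ring, oddPart_two_mul_add_one, oddPart_two_mul,
        one_pow, (even_two_mul (K + 1)).neg_one_pow]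
      ring

lemma logBigO_evenPart_sub_oddPart {w : ℕ} {b : ℕ → ℝ} (hb : LogBigO (-1) b)
    (hpos : ∀ K n, 0 ≤ diffTable b K (n + 1)) (he : ColoredSum w (evenPart b)) :
    LogBigO (-1) fun M => evenPart b M - oddPart b M := by
  have hD : LogBigO (-1) fun M => ‖evenPart b (M + 1) - evenPart b M‖ :=
    he.logBigO_increment.of_norm_le fun n => (norm_norm _).le
  have key : ∀ K, evenPart b (2 * K + 1 + 1) - evenPart b (2 * K + 1) =
      (-diffTable b K 1 : ℝ) := fun K => by
    rw [show 2 * K + 1 + 1 = 2 * (K + 1) by ring, evenPart_two_mul_add_one, evenPart_two_mul,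
      diffTable_succ]
    push_cast
    ring
  refine LogBigO.of_shift ((hD.add hD.shift).of_norm_le fun M => ?_)
  rw [Pi.add_apply, Real.norm_of_nonneg (by positivity)]
  obtain ⟨K, rfl | rfl⟩ := M.even_or_odd'
  · refine le_add_of_nonneg_of_le (norm_nonneg _) ?_
    have h := halfValue_succ_bounds hb hpos K
    rw [key, evenPart_two_mul_add_one, oddPart_two_mul_add_one, ← Complex.ofReal_sub,
      Complex.norm_real, Complex.norm_real, norm_neg, Real.norm_of_nonneg (hpos K 0),
      Real.norm_eq_abs, abs_le]
    rw [diffTable_succ] at h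
    constructor <;> linarith [hpos K 0]
  · refine le_add_of_le_of_nonneg ?_ (norm_nonneg _)
    have h := halfValue_succ_bounds hb hpos K
    rw [key, show 2 * K + 1 + 1 = 2 * (K + 1) by ring, evenPart_two_mul, oddPart_two_mul,
      ← Complex.ofReal_sub, Complex.norm_real, Complex.norm_real, norm_neg,
      Real.norm_of_nonneg (hpos K 0), Real.norm_eq_abs, abs_le]
    constructor <;> linarith [hpos K 0]

namespace Tame

lemma of_recursion {w : ℕ} {b : ℕ → ℝ} {φ ψ : ℕ → ℂ} (h0 : b 0 = 0)
    (hd : LogBigO (-1) (weightedDiff b)) (hpos : ∀ K n, 0 ≤ diffTable b K (n + 1))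
    (hφ : ∀ K, φ (2 * K + 1) = (diffTable (weightedDiff b) K 0 : ℝ))
    (hψ : ∀ K, ψ (2 * K) = (∑' n, centralWeight n * diffTable (weightedDiff b) K n : ℝ))
    (hφ' : ∀ ε : ℂ, ε ^ 2 = 1 → ColoredSum w (nest 1 ε φ))
    (hψ' : ∀ ε : ℂ, ε ^ 2 = 1 → ScaledSum w (nest 1 ε ψ)) : Tame w b := by
  have hb := logBigO_of_weightedDiff hd
  have he : ColoredSum w (evenPart b) := by
    rw [evenPart_eq_nest h0 hφ]
    exact (hφ' 1 (by norm_num)).add (hφ' (-1) (by norm_num))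
  have ho := oddPart_eq_nest hd hψ
  have hs : ScaledSum w (nest 1 1 ψ - nest 1 (-1) ψ) :=
    (hψ' 1 (by norm_num)).sub (hψ' (-1) (by norm_num))
  have ha : Approximable w (halfValue b 0 : ℝ) := by
    refine approximable_of_asymptotic he hs ?_
    have h := (logBigO_evenPart_sub_oddPart hb hpos he).mono (by norm_num : (-1 : ℝ) ≤ -1 / 2)
    rw [ho] at h
    exact h
  exact ⟨h0, hb, hpos, he, by rw [ho]; exact (ScaledSum.const ha).add hs, ha⟩

lemma base : Tame 1 fun n => 1 / (n : ℝ) := by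
  set d : ℕ → ℝ := fun n => if n = 0 then -1 else 0 with hd
  have hw : weightedDiff (fun n => 1 / (n : ℝ)) = d := by
    funext n
    rcases n with _ | n
    · simp [weightedDiff, hd]
    · have h1 : (n : ℝ) + 1 ≠ 0 := by positivity
      have h2 : (n : ℝ) + 1 + 1 ≠ 0 := by positivity
      simp [weightedDiff, hd, h1, h2]
  have hT : ∀ K, diffTable d K = d := by
    intro K
    induction K with
    | zero => rfl
    | succ K ih =>
      funext n
      rw [diffTable_succ, ih]
      simp [hd]
  have hs : ∀ ε : ℂ, ε ^ 2 = 1 → ColoredSum 1 (nest 1 ε ((-1 : ℚ) • 1)) := fun ε hε => by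
    rw [nest_smul_rat]
    exact ((ColoredSum.one.nest one_pos hε).of_eq (zero_add 1)).smul (-1)
  refine of_recursion (φ := (-1 : ℚ) • 1) (ψ := (-1 : ℚ) • 1) (by simp) ?_
    (diffTable_nonneg_of_weightedDiff_nonpos fun K n => ?_) (fun K => ?_) (fun K => ?_) hs
    fun ε hε => .of_coloredSum (hs ε hε)
  · rw [hw]
    refine LogBigO.of_shift ((logBigO_inv_natCast_add_one ℝ).of_norm_le fun n => ?_)
    simp [hd]
  · rw [hw, hT, hd]
    dsimp only
    split_ifs <;> norm_num
  · rw [hw, hT]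
    simp [hd]
  · rw [hw, hT, tsum_eq_single 0 fun n hn => by simp [hd, hn]]
    simp [hd, centralWeight_zero]

variable {w : ℕ} {c : ℕ → ℝ}

lemma divide (hc : Tame w c) : Tame (w + 1) fun n => c n / n := by
  have hw : weightedDiff (fun n => c n / (n : ℝ)) = fun n => c n - c (n + 1) := by
    funext n
    have h1 : (n : ℝ) + 1 ≠ 0 := by positivity
    rcases eq_or_ne n 0 with rfl | hn
    · simp [weightedDiff, hc.zero]
    · have h2 : (n : ℝ) ≠ 0 := by exact_mod_cast hn
      rw [weightedDiff]
      push_cast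
      field_simp
  refine of_recursion (φ := fun n => evenPart c (n + 1)) (ψ := fun n => oddPart c (n + 1)) (by simp)
    ?_ (diffTable_nonneg_of_weightedDiff_nonneg (fun n => ?_) fun K n => ?_) (fun K => ?_)
    (fun K => ?_) (fun ε hε => hc.coloredSum.nest_shift one_pos hε)
    fun ε hε => hc.scaledSum.nest_shift one_pos hε
  · rw [hw]
    exact hc.logBigO.sub hc.logBigO.shift
  · exact div_nonneg (hc.nonneg 0 n) (Nat.cast_nonneg _)
  · rw [hw, diffTable_sub_shift]
    exact hc.nonneg _ _
  · rw [hw, diffTable_sub_shift, show 2 * K + 1 + 1 = 2 * (K + 1) by ring, evenPart_two_mul]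
  · simp only [hw, diffTable_sub_shift]
    rw [oddPart_two_mul_add_one, halfValue]

lemma average (hc : Tame w c) : Tame (w + 1) fun n => (∑ k ∈ range (n + 1), c k) / n := by
  have hw : weightedDiff (fun n => (∑ k ∈ range (n + 1), c k) / (n : ℝ)) = fun n => -c (n + 1) := by
    funext n
    have h1 : (n : ℝ) + 1 ≠ 0 := by positivity
    rcases eq_or_ne n 0 with rfl | hn
    · simp [weightedDiff, hc.zero, sum_range_succ]
    · have h2 : (n : ℝ) ≠ 0 := by exact_mod_cast hn
      rw [weightedDiff, sum_range_succ _ (n + 1)]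
      push_cast
      field_simp
      ring
  refine of_recursion (φ := (fun n => evenPart c (n + 1)) - evenPart c)
    (ψ := (fun n => oddPart c (n + 1)) - oddPart c) (by simp) ?_
    (diffTable_nonneg_of_weightedDiff_nonpos fun K n => ?_) (fun K => ?_) (fun K => ?_)
    (fun ε hε => ?_) fun ε hε => ?_
  · rw [hw]
    exact hc.logBigO.shift.neg
  · rw [hw, diffTable_neg_shift]
    exact neg_nonpos.2 (hc.nonneg _ _)
  · rw [hw, diffTable_neg_shift, Pi.sub_apply, show 2 * K + 1 + 1 = 2 * (K + 1) by ring,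
      evenPart_two_mul, evenPart_two_mul_add_one, diffTable_succ]
    push_cast
    ring
  · simp only [hw, diffTable_neg_shift]
    rw [Pi.sub_apply, oddPart_two_mul_add_one, oddPart_two_mul, halfValue, halfValue,
      ← Complex.ofReal_sub, ← (summable_centralWeight_mul (hc.logBigO.diffTable _)).tsum_sub
        (summable_centralWeight_mul (hc.logBigO.diffTable _))]
    congr 2
    funext n
    rw [diffTable_succ]
    ring
  · rw [map_sub]
    exact (hc.coloredSum.nest_shift one_pos hε).sub (hc.coloredSum.nest one_pos hε)
  · rw [map_sub]
    exact (hc.scaledSum.nest_shift one_pos hε).sub (hc.scaledSum.nest one_pos hε)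

lemma summable_and_tsum_mem (hw : 0 < w) (hc : Tame w c) :
    Summable (fun n => centralWeight (n + 1) * c (n + 1)) ∧
      ((∑' n, centralWeight (n + 1) * c (n + 1) : ℝ) : ℂ) ∈ CMZV 2 w := by
  have h := summable_centralWeight_mul hc.logBigO
  refine ⟨(summable_nat_add_iff 1).2 h, ?_⟩
  obtain ⟨f, hf, hcf⟩ := hc.approximable
  have h1 := mem_CMZV_of_approx hw hf hcf
  have h2 : halfValue c 0 = ∑' n, centralWeight (n + 1) * c (n + 1) := by
    have h3 := h.tsum_eq_zero_add
    rw [hc.zero, mul_zero, zero_add] at h3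
    exact h3
  rwa [h2] at h1

end Tame

/-- The rational span of the tame sequences of weight `w`. -/
noncomputable def tameSpan (w : ℕ) : Submodule ℚ (ℕ → ℝ) := Submodule.span ℚ {A | Tame w A}

namespace tameSpan

variable {w : ℕ} {A : ℕ → ℝ}

lemma zero (hA : A ∈ tameSpan w) : A 0 = 0 := by
  induction hA using Submodule.span_induction with
  | mem A h => exact h.zero
  | zero => rfl
  | add _ _ _ _ h₁ h₂ => rw [Pi.add_apply, h₁, h₂, add_zero]
  | smul q _ _ h => rw [Pi.smul_apply, h, smul_zero]

lemma divide (hA : A ∈ tameSpan w) : (fun n => A n / n) ∈ tameSpan (w + 1) := by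
  induction hA using Submodule.span_induction with
  | mem A h => exact Submodule.subset_span h.divide
  | zero =>
    simp only [Pi.zero_apply, zero_div]
    exact (tameSpan (w + 1)).zero_mem
  | add _ _ _ _ h₁ h₂ =>
    simp only [Pi.add_apply, add_div]
    exact add_mem h₁ h₂
  | smul q _ _ h =>
    simp only [Pi.smul_apply, smul_div_assoc]
    exact (tameSpan (w + 1)).smul_mem q h

lemma average (hA : A ∈ tameSpan w) :
    (fun n => (∑ k ∈ range (n + 1), A k) / n) ∈ tameSpan (w + 1) := by
  induction hA using Submodule.span_induction with
  | mem A h => exact Submodule.subset_span h.average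
  | zero =>
    simp only [Pi.zero_apply, sum_const_zero, zero_div]
    exact (tameSpan (w + 1)).zero_mem
  | add _ _ _ _ h₁ h₂ =>
    simp only [Pi.add_apply, sum_add_distrib, add_div]
    exact add_mem h₁ h₂
  | smul q _ _ h =>
    simp only [Pi.smul_apply, ← smul_sum, smul_div_assoc]
    exact (tameSpan (w + 1)).smul_mem q h

lemma summable_and_tsum_mem (hw : 0 < w) (hA : A ∈ tameSpan w) :
    Summable (fun n => centralWeight (n + 1) * A (n + 1)) ∧
      ((∑' n, centralWeight (n + 1) * A (n + 1) : ℝ) : ℂ) ∈ CMZV 2 w := by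
  induction hA using Submodule.span_induction with
  | mem A h => exact h.summable_and_tsum_mem hw
  | zero => simp [summable_zero]
  | add _ _ _ _ h₁ h₂ =>
    simp only [Pi.add_apply, mul_add]
    refine ⟨h₁.1.add h₂.1, ?_⟩
    rw [h₁.1.tsum_add h₂.1, Complex.ofReal_add]
    exact add_mem h₁.2 h₂.2
  | smul q _ _ h =>
    simp only [Pi.smul_apply, Rat.smul_def, mul_left_comm _ (q : ℝ)]
    refine ⟨h.1.mul_left _, ?_⟩
    rw [tsum_mul_left, Complex.ofReal_mul, Complex.ofReal_ratCast, ← Rat.smul_def]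
    exact (CMZV 2 w).smul_mem q h.2

lemma nestedSum_div_mem {m : ℕ} (t : Fin m → ℕ) (ht : ∀ i, 0 < t i) (s : ℕ) :
    (fun n : ℕ => nestedSum m (fun i k => 1 / (k : ℝ) ^ t i) (n - 1) / (n : ℝ) ^ (s + 1)) ∈
      tameSpan (∑ i, t i + s + 1) := by
  induction m generalizing s with
  | zero =>
    simp only [nestedSum_zero]
    induction s with
    | zero =>
      simp only [zero_add, pow_one, univ_eq_empty, sum_empty]
      exact Submodule.subset_span Tame.base
    | succ s ih => simpa only [div_div, ← pow_succ, ← add_assoc] using divide ih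
  | succ m ihm =>
    induction s with
    | succ s ih => simpa only [div_div, ← pow_succ, ← add_assoc] using divide ih
    | zero =>
      obtain ⟨r, hr⟩ := Nat.exists_eq_add_of_lt (ht 0)
      rw [zero_add] at hr
      have h := ihm (fun i => t i.succ) (fun i => ht _) r
      set G : ℕ → ℝ := fun n =>
        nestedSum m (fun i k => 1 / (k : ℝ) ^ t i.succ) (n - 1) / (n : ℝ) ^ (r + 1) with hG
      have h1 := sub_mem (average h) (divide h)
      rw [show ∑ i, t i + 0 + 1 = ∑ i : Fin m, t i.succ + r + 1 + 1 by
        rw [Fin.sum_univ_succ, hr]; ring]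
      convert! h1 using 1
      funext n
      rw [Pi.sub_apply, ← sub_div, sum_range_succ, add_sub_cancel_right, zero_add, pow_one]
      congr 1
      rcases n with _ | n
      · simp [nestedSum_succ]
      · rw [Nat.add_sub_cancel, nestedSum_succ, sum_range_succ', zero h, add_zero]
        refine sum_congr rfl fun k _ => ?_
        rw [hG, hr]
        simp only [Nat.add_sub_cancel]
        ring

end tameSpan

end CentralBinomialSum

/-- For a tuple `(t₁,…,t_m)` of positive integers with sum `u` and an
integer `s ≥ 1`, the convergent series `∑_{n=1}^∞ (H_{n-1}^{(t₁,…,t_m)}/n^s) · 4^{-n} · C(2n,n)`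
belongs to `CMZV²_{s+u}`. -/
theorem statement3 (m : ℕ) (t : Fin m → ℕ) (ht : ∀ i, 0 < t i) (u : ℕ) (hu : ∑ i, t i = u)
    (s : ℕ) (hs : 1 ≤ s) :
    Summable (fun n : ℕ =>
      multiHarmonic t n / ((n + 1 : ℕ) : ℝ) ^ s
        * ((Nat.choose (2 * (n + 1)) (n + 1) : ℝ) / 4 ^ (n + 1))) ∧
    ((↑(∑' n : ℕ, multiHarmonic t n / ((n + 1 : ℕ) : ℝ) ^ s
        * ((Nat.choose (2 * (n + 1)) (n + 1) : ℝ) / 4 ^ (n + 1))) : ℂ) ∈ CMZV 2 (s + u)) := by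
  obtain ⟨r, rfl⟩ := Nat.exists_eq_add_of_le' hs
  have h := CentralBinomialSum.tameSpan.summable_and_tsum_mem (Nat.succ_pos _)
    (CentralBinomialSum.tameSpan.nestedSum_div_mem t ht r)
  have hterm : ∀ n : ℕ, CentralBinomialSum.centralWeight (n + 1) *
      (CentralBinomialSum.nestedSum m (fun i k => 1 / (k : ℝ) ^ t i) (n + 1 - 1) /
        ((n + 1 : ℕ) : ℝ) ^ (r + 1)) =
      multiHarmonic t n / ((n + 1 : ℕ) : ℝ) ^ (r + 1)
        * ((Nat.choose (2 * (n + 1)) (n + 1) : ℝ) / 4 ^ (n + 1)) := fun n => by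
    rw [mul_comm, CentralBinomialSum.centralWeight, Nat.centralBinom_eq_two_mul_choose]
    rfl
  simp only [hterm] at h
  rwa [hu, show (u + r).succ = r + 1 + u by lia] at h
end

section
/- Let (t₁,…,t_m) be a (possibly empty) tuple of positive integers with t₁+⋯+t_m = u, and let s ≥ 3 be an integer. Then the convergent series ∑_{n=1}^∞ (H_{n-1}^{(t₁,…,t_m)}/n^s)·(4^{-n}·binom(2n,n))^{-2} = ∑_{n=1}^∞ (H_{n-1}^{(t₁,…,t_m)}/n^s)·16^n·binom(2n,n)^{-2} belongs to CMZV⁴_{s+u}, the ℚ-linear span in ℂ of colored multiple zeta values of level 4 and weight s+u. -/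
open scoped BigOperators

namespace CentralBinomialSeries

open Finset Filter Topology

/-- The coefficient of the term `n₁ = n` in the multiple series with exponents `s` and colors `a`:
the partial sums of `multiCoeff k s a` are the multiple partial sums. -/
noncomputable def multiCoeff : (k : ℕ) → (Fin k → ℕ) → (Fin k → ℂ) → ℕ → ℂ
  | 0, _, _, n => if n = 0 then 1 else 0
  | k + 1, s, a, n =>
      a 0 ^ n / (n : ℂ) ^ s 0 * ∑ m ∈ range n, multiCoeff k (Fin.tail s) (Fin.tail a) m

theorem multiCoeff_zero_apply_zero (k : ℕ) (s : Fin (k + 1) → ℕ) (a : Fin (k + 1) → ℂ) :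
    multiCoeff (k + 1) s a 0 = 0 := by
  simp [multiCoeff]

/-- The multiple sum over `N > n₁ > ⋯ > n_k ≥ 1`. -/
noncomputable def boundedMultipleSum (k : ℕ) (s : Fin k → ℕ) (a : Fin k → ℂ) (N : ℕ) : ℂ :=
  ∑ n : Fin k → Fin N,
    if (∀ i j : Fin k, i < j → (n j : ℕ) < (n i : ℕ)) ∧ (∀ i, 0 < (n i : ℕ)) then
      ∏ i, (a i) ^ (n i : ℕ) / ((n i : ℕ) : ℂ) ^ (s i)
    else 0

theorem boundedMultipleSum_succ (k : ℕ) (s : Fin (k + 1) → ℕ) (a : Fin (k + 1) → ℂ) (N : ℕ) :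
    boundedMultipleSum (k + 1) s a N = ∑ n ∈ range N, if 0 < n then
      a 0 ^ n / (n : ℂ) ^ s 0 * boundedMultipleSum k (Fin.tail s) (Fin.tail a) n else 0 := by
  classical
  rw [← Fin.sum_univ_eq_sum_range (fun n => if 0 < n then
      a 0 ^ n / (n : ℂ) ^ s 0 * boundedMultipleSum k (Fin.tail s) (Fin.tail a) n else 0),
    boundedMultipleSum, ← (Fin.consEquiv fun _ => Fin N).sum_comp, Fintype.sum_prod_type]
  refine Finset.sum_congr rfl fun n _ => ?_
  by_cases hn : 0 < (n : ℕ)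
  · rw [if_pos hn, boundedMultipleSum, Finset.mul_sum]
    symm
    refine Fintype.sum_of_injective (fun x i => Fin.castLE n.2.le (x i)) ?_ _ _ ?_ ?_
    · intro x x' h
      funext i
      have := congrFun h i
      simpa [Fin.ext_iff] using this
    · intro x hx
      refine if_neg fun h => hx ?_
      refine ⟨fun i => ⟨x i, ?_⟩, ?_⟩
      · simpa [Fin.consEquiv] using h.1 0 i.succ (Fin.succ_pos i)
      · funext i
        simp
    · intro x
      have hiff : ((∀ i j : Fin (k + 1), i < j →
            ((Fin.consEquiv fun _ => Fin N) (n, fun i => Fin.castLE n.2.le (x i)) j : ℕ) <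
              ((Fin.consEquiv fun _ => Fin N) (n, fun i => Fin.castLE n.2.le (x i)) i : ℕ)) ∧
          (∀ i, 0 <
            ((Fin.consEquiv fun _ => Fin N) (n, fun i => Fin.castLE n.2.le (x i)) i : ℕ))) ↔
          ((∀ i j : Fin k, i < j → (x j : ℕ) < (x i : ℕ)) ∧ (∀ i, 0 < (x i : ℕ))) := by
        simp only [Fin.forall_fin_succ, Fin.consEquiv, Equiv.coe_fn_mk, Fin.cons_zero,
          Fin.cons_succ, Fin.val_castLE, Fin.succ_lt_succ_iff, Fin.succ_pos, forall_const,
          Fin.not_lt_zero, IsEmpty.forall_iff, true_and, hn]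
        refine ⟨fun h => ⟨h.1.2, h.2⟩, fun h => ⟨⟨fun i => (x i).2, h.1⟩, h.2⟩⟩
      by_cases hx : (∀ i j : Fin k, i < j → (x j : ℕ) < (x i : ℕ)) ∧ (∀ i, 0 < (x i : ℕ))
      · rw [if_pos hx, if_pos (hiff.2 hx), Fin.prod_univ_succ]
        simp [Fin.consEquiv, Fin.tail]
      · rw [if_neg hx, if_neg (fun h => hx (hiff.1 h)), mul_zero]
  · rw [if_neg hn]
    refine Finset.sum_eq_zero fun x _ => if_neg fun h => hn ?_
    simpa [Fin.consEquiv] using h.2 0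

theorem sum_multiCoeff_eq_boundedMultipleSum (k : ℕ) (s : Fin k → ℕ) (a : Fin k → ℂ) {N : ℕ}
    (hN : 0 < N) : ∑ m ∈ range N, multiCoeff k s a m = boundedMultipleSum k s a N := by
  induction k generalizing N with
  | zero =>
    simp [multiCoeff, boundedMultipleSum, hN]
  | succ k ih =>
    rw [boundedMultipleSum_succ]
    refine Finset.sum_congr rfl fun n _ => ?_
    split_ifs with hn
    · rw [multiCoeff, ih _ _ hn]
    · obtain rfl : n = 0 := by omega
      exact multiCoeff_zero_apply_zero k s a

theorem sum_multiCoeff (k : ℕ) (s : Fin k → ℕ) (a : Fin k → ℂ) (M : ℕ) :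
    ∑ m ∈ range (M + 1), multiCoeff k s a m = multiplePartialSum k s a M :=
  sum_multiCoeff_eq_boundedMultipleSum k s a M.succ_pos

theorem ofReal_multiHarmonic {m : ℕ} (t : Fin m → ℕ) (n : ℕ) :
    (multiHarmonic t n : ℂ) = ∑ j ∈ range (n + 1), multiCoeff m t (fun _ => 1) j := by
  rw [sum_multiCoeff, multiHarmonic, multiplePartialSum, Complex.ofReal_sum]
  refine Finset.sum_congr rfl fun x _ => ?_
  split_ifs <;> simp

theorem multiHarmonic_nonneg {m : ℕ} (t : Fin m → ℕ) (n : ℕ) : 0 ≤ multiHarmonic t n := by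
  refine Finset.sum_nonneg fun x _ => ?_
  split_ifs
  · positivity
  · exact le_rfl

/-! ### Operations on coefficient sequences -/

/-- Coefficients of the iterated integral against `dt / t`. -/
noncomputable def divIndex (c : ℕ → ℂ) (n : ℕ) : ℂ := c n / n

/-- Coefficients of the iterated integral against `a dt / (1 - a t)`. -/
noncomputable def geomConv (a : ℂ) (c : ℕ → ℂ) (n : ℕ) : ℂ :=
  (∑ m ∈ range n, a ^ (n - m) * c m) / n

@[simp] theorem divIndex_zero (c : ℕ → ℂ) : divIndex c 0 = 0 := by simp [divIndex]

@[simp] theorem geomConv_zero (a : ℂ) (c : ℕ → ℂ) : geomConv a c 0 = 0 := by simp [geomConv]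

/-- The `ℚ`-span of the coefficient sequences of the level four multiple polylogarithms of
weight `w`. -/
noncomputable def coeffSpan (w : ℕ) : Submodule ℚ (ℕ → ℂ) :=
  Submodule.span ℚ {c | ∃ (k : ℕ) (s : Fin k → ℕ) (a : Fin k → ℂ), (∀ i, 0 < s i) ∧
    ∑ i, s i = w ∧ (∀ i, a i ^ 4 = 1) ∧ c = multiCoeff k s a}

theorem divIndex_multiCoeff (k : ℕ) (s : Fin (k + 1) → ℕ) (a : Fin (k + 1) → ℂ) :
    divIndex (multiCoeff (k + 1) s a) =
      multiCoeff (k + 1) (Fin.cons (s 0 + 1) (Fin.tail s)) a := by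
  funext n
  simp only [divIndex, multiCoeff, Fin.cons_zero, Fin.tail_cons]
  rcases eq_or_ne n 0 with rfl | hn
  · simp
  · have : (n : ℂ) ≠ 0 := Nat.cast_ne_zero.2 hn
    rw [pow_succ]
    field_simp

theorem exists_multiCoeff_scale {a : ℂ} (ha : a ^ 4 = 1) (k : ℕ) (s : Fin k → ℕ) (b : Fin k → ℂ)
    (hb : ∀ i, b i ^ 4 = 1) : ∃ b' : Fin k → ℂ, (∀ i, b' i ^ 4 = 1) ∧
      ∀ n, multiCoeff k s b' n = (a ^ n)⁻¹ * multiCoeff k s b n := by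
  cases k with
  | zero =>
    refine ⟨b, hb, fun n => ?_⟩
    rcases eq_or_ne n 0 with rfl | hn
    · simp
    · simp [multiCoeff, hn]
  | succ k =>
    refine ⟨Fin.cons (b 0 / a) (Fin.tail b), ?_, fun n => ?_⟩
    · refine Fin.cases ?_ fun i => ?_
      · simp [div_pow, hb 0, ha]
      · simpa [Fin.tail] using hb i.succ
    · simp only [multiCoeff, Fin.cons_zero, Fin.tail_cons, div_pow]
      ring

theorem geomConv_multiCoeff {a : ℂ} (ha : a ^ 4 = 1) (k : ℕ) (s : Fin k → ℕ) (b b' : Fin k → ℂ)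
    (hb' : ∀ n, multiCoeff k s b' n = (a ^ n)⁻¹ * multiCoeff k s b n) :
    geomConv a (multiCoeff k s b) = multiCoeff (k + 1) (Fin.cons 1 s) (Fin.cons a b') := by
  have ha0 : a ≠ 0 := by rintro rfl; simp at ha
  funext n
  simp only [geomConv, multiCoeff, Fin.cons_zero, Fin.tail_cons, pow_one, hb', Finset.mul_sum,
    Finset.sum_div]
  refine Finset.sum_congr rfl fun m hm => ?_
  have hm : m ≤ n := (Finset.mem_range.1 hm).le
  rw [pow_sub₀ _ ha0 hm]
  ring

theorem divIndex_mem_coeffSpan {w : ℕ} (hw : 0 < w) {c : ℕ → ℂ} (hc : c ∈ coeffSpan w) :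
    divIndex c ∈ coeffSpan (w + 1) := by
  induction hc using Submodule.span_induction with
  | mem c hc =>
    obtain ⟨k, s, a, hs, hsum, ha, rfl⟩ := hc
    cases k with
    | zero => simp at hsum; omega
    | succ k =>
      refine Submodule.subset_span ⟨k + 1, _, a, ?_, ?_, ha, divIndex_multiCoeff k s a⟩
      · refine Fin.cases (by simp) fun i => ?_
        simpa [Fin.tail] using hs i.succ
      · rw [Fin.sum_univ_succ] at hsum ⊢
        simp only [Fin.cons_zero, Fin.cons_succ, Fin.tail]
        omega
  | zero =>
    convert (coeffSpan (w + 1)).zero_mem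
    funext n; simp [divIndex]
  | add c d _ _ hc hd =>
    convert (coeffSpan (w + 1)).add_mem hc hd
    funext n; simp [divIndex, add_div]
  | smul q c _ hc =>
    convert (coeffSpan (w + 1)).smul_mem q hc
    funext n; simp [divIndex, Rat.smul_def, mul_div_assoc]

theorem geomConv_mem_coeffSpan {a : ℂ} (ha : a ^ 4 = 1) {w : ℕ} {c : ℕ → ℂ}
    (hc : c ∈ coeffSpan w) : geomConv a c ∈ coeffSpan (w + 1) := by
  induction hc using Submodule.span_induction with
  | mem c hc =>
    obtain ⟨k, s, b, hs, hsum, hb, rfl⟩ := hc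
    obtain ⟨b', hb'4, hb'⟩ := exists_multiCoeff_scale ha k s b hb
    refine Submodule.subset_span
      ⟨k + 1, _, _, ?_, ?_, ?_, geomConv_multiCoeff ha k s b b' hb'⟩
    · exact Fin.cases (by simp) fun i => by simpa using hs i
    · rw [Fin.sum_univ_succ]
      simp only [Fin.cons_zero, Fin.cons_succ]
      omega
    · exact Fin.cases (by simpa using ha) fun i => by simpa using hb'4 i
  | zero =>
    convert (coeffSpan (w + 1)).zero_mem
    funext n; simp [geomConv]
  | add c d _ _ hc hd =>
    convert (coeffSpan (w + 1)).add_mem hc hd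
    funext n; simp [geomConv, mul_add, Finset.sum_add_distrib, add_div]
  | smul q c _ hc =>
    convert (coeffSpan (w + 1)).smul_mem q hc
    funext n
    simp only [geomConv, Pi.smul_apply, Rat.smul_def, ← mul_div_assoc, Finset.mul_sum]
    congr 1
    exact Finset.sum_congr rfl fun m _ => by ring

theorem apply_zero_of_mem_coeffSpan {w : ℕ} (hw : 0 < w) {c : ℕ → ℂ} (hc : c ∈ coeffSpan w) :
    c 0 = 0 := by
  induction hc using Submodule.span_induction with
  | mem c hc =>
    obtain ⟨k, s, a, -, hsum, -, rfl⟩ := hc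
    cases k with
    | zero => simp at hsum; omega
    | succ k => exact multiCoeff_zero_apply_zero k s a
  | zero => rfl
  | add c d _ _ hc hd => simp [hc, hd]
  | smul q c _ hc => simp [hc]

/-! ### Growth of coefficient sequences -/

/-- The sequence `c` is `O(n ^ (-1 / 2))`. -/
def SqrtDecay (c : ℕ → ℂ) : Prop := ∃ C : ℝ, ∀ n, ‖c n‖ ≤ C / √(n + 1)

theorem sum_inv_sqrt_le (n : ℕ) : ∑ m ∈ range n, 1 / √((m : ℝ) + 1) ≤ 2 * √n := by
  induction n with
  | zero => simp
  | succ n ih =>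
    rw [Finset.sum_range_succ]
    push_cast
    have h1 : 0 < √((n : ℝ) + 1) := Real.sqrt_pos.2 (by positivity)
    have h2 : √((n : ℝ) + 1) ^ 2 = n + 1 := Real.sq_sqrt (by positivity)
    have h3 : √(n : ℝ) ^ 2 = n := Real.sq_sqrt (by positivity)
    have h4 : 1 / √((n : ℝ) + 1) ≤ 2 * √((n : ℝ) + 1) - 2 * √n := by
      rw [div_le_iff₀ h1]
      nlinarith [sq_nonneg (√((n : ℝ) + 1) - √n)]
    linarith

theorem SqrtDecay.nonneg {c : ℕ → ℂ} {C : ℝ} (hC : ∀ n, ‖c n‖ ≤ C / √(n + 1)) : 0 ≤ C := by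
  simpa using (norm_nonneg _).trans (hC 0)

theorem SqrtDecay.divIndex {c : ℕ → ℂ} (hc : SqrtDecay c) : SqrtDecay (divIndex c) := by
  obtain ⟨C, hC⟩ := hc
  refine ⟨C, fun n => le_trans ?_ (hC n)⟩
  rw [CentralBinomialSeries.divIndex, norm_div, Complex.norm_natCast]
  rcases eq_or_ne n 0 with rfl | hn
  · simp
  · exact div_le_self (norm_nonneg _) (by exact_mod_cast Nat.one_le_iff_ne_zero.2 hn)

theorem SqrtDecay.geomConv {a : ℂ} (ha : a ^ 4 = 1) {c : ℕ → ℂ} (hc : SqrtDecay c) :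
    SqrtDecay (geomConv a c) := by
  obtain ⟨C, hC⟩ := hc
  have hC0 := SqrtDecay.nonneg hC
  have hna : ‖a‖ = 1 := Complex.norm_eq_one_of_pow_eq_one ha (by norm_num)
  refine ⟨4 * C, fun n => ?_⟩
  rw [CentralBinomialSeries.geomConv, norm_div, Complex.norm_natCast]
  rcases eq_or_ne n 0 with rfl | hn
  · simp; positivity
  have hn1 : (1 : ℝ) ≤ n := by exact_mod_cast Nat.one_le_iff_ne_zero.2 hn
  have hsum : ‖∑ m ∈ range n, a ^ (n - m) * c m‖ ≤ C * (2 * √n) := by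
    calc _ ≤ ∑ m ∈ range n, ‖a ^ (n - m) * c m‖ := norm_sum_le _ _
      _ ≤ ∑ m ∈ range n, C * (1 / √((m : ℝ) + 1)) := by
          refine Finset.sum_le_sum fun m _ => ?_
          rw [norm_mul, norm_pow, hna, one_pow, one_mul, mul_one_div]
          exact hC m
      _ ≤ _ := by
          rw [← Finset.mul_sum]
          exact mul_le_mul_of_nonneg_left (sum_inv_sqrt_le n) hC0
  have h1 : 0 < √((n : ℝ) + 1) := Real.sqrt_pos.2 (by positivity)
  have h2 : √((n : ℝ) + 1) ≤ 2 * √n := by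
    rw [Real.sqrt_le_left (by positivity), mul_pow, Real.sq_sqrt (by positivity)]
    linarith
  have h3 : √(n : ℝ) ^ 2 = n := Real.sq_sqrt (by positivity)
  rw [div_le_div_iff₀ (by positivity) h1]
  calc _ ≤ C * (2 * √n) * (2 * √n) := by gcongr
    _ = 4 * C * √n ^ 2 := by ring
    _ = 4 * C * n := by rw [h3]

theorem sqrtDecay_multiCoeff_zero (s : Fin 0 → ℕ) (a : Fin 0 → ℂ) :
    SqrtDecay (multiCoeff 0 s a) := by
  refine ⟨1, fun n => ?_⟩
  rcases eq_or_ne n 0 with rfl | hn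
  · simp [multiCoeff]
  · simp only [multiCoeff, hn, if_false, norm_zero]
    positivity

theorem SqrtDecay.add {c d : ℕ → ℂ} (hc : SqrtDecay c) (hd : SqrtDecay d) :
    SqrtDecay (c + d) := by
  obtain ⟨C, hC⟩ := hc
  obtain ⟨D, hD⟩ := hd
  refine ⟨C + D, fun n => ?_⟩
  rw [add_div]
  exact (norm_add_le _ _).trans (add_le_add (hC n) (hD n))

theorem SqrtDecay.smul {c : ℕ → ℂ} (hc : SqrtDecay c) (q : ℚ) : SqrtDecay (q • c) := by
  obtain ⟨C, hC⟩ := hc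
  refine ⟨‖(q : ℂ)‖ * C, fun n => ?_⟩
  rw [Pi.smul_apply, Rat.smul_def, norm_mul, mul_div_assoc]
  exact mul_le_mul_of_nonneg_left (hC n) (norm_nonneg _)

theorem sqrtDecay_multiCoeff (k : ℕ) (s : Fin k → ℕ) (a : Fin k → ℂ) (hs : ∀ i, 0 < s i)
    (ha : ∀ i, a i ^ 4 = 1) : SqrtDecay (multiCoeff k s a) := by
  induction k with
  | zero => exact sqrtDecay_multiCoeff_zero s a
  | succ k ih =>
    obtain ⟨b, hb4, hb⟩ := exists_multiCoeff_scale
      (a := (a 0)⁻¹) (by rw [inv_pow, ha 0, inv_one]) k (Fin.tail s) (Fin.tail a)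
      (fun i => ha i.succ)
    have hb' : ∀ n, multiCoeff k (Fin.tail s) (Fin.tail a) n =
        (a 0 ^ n)⁻¹ * multiCoeff k (Fin.tail s) b n := by
      intro n
      have ha0 : a 0 ≠ 0 := by
        intro h
        simpa [h] using ha 0
      rw [hb, inv_pow, inv_inv, inv_mul_cancel_left₀ (pow_ne_zero n ha0)]
    obtain ⟨C, hC⟩ : SqrtDecay (multiCoeff (k + 1) (Fin.cons 1 (Fin.tail s)) a) := by
      have := geomConv_multiCoeff (ha 0) k (Fin.tail s) b (Fin.tail a) hb'
      rw [Fin.cons_self_tail] at this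
      rw [← this]
      exact (ih (Fin.tail s) b (fun i => hs i.succ) hb4).geomConv (ha 0)
    refine ⟨C, fun n => le_trans ?_ (hC n)⟩
    simp only [multiCoeff, Fin.cons_zero, Fin.tail_cons, norm_mul, norm_div, norm_pow,
      Complex.norm_natCast]
    rcases eq_or_ne n 0 with rfl | hn
    · simp
    have hn1 : (1 : ℝ) ≤ n := by exact_mod_cast Nat.one_le_iff_ne_zero.2 hn
    gcongr
    exact hs 0

theorem sqrtDecay_of_mem_coeffSpan {w : ℕ} {c : ℕ → ℂ} (hc : c ∈ coeffSpan w) :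
    SqrtDecay c := by
  induction hc using Submodule.span_induction with
  | mem c hc =>
    obtain ⟨k, s, a, hs, -, ha, rfl⟩ := hc
    exact sqrtDecay_multiCoeff k s a hs ha
  | zero => exact ⟨0, by simp⟩
  | add c d _ _ hc hd => exact hc.add hd
  | smul q c _ hc => exact hc.smul q

theorem SqrtDecay.summable_divIndex {c : ℕ → ℂ} (hc : SqrtDecay c) :
    Summable (CentralBinomialSeries.divIndex c) := by
  obtain ⟨C, hC⟩ := hc
  have hC0 := SqrtDecay.nonneg hC
  have hsum : Summable fun n : ℕ => C * ((n : ℝ) ^ (3 / 2 : ℝ))⁻¹ :=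
    (Real.summable_nat_rpow_inv.2 (by norm_num)).mul_left C
  refine Summable.of_norm_bounded hsum fun n => ?_
  rw [CentralBinomialSeries.divIndex, norm_div, Complex.norm_natCast]
  rcases eq_or_ne n 0 with rfl | hn
  · simp
  have hn0 : (0 : ℝ) < n := by exact_mod_cast Nat.pos_of_ne_zero hn
  have h1 : (n : ℝ) ^ (3 / 2 : ℝ) = √n * n := by
    rw [show (3 / 2 : ℝ) = 1 / 2 + 1 by norm_num, Real.rpow_add_one hn0.ne', Real.sqrt_eq_rpow]
  rw [h1, mul_inv, ← mul_assoc, ← div_eq_mul_inv, ← div_eq_mul_inv]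
  gcongr
  refine (hC n).trans ?_
  gcongr
  linarith

/-- A multiple polylogarithm whose outermost form is `dt / t` has a colored multiple zeta value
as its value at `1`. -/
theorem tsum_divIndex_mem_CMZV {w : ℕ} (hw : 0 < w) {c : ℕ → ℂ} (hc : c ∈ coeffSpan w) :
    ∑' n, divIndex c n ∈ CMZV 4 (w + 1) := by
  induction hc using Submodule.span_induction with
  | mem c hc =>
    obtain ⟨k, s, a, hs, hsum, ha, rfl⟩ := hc
    have hsm := (sqrtDecay_multiCoeff k s a hs ha).summable_divIndex
    cases k with
    | zero => simp at hsum; omega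
    | succ k =>
      rw [divIndex_multiCoeff] at hsm ⊢
      refine Submodule.subset_span ⟨k + 1, k.succ_pos,
        (Fin.cons (s 0 + 1) (Fin.tail s) : Fin (k + 1) → ℕ), a, ?_, ?_, ha, ?_, ?_⟩
      · exact Fin.cases (by simp) fun i => by simpa [Fin.tail] using hs i.succ
      · rw [Fin.sum_univ_succ] at hsum ⊢
        simp only [Fin.cons_zero, Fin.cons_succ, Fin.tail]
        omega
      · rintro ⟨h, -⟩
        have h' : s 0 + 1 = 1 := h
        have := hs 0
        omega
      · have := (tendsto_add_atTop_iff_nat 1).2 hsm.hasSum.tendsto_sum_nat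
        refine this.congr fun M => ?_
        exact sum_multiCoeff _ _ _ M
  | zero =>
    convert (CMZV 4 (w + 1)).zero_mem
    simp [divIndex]
  | add c d hc hd ihc ihd =>
    convert (CMZV 4 (w + 1)).add_mem ihc ihd
    rw [← ((sqrtDecay_of_mem_coeffSpan hc).summable_divIndex).tsum_add
      ((sqrtDecay_of_mem_coeffSpan hd).summable_divIndex)]
    exact tsum_congr fun n => by simp [divIndex, add_div]
  | smul q c hc ih =>
    convert (CMZV 4 (w + 1)).smul_mem q ih
    rw [Rat.smul_def, ← tsum_mul_left]
    exact tsum_congr fun n => by simp [divIndex, Rat.smul_def, mul_div_assoc]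

/-! ### Power series with polynomially bounded coefficients -/

/-- The sequence `a` grows at most polynomially. -/
def PolyBounded (a : ℕ → ℂ) : Prop := ∃ (C : ℝ) (k : ℕ), ∀ n, ‖a n‖ ≤ C * ((n : ℝ) + 1) ^ k

theorem PolyBounded.nonneg {a : ℕ → ℂ} {C : ℝ} {k : ℕ}
    (h : ∀ n, ‖a n‖ ≤ C * ((n : ℝ) + 1) ^ k) : 0 ≤ C := by
  simpa using (norm_nonneg _).trans (h 0)

theorem PolyBounded.shift {a : ℕ → ℂ} (ha : PolyBounded a) :
    PolyBounded fun n => a (n + 1) := by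
  obtain ⟨C, k, h⟩ := ha
  have hC := PolyBounded.nonneg h
  refine ⟨C * 2 ^ k, k, fun n => (h (n + 1)).trans ?_⟩
  rw [mul_assoc, ← mul_pow]
  push_cast
  gcongr
  linarith [(Nat.cast_nonneg n : (0 : ℝ) ≤ n)]

theorem PolyBounded.index_mul {a : ℕ → ℂ} (ha : PolyBounded a) :
    PolyBounded fun n => (n : ℂ) * a n := by
  obtain ⟨C, k, h⟩ := ha
  refine ⟨C, k + 1, fun n => ?_⟩
  rw [norm_mul, Complex.norm_natCast]
  calc (n : ℝ) * ‖a n‖ ≤ ((n : ℝ) + 1) * (C * ((n : ℝ) + 1) ^ k) := by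
        gcongr
        · linarith
        · exact h n
    _ = _ := by ring

theorem PolyBounded.const_mul {a : ℕ → ℂ} (ha : PolyBounded a) (b : ℂ) :
    PolyBounded fun n => b * a n := by
  obtain ⟨C, k, h⟩ := ha
  refine ⟨‖b‖ * C, k, fun n => ?_⟩
  rw [norm_mul, mul_assoc]
  exact mul_le_mul_of_nonneg_left (h n) (norm_nonneg b)

theorem SqrtDecay.polyBounded {c : ℕ → ℂ} (hc : SqrtDecay c) : PolyBounded c := by
  obtain ⟨C, hC⟩ := hc
  refine ⟨C, 0, fun n => (hC n).trans ?_⟩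
  rw [pow_zero, mul_one]
  refine div_le_self (SqrtDecay.nonneg hC) (Real.one_le_sqrt.2 ?_)
  linarith [(Nat.cast_nonneg n : (0 : ℝ) ≤ n)]

/-- The sum of the power series with coefficients `a`. -/
noncomputable def powSum (a : ℕ → ℂ) (z : ℂ) : ℂ := ∑' n, a n * z ^ n

theorem summable_add_one_pow_mul_geometric (k : ℕ) {r : ℝ} (h0 : 0 < r) (h1 : r < 1) :
    Summable fun n : ℕ => ((n : ℝ) + 1) ^ k * r ^ n := by
  have h := (summable_nat_add_iff 1).2
    (summable_pow_mul_geometric_of_norm_lt_one k (r := r) (by rwa [Real.norm_of_nonneg h0.le]))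
  refine (h.mul_left r⁻¹).congr fun n => ?_
  push_cast
  rw [pow_succ r]
  field_simp

theorem PolyBounded.summable {a : ℕ → ℂ} (ha : PolyBounded a) {z : ℂ} (hz : ‖z‖ < 1) :
    Summable fun n => a n * z ^ n := by
  obtain ⟨C, k, h⟩ := ha
  obtain ⟨r, hzr, hr1⟩ := exists_between hz
  have hr0 : 0 < r := (norm_nonneg z).trans_lt hzr
  refine Summable.of_norm_bounded
    ((summable_add_one_pow_mul_geometric k hr0 hr1).mul_left C) fun n => ?_
  rw [norm_mul, norm_pow, ← mul_assoc]
  have := PolyBounded.nonneg h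
  gcongr
  exact h n

theorem powSum_zero (a : ℕ → ℂ) : powSum a 0 = a 0 := by
  rw [powSum, tsum_eq_single 0]
  · simp
  · intro n hn
    simp [hn]

theorem powSum_eq_add_mul {a : ℕ → ℂ} (ha : PolyBounded a) {z : ℂ} (hz : ‖z‖ < 1) :
    powSum a z = a 0 + z * powSum (fun n => a (n + 1)) z := by
  rw [powSum, (ha.summable hz).tsum_eq_zero_add, powSum, ← tsum_mul_left]
  simp only [pow_zero, mul_one]
  congr 1
  exact tsum_congr fun n => by ring

theorem powSum_add {a b : ℕ → ℂ} (ha : PolyBounded a) (hb : PolyBounded b) {z : ℂ}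
    (hz : ‖z‖ < 1) : powSum (fun n => a n + b n) z = powSum a z + powSum b z := by
  simp only [powSum]
  rw [← (ha.summable hz).tsum_add (hb.summable hz)]
  exact tsum_congr fun n => by ring

theorem powSum_const_mul (a : ℕ → ℂ) (b z : ℂ) :
    powSum (fun n => b * a n) z = b * powSum a z := by
  simp only [powSum]
  rw [← tsum_mul_left]
  exact tsum_congr fun n => by ring

theorem hasDerivAt_powSum {a : ℕ → ℂ} (ha : PolyBounded a) {z : ℂ} (hz : ‖z‖ < 1) :
    HasDerivAt (powSum a) (powSum (fun n => ((n : ℂ) + 1) * a (n + 1)) z) z := by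
  obtain ⟨r, hzr, hr1⟩ := exists_between hz
  have hr0 : 0 < r := (norm_nonneg z).trans_lt hzr
  obtain ⟨C, k, h⟩ := id ha.index_mul.shift
  have hC := PolyBounded.nonneg h
  have hu : Summable fun n : ℕ => ‖(n : ℂ) * a n‖ * r ^ (n - 1) := by
    rw [← summable_nat_add_iff 1]
    refine Summable.of_nonneg_of_le (fun n => by positivity) (fun n => ?_)
      ((summable_add_one_pow_mul_geometric k hr0 hr1).mul_left C)
    rw [← mul_assoc, Nat.add_sub_cancel]
    gcongr
    exact h n
  have key := hasDerivAt_tsum_of_isPreconnected (g := fun n z => a n * z ^ n)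
    (g' := fun n z => a n * (n * z ^ (n - 1))) (y₀ := 0) hu Metric.isOpen_ball
    (convex_ball (0 : ℂ) r).isPreconnected
    (fun n y _ => (hasDerivAt_pow n y).const_mul (a n)) ?_ (by simpa using hr0)
    (ha.summable (by simp)) (y := z) (by simpa using hzr)
  · have hs : Summable fun n : ℕ => a n * ((n : ℂ) * z ^ (n - 1)) := by
      refine Summable.of_norm_bounded hu fun n => ?_
      rw [norm_mul, norm_mul, norm_mul, norm_pow, ← mul_assoc, mul_comm ‖a n‖]
      gcongr
    rw [hs.tsum_eq_zero_add] at key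
    refine HasDerivAt.congr_deriv (f := powSum a) key ?_
    simp only [powSum, Nat.cast_zero, zero_mul, mul_zero, zero_add, Nat.add_sub_cancel]
    exact tsum_congr fun n => by push_cast; ring
  · intro n y hy
    rw [norm_mul, norm_mul, norm_mul, norm_pow, ← mul_assoc, mul_comm ‖a n‖]
    have : ‖y‖ ≤ r := by simpa using (mem_ball_zero_iff.1 hy).le
    gcongr

theorem mul_powSum_deriv {a : ℕ → ℂ} (ha : PolyBounded a) {z : ℂ} (hz : ‖z‖ < 1) :
    z * powSum (fun n => ((n : ℂ) + 1) * a (n + 1)) z = powSum (fun n => (n : ℂ) * a n) z := by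
  rw [powSum_eq_add_mul ha.index_mul hz]
  simp

theorem hasDerivAt_powSum_divIndex {c : ℕ → ℂ} (hc : SqrtDecay c) (h0 : c 0 = 0) {z : ℂ}
    (hz : ‖z‖ < 1) (hz0 : z ≠ 0) :
    HasDerivAt (powSum (divIndex c)) (1 / z * powSum c z) z := by
  have hb := hc.divIndex.polyBounded
  convert hasDerivAt_powSum hb hz using 1
  rw [one_div, inv_mul_eq_iff_eq_mul₀ hz0, mul_powSum_deriv hb hz]
  congr 1
  funext n
  rcases eq_or_ne n 0 with rfl | hn
  · simp [h0]
  · have : (n : ℂ) ≠ 0 := Nat.cast_ne_zero.2 hn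
    simp only [divIndex]
    field_simp

theorem hasDerivAt_powSum_geomConv {a : ℂ} (ha : a ^ 4 = 1) {c : ℕ → ℂ} (hc : SqrtDecay c)
    {z : ℂ} (hz : ‖z‖ < 1) :
    HasDerivAt (powSum (geomConv a c)) (a / (1 - a * z) * powSum c z) z := by
  have hb := (hc.geomConv ha).polyBounded
  have hcb := hc.polyBounded
  have hna : ‖a‖ = 1 := Complex.norm_eq_one_of_pow_eq_one ha (by norm_num)
  have hne : 1 - a * z ≠ 0 := by
    intro h
    have : ‖a * z‖ = 1 := by rw [← sub_eq_zero.1 h, norm_one]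
    rw [norm_mul, hna, one_mul] at this
    exact hz.ne this
  convert hasDerivAt_powSum hb hz using 1
  set r : ℕ → ℂ := fun n => ((n : ℂ) + 1) * geomConv a c (n + 1) with hr
  have hrb : PolyBounded r := by
    have := hb.index_mul.shift
    simpa only [Nat.cast_add, Nat.cast_one] using this
  have hr' : ∀ n, r n = ∑ m ∈ range (n + 1), a ^ (n + 1 - m) * c m := by
    intro n
    have : (n : ℂ) + 1 ≠ 0 := Nat.cast_add_one_ne_zero n
    simp only [hr, geomConv, Nat.cast_add, Nat.cast_one]
    field_simp
  have hrec : ∀ n, r (n + 1) = a * r n + a * c (n + 1) := by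
    intro n
    rw [hr', Finset.sum_range_succ, hr', Finset.mul_sum]
    congr 1
    · refine Finset.sum_congr rfl fun m hm => ?_
      have hm := Finset.mem_range.1 hm
      rw [show n + 1 + 1 - m = n + 1 - m + 1 by omega, pow_succ]
      ring
    · simp
  have h1 := powSum_eq_add_mul hrb hz
  have h2 := powSum_eq_add_mul hcb hz
  rw [show (fun n => r (n + 1)) = fun n => a * r n + a * c (n + 1) from funext hrec,
    powSum_add (hrb.const_mul a) (hcb.shift.const_mul a) hz, powSum_const_mul,
    powSum_const_mul, show r 0 = a * c 0 by simp [hr']] at h1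
  rw [div_mul_eq_mul_div, div_eq_iff hne]
  linear_combination (-a) * (-h2) - h1

/-! ### The half-angle parametrization of the trigonometric functions -/

/-- `sin θ` for `z = tan (θ / 2)`. -/
noncomputable def sinHalf (z : ℂ) : ℂ := 2 * z / (1 + z ^ 2)

/-- `cos θ` for `z = tan (θ / 2)`. -/
noncomputable def cosHalf (z : ℂ) : ℂ := (1 - z ^ 2) / (1 + z ^ 2)

/-- `dθ / dz` for `z = tan (θ / 2)`. -/
noncomputable def angleDeriv (z : ℂ) : ℂ := 2 / (1 + z ^ 2)

theorem sinHalf_zero : sinHalf 0 = 0 := by simp [sinHalf]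

theorem one_add_ofReal_sq_ne_zero (t : ℝ) : (1 : ℂ) + (t : ℂ) ^ 2 ≠ 0 := by
  have : (1 : ℝ) + t ^ 2 ≠ 0 := by positivity
  exact_mod_cast this

theorem cosHalf_sq {z : ℂ} (hz : 1 + z ^ 2 ≠ 0) : cosHalf z ^ 2 = 1 - sinHalf z ^ 2 := by
  simp only [cosHalf, sinHalf]
  field_simp
  ring

theorem hasDerivAt_sinHalf {z : ℂ} (hz : 1 + z ^ 2 ≠ 0) :
    HasDerivAt sinHalf (cosHalf z * angleDeriv z) z := by
  have h := ((hasDerivAt_id z).const_mul 2).div ((hasDerivAt_pow 2 z).const_add 1) hz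
  refine HasDerivAt.congr_deriv (f := sinHalf) h ?_
  simp only [cosHalf, angleDeriv, id]
  field_simp
  ring

theorem hasDerivAt_cosHalf {z : ℂ} (hz : 1 + z ^ 2 ≠ 0) :
    HasDerivAt cosHalf (-(sinHalf z * angleDeriv z)) z := by
  have h := ((hasDerivAt_pow 2 z).const_sub 1).div ((hasDerivAt_pow 2 z).const_add 1) hz
  refine HasDerivAt.congr_deriv (f := cosHalf) h ?_
  simp only [sinHalf, angleDeriv]
  field_simp
  ring

theorem norm_sinHalf_sq_lt_one {t : ℝ} (h0 : 0 ≤ t) (h1 : t < 1) :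
    ‖sinHalf t ^ 2‖ < 1 := by
  have hs : sinHalf t = ((2 * t / (1 + t ^ 2) : ℝ) : ℂ) := by simp [sinHalf]
  have hnn : 0 ≤ 2 * t / (1 + t ^ 2) := by positivity
  rw [norm_pow, hs, Complex.norm_of_nonneg hnn]
  refine pow_lt_one₀ hnn ?_ two_ne_zero
  rw [div_lt_one (by positivity)]
  nlinarith [sq_pos_of_pos (sub_pos.2 h1)]

theorem norm_ofReal_lt_one {t : ℝ} (h0 : 0 ≤ t) (h1 : t < 1) : ‖(t : ℂ)‖ < 1 := by
  rwa [Complex.norm_of_nonneg h0]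

/-! ### The inverse central binomial generating function -/

/-- The reciprocal of the normalized central binomial coefficient. -/
noncomputable def invBinom (n : ℕ) : ℝ := 4 ^ n / n.centralBinom

theorem invBinom_nonneg (n : ℕ) : 0 ≤ invBinom n := by
  unfold invBinom
  positivity

theorem invBinom_le (n : ℕ) : invBinom n ≤ 2 * ((n : ℝ) + 1) := by
  have hpos : (0 : ℝ) < n.centralBinom := by exact_mod_cast n.centralBinom_pos
  rw [invBinom, div_le_iff₀ hpos]
  rcases Nat.eq_zero_or_pos n with rfl | hn
  · simp
  · have h : (4 : ℝ) ^ n ≤ 2 * n * n.centralBinom := by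
      exact_mod_cast Nat.four_pow_le_two_mul_self_mul_centralBinom n hn
    nlinarith

theorem invBinom_succ (n : ℕ) :
    (2 * (n : ℝ) + 1) * invBinom (n + 1) = 2 * ((n : ℝ) + 1) * invBinom n := by
  have hpos : (n.centralBinom : ℝ) ≠ 0 := by exact_mod_cast n.centralBinom_ne_zero
  have hpos' : ((n + 1).centralBinom : ℝ) ≠ 0 := by exact_mod_cast (n + 1).centralBinom_ne_zero
  have h : ((n : ℝ) + 1) * (n + 1).centralBinom = 2 * (2 * n + 1) * n.centralBinom := by
    exact_mod_cast Nat.succ_mul_centralBinom_succ n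
  simp only [invBinom]
  field_simp
  rw [pow_succ]
  linear_combination (-2 * 4 ^ n : ℝ) * h

/-- The coefficients `c n`, each divided by the normalized central binomial coefficient. -/
noncomputable def overBinom (c : ℕ → ℂ) (n : ℕ) : ℂ := c n * (invBinom n : ℂ)

theorem SqrtDecay.polyBounded_overBinom {c : ℕ → ℂ} (hc : SqrtDecay c) :
    PolyBounded (overBinom c) := by
  obtain ⟨C, k, h⟩ := hc.polyBounded
  refine ⟨C * 2, k + 1, fun n => ?_⟩
  rw [overBinom, norm_mul, Complex.norm_of_nonneg (invBinom_nonneg n)]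
  have := PolyBounded.nonneg h
  calc _ ≤ C * ((n : ℝ) + 1) ^ k * (2 * ((n : ℝ) + 1)) := by
        gcongr
        · exact invBinom_nonneg n
        · exact h n
        · exact invBinom_le n
    _ = _ := by ring

/-- The generating function `∑ c n sin²ⁿ θ / (4⁻ⁿ binom (2n) n)` for `z = tan (θ / 2)`. -/
noncomputable def binomSum (c : ℕ → ℂ) (z : ℂ) : ℂ := powSum (overBinom c) (sinHalf z ^ 2)

theorem hasDerivAt_sinHalf_sq {z : ℂ} (hz : 1 + z ^ 2 ≠ 0) :
    HasDerivAt (fun z => sinHalf z ^ 2) (2 * sinHalf z * (cosHalf z * angleDeriv z)) z := by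
  refine ((hasDerivAt_sinHalf hz).pow 2).congr_deriv ?_
  simp

theorem hasDerivAt_binomSum {c : ℕ → ℂ} (hc : SqrtDecay c) {t : ℝ} (h0 : 0 ≤ t) (h1 : t < 1) :
    HasDerivAt (binomSum c) (powSum (fun n => ((n : ℂ) + 1) * overBinom c (n + 1)) (sinHalf t ^ 2)
      * (2 * sinHalf t * (cosHalf t * angleDeriv t))) t :=
  (hasDerivAt_powSum hc.polyBounded_overBinom (norm_sinHalf_sq_lt_one h0 h1)).comp (t : ℂ)
    (hasDerivAt_sinHalf_sq (one_add_ofReal_sq_ne_zero t))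

/-- Dividing the coefficients by the index integrates against `2 cot θ dθ`. -/
theorem hasDerivAt_binomSum_divIndex {c : ℕ → ℂ} (hc : SqrtDecay c) (hc0 : c 0 = 0) {t : ℝ}
    (h0 : 0 < t) (h1 : t < 1) :
    HasDerivAt (binomSum (divIndex c))
      (2 * (cosHalf t * angleDeriv t) / sinHalf t * binomSum c t) t := by
  have hx := norm_sinHalf_sq_lt_one h0.le h1
  have hs : sinHalf t ≠ 0 := by
    have := one_add_ofReal_sq_ne_zero t
    have h0' : (t : ℂ) ≠ 0 := by exact_mod_cast h0.ne'
    simp [sinHalf, this, h0']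
  convert hasDerivAt_binomSum hc.divIndex h0.le h1 using 1
  have h := mul_powSum_deriv hc.divIndex.polyBounded_overBinom hx
  have h' : (fun n : ℕ => (n : ℂ) * overBinom (divIndex c) n) = overBinom c := by
    funext n
    rcases eq_or_ne n 0 with rfl | hn
    · simp [overBinom, hc0]
    · have : (n : ℂ) ≠ 0 := Nat.cast_ne_zero.2 hn
      simp only [overBinom, divIndex]
      field_simp
  rw [h'] at h
  rw [binomSum, ← h]
  field_simp

/-- The series `∑ c (n + 1) sin²ⁿ θ / (4⁻⁽ⁿ⁺¹⁾ binom (2n+2) (n+1))`. -/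
noncomputable def shiftedBinomSum (c : ℕ → ℂ) (z : ℂ) : ℂ :=
  powSum (fun n => overBinom c (n + 1)) (sinHalf z ^ 2)

theorem binomSum_eq_sq_mul {c : ℕ → ℂ} (hc : SqrtDecay c) (hc0 : c 0 = 0) {t : ℝ} (h0 : 0 ≤ t)
    (h1 : t < 1) : binomSum c t = sinHalf t ^ 2 * shiftedBinomSum c t := by
  rw [binomSum, powSum_eq_add_mul hc.polyBounded_overBinom (norm_sinHalf_sq_lt_one h0 h1)]
  simp [overBinom, hc0, shiftedBinomSum]

theorem overBinom_geomConv_one (c : ℕ → ℂ) (n : ℕ) :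
    (2 * (n : ℂ) + 1) * overBinom (geomConv 1 c) (n + 1) =
      2 * (n * overBinom (geomConv 1 c) n) + 2 * overBinom c n := by
  have hb : (2 * (n : ℂ) + 1) * (invBinom (n + 1) : ℂ) = 2 * ((n : ℂ) + 1) * invBinom n := by
    exact_mod_cast invBinom_succ n
  have h1 : (n : ℂ) + 1 ≠ 0 := Nat.cast_add_one_ne_zero n
  simp only [overBinom, geomConv, one_pow, one_mul, Finset.sum_range_succ, Nat.cast_add,
    Nat.cast_one]
  set S := ∑ m ∈ range n, c m with hS
  have h2 : (n : ℂ) * (S / n * invBinom n) = S * invBinom n := by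
    rcases eq_or_ne n 0 with rfl | hn
    · simp [hS]
    · have : (n : ℂ) ≠ 0 := Nat.cast_ne_zero.2 hn
      field_simp
  rw [h2]
  field_simp
  linear_combination (S + c n) * hb

theorem hasDerivAt_shiftedBinomSum_geomConv_one {c : ℕ → ℂ} (hc : SqrtDecay c) {t : ℝ}
    (h0 : 0 ≤ t) (h1 : t < 1) :
    HasDerivAt (fun z => cosHalf z * sinHalf z * shiftedBinomSum (geomConv 1 c) z)
      (2 * angleDeriv t * binomSum c t) t := by
  have hz := one_add_ofReal_sq_ne_zero t
  have hx := norm_sinHalf_sq_lt_one h0 h1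
  have he := (hc.geomConv (one_pow 4)).polyBounded_overBinom
  have hE1 : HasDerivAt (shiftedBinomSum (geomConv 1 c)) _ (t : ℂ) :=
    (hasDerivAt_powSum he.shift hx).comp (t : ℂ) (hasDerivAt_sinHalf_sq hz)
  refine (((hasDerivAt_cosHalf hz).mul (hasDerivAt_sinHalf hz)).mul hE1).congr_deriv ?_
  have hderiv := mul_powSum_deriv he.shift hx
  have hxr := mul_powSum_deriv he hx
  have hsum : powSum (fun n : ℕ => ((n : ℂ) + 1) * overBinom (geomConv 1 c) (n + 1))
      (sinHalf t ^ 2) = powSum (fun n : ℕ => (n : ℂ) * overBinom (geomConv 1 c) (n + 1))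
      (sinHalf t ^ 2) + powSum (fun n => overBinom (geomConv 1 c) (n + 1)) (sinHalf t ^ 2) := by
    rw [← powSum_add he.shift.index_mul he.shift hx]
    simp only [add_mul, one_mul]
  have hrec : 2 * powSum (fun n : ℕ => (n : ℂ) * overBinom (geomConv 1 c) (n + 1))
      (sinHalf t ^ 2) + powSum (fun n => overBinom (geomConv 1 c) (n + 1)) (sinHalf t ^ 2) =
      2 * powSum (fun n : ℕ => (n : ℂ) * overBinom (geomConv 1 c) n) (sinHalf t ^ 2) +
      2 * binomSum c t := by
    rw [binomSum, ← powSum_const_mul, ← powSum_const_mul, ← powSum_const_mul,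
      ← powSum_add (he.shift.index_mul.const_mul 2) he.shift hx,
      ← powSum_add (he.index_mul.const_mul 2) (hc.polyBounded_overBinom.const_mul 2) hx]
    congr 1
    funext n
    linear_combination overBinom_geomConv_one c n
  have hcs := cosHalf_sq hz
  have hmul : (cosHalf * sinHalf) t = cosHalf t * sinHalf t := rfl
  rw [hmul, shiftedBinomSum]
  set x := sinHalf t
  set y := cosHalf t
  set E1 := powSum (fun n => overBinom (geomConv 1 c) (n + 1)) (x ^ 2)
  set D := powSum (fun n : ℕ => ((n : ℂ) + 1) * overBinom (geomConv 1 c) (n + 1 + 1)) (x ^ 2)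
  set A := powSum (fun n : ℕ => (n : ℂ) * overBinom (geomConv 1 c) (n + 1)) (x ^ 2)
  set B := powSum (fun n : ℕ => (n : ℂ) * overBinom (geomConv 1 c) n) (x ^ 2)
  rw [hsum] at hxr
  linear_combination (angleDeriv t) * (hrec + (2 - 2 * x ^ 2) * hderiv - 2 * hxr
    + (E1 + 2 * x ^ 2 * D) * hcs)

/-! ### Generating functions that are multiple polylogarithms -/

theorem eq_of_hasDerivAt_ofReal_eq {f g d : ℝ → ℂ}
    (hf : ∀ t : ℝ, 0 < t → t < 1 → HasDerivAt f (d t) t)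
    (hg : ∀ t : ℝ, 0 < t → t < 1 → HasDerivAt g (d t) t)
    (hf0 : ContinuousAt f 0) (hg0 : ContinuousAt g 0) (h0 : f 0 = g 0) {t : ℝ}
    (ht0 : 0 ≤ t) (ht1 : t < 1) : f t = g t := by
  rcases ht0.eq_or_lt with rfl | ht
  · exact h0
  set h : ℝ → ℂ := fun x => f x - g x with hh
  have hd : ∀ x : ℝ, 0 < x → x < 1 → HasDerivAt h 0 x := fun x hx0 hx1 =>
    HasDerivAt.congr_deriv (f := h) ((hf x hx0 hx1).sub (hg x hx0 hx1)) (sub_self _)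
  have hconst : ∀ x ∈ Set.Ioo 0 t, h x = h t := fun x hx =>
    (constant_of_has_deriv_right_zero
      (fun y hy => (hd y (hx.1.trans_le hy.1) (hy.2.trans_lt ht1)).continuousAt.continuousWithinAt)
      (fun y hy => (hd y (hx.1.trans_le hy.1) (hy.2.trans ht1)).hasDerivWithinAt)
      t (Set.right_mem_Icc.2 hx.2.le)).symm
  have hlim : Tendsto h (𝓝[>] 0) (𝓝 (h t)) :=
    tendsto_const_nhds.congr' (by
      filter_upwards [Ioo_mem_nhdsGT ht] with x hx using (hconst x hx).symm)
  have h00 : h t = h 0 :=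
    tendsto_nhds_unique hlim ((hf0.sub hg0).tendsto.mono_left nhdsWithin_le_nhds)
  have : h 0 = 0 := by simp [hh, h0]
  exact sub_eq_zero.1 (h00.trans this)

theorem continuousAt_comp_ofReal_zero {f : ℂ → ℂ} (hf : ContinuousAt f 0) :
    ContinuousAt (fun x : ℝ => f x) 0 :=
  ContinuousAt.comp (g := f) (by simpa using hf) Complex.continuous_ofReal.continuousAt

theorem eq_of_hasDerivAt_eq {f g d : ℂ → ℂ}
    (hf : ∀ t : ℝ, 0 < t → t < 1 → HasDerivAt f (d t) t)
    (hg : ∀ t : ℝ, 0 < t → t < 1 → HasDerivAt g (d t) t)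
    (hf0 : ContinuousAt f 0) (hg0 : ContinuousAt g 0) (h0 : f 0 = g 0) {t : ℝ}
    (ht0 : 0 ≤ t) (ht1 : t < 1) : f t = g t :=
  eq_of_hasDerivAt_ofReal_eq (f := fun x => f x) (g := fun x => g x) (d := fun x => d x)
    (fun t h0 h1 => (hf t h0 h1).comp_ofReal) (fun t h0 h1 => (hg t h0 h1).comp_ofReal)
    (continuousAt_comp_ofReal_zero hf0) (continuousAt_comp_ofReal_zero hg0) (by simpa using h0)
    ht0 ht1

theorem hasDerivAt_powSum_add {a b : ℕ → ℂ} (ha : SqrtDecay a) (hb : SqrtDecay b) {z da db : ℂ}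
    (hz : ‖z‖ < 1) (hda : HasDerivAt (powSum a) da z) (hdb : HasDerivAt (powSum b) db z) :
    HasDerivAt (powSum (a + b)) (da + db) z := by
  refine (hda.add hdb).congr_of_eventuallyEq ?_
  filter_upwards [Metric.isOpen_ball.mem_nhds (mem_ball_zero_iff.2 hz)] with y hy
  exact powSum_add ha.polyBounded hb.polyBounded (mem_ball_zero_iff.1 hy)

theorem hasDerivAt_powSum_smul {a : ℕ → ℂ} (q : ℚ) {z da : ℂ}
    (hda : HasDerivAt (powSum a) da z) :
    HasDerivAt (powSum (q • a)) (q * da) z := by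
  have h : powSum (q • a) = fun z => (q : ℂ) * powSum a z := by
    funext z
    rw [← powSum_const_mul]
    congr 1
  rw [h]
  exact hda.const_mul _

theorem continuousAt_powSum {a : ℕ → ℂ} (ha : PolyBounded a) {z : ℂ} (hz : ‖z‖ < 1) :
    ContinuousAt (powSum a) z :=
  (hasDerivAt_powSum ha hz).continuousAt

/-- The generating function of `c` is a combination of multiple polylogarithms of weight `w`. -/
def IsPolylog (w : ℕ) (c : ℕ → ℂ) : Prop :=
  SqrtDecay c ∧ ∃ p ∈ coeffSpan w, ∀ t : ℝ, 0 ≤ t → t < 1 → binomSum c t = powSum p t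

/-- The generating function of `c` is `i tan θ` times a combination of multiple polylogarithms of
weight `w`. -/
def IsTanPolylog (w : ℕ) (c : ℕ → ℂ) : Prop :=
  SqrtDecay c ∧ ∃ p ∈ coeffSpan w, ∀ t : ℝ, 0 ≤ t → t < 1 →
    cosHalf t * binomSum c t = Complex.I * sinHalf t * powSum p t

theorem isTanPolylog_geomConv_one {w : ℕ} {c q : ℕ → ℂ} (hc : SqrtDecay c)
    (hq : q ∈ coeffSpan (w + 1))
    (h : ∀ t : ℝ, 0 < t → t < 1 →
      ∃ d, HasDerivAt (powSum q) d t ∧ Complex.I * d = 2 * angleDeriv t * binomSum c t) :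
    IsTanPolylog (w + 1) (geomConv 1 c) := by
  refine ⟨hc.geomConv (one_pow 4), q, hq, fun t ht0 ht1 => ?_⟩
  have key := eq_of_hasDerivAt_eq
    (f := fun z => cosHalf z * sinHalf z * shiftedBinomSum (geomConv 1 c) z)
    (g := fun z => Complex.I * powSum q z) (d := fun z => 2 * angleDeriv z * binomSum c z)
    (fun t h0 h1 => hasDerivAt_shiftedBinomSum_geomConv_one hc h0.le h1)
    (fun t h0 h1 => by
      obtain ⟨d, hd, hd'⟩ := h t h0 h1
      exact (hd.const_mul Complex.I).congr_deriv hd')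
    (by simpa using (hasDerivAt_shiftedBinomSum_geomConv_one hc le_rfl one_pos).continuousAt)
    (continuousAt_const.mul
      (continuousAt_powSum (sqrtDecay_of_mem_coeffSpan hq).polyBounded (by simp)))
    (by simp [sinHalf_zero, powSum_zero, apply_zero_of_mem_coeffSpan w.succ_pos hq]) ht0 ht1
  rw [binomSum_eq_sq_mul (hc.geomConv (one_pow 4)) (geomConv_zero 1 c) ht0 ht1]
  linear_combination sinHalf t * key

theorem isPolylog_divIndex {w : ℕ} {c q : ℕ → ℂ} (hc : SqrtDecay c) (hc0 : c 0 = 0)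
    (hq : q ∈ coeffSpan (w + 1))
    (h : ∀ t : ℝ, 0 < t → t < 1 → HasDerivAt (powSum q)
      (2 * (cosHalf t * angleDeriv t) / sinHalf t * binomSum c t) t) :
    IsPolylog (w + 1) (divIndex c) := by
  refine ⟨hc.divIndex, q, hq, fun t ht0 ht1 => ?_⟩
  exact eq_of_hasDerivAt_eq
    (d := fun z => 2 * (cosHalf z * angleDeriv z) / sinHalf z * binomSum c z)
    (fun t h0 h1 => hasDerivAt_binomSum_divIndex hc hc0 h0 h1) h
    (by simpa using (hasDerivAt_binomSum hc.divIndex le_rfl one_pos).continuousAt)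
    (continuousAt_powSum (sqrtDecay_of_mem_coeffSpan hq).polyBounded (by simp))
    (by simp [binomSum, sinHalf_zero, powSum_zero, overBinom,
      apply_zero_of_mem_coeffSpan w.succ_pos hq]) ht0 ht1

theorem kernel_I (t : ℝ) :
    Complex.I / (1 - Complex.I * t) = (Complex.I - t) / (1 + (t : ℂ) ^ 2) := by
  have h := one_add_ofReal_sq_ne_zero t
  have hfac : (1 - Complex.I * t) * (1 + Complex.I * t) = 1 + (t : ℂ) ^ 2 := by
    linear_combination (-(t : ℂ) ^ 2) * Complex.I_sq
  have h' : 1 - Complex.I * (t : ℂ) ≠ 0 := left_ne_zero_of_mul (hfac ▸ h)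
  rw [div_eq_div_iff h' h]
  linear_combination t * Complex.I_sq

theorem kernel_neg_I (t : ℝ) :
    -Complex.I / (1 - -Complex.I * t) = (-Complex.I - t) / (1 + (t : ℂ) ^ 2) := by
  have h := kernel_I (-t)
  push_cast at h
  rw [mul_neg, ← neg_mul, neg_sq] at h
  rw [neg_div, h]
  ring

theorem neg_I_pow_four : (-Complex.I) ^ 4 = 1 := by
  rw [neg_pow, Complex.I_pow_four]
  norm_num

theorem neg_one_pow_four : (-1 : ℂ) ^ 4 = 1 := by norm_num

theorem one_sub_ofReal_sq_ne_zero {t : ℝ} (h0 : 0 < t) (h1 : t < 1) :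
    (1 : ℂ) - (t : ℂ) ^ 2 ≠ 0 := by
  have : (1 : ℝ) - t ^ 2 ≠ 0 := by nlinarith
  exact_mod_cast this

theorem IsPolylog.geomConv_one {w : ℕ} {c : ℕ → ℂ} (h : IsPolylog w c) :
    IsTanPolylog (w + 1) (geomConv 1 c) := by
  obtain ⟨hc, p, hp, hcp⟩ := h
  have hpd := sqrtDecay_of_mem_coeffSpan hp
  refine isTanPolylog_geomConv_one hc
    (Submodule.add_mem _
      (Submodule.smul_mem _ (-2 : ℚ) (geomConv_mem_coeffSpan Complex.I_pow_four hp))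
      (Submodule.smul_mem _ (2 : ℚ) (geomConv_mem_coeffSpan neg_I_pow_four hp)))
    fun t h0 h1 => ⟨_, hasDerivAt_powSum_add
      ((hpd.geomConv Complex.I_pow_four).smul _) ((hpd.geomConv neg_I_pow_four).smul _)
      (norm_ofReal_lt_one h0.le h1)
      (hasDerivAt_powSum_smul _
        (hasDerivAt_powSum_geomConv Complex.I_pow_four hpd (norm_ofReal_lt_one h0.le h1)))
      (hasDerivAt_powSum_smul _
        (hasDerivAt_powSum_geomConv neg_I_pow_four hpd (norm_ofReal_lt_one h0.le h1))), ?_⟩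
  rw [hcp t h0.le h1, kernel_I, kernel_neg_I, angleDeriv]
  push_cast
  have := one_add_ofReal_sq_ne_zero t
  field_simp
  linear_combination (-2) * powSum p t * Complex.I_sq

theorem IsTanPolylog.geomConv_one {w : ℕ} {c : ℕ → ℂ} (h : IsTanPolylog w c) :
    IsTanPolylog (w + 1) (geomConv 1 c) := by
  obtain ⟨hc, p, hp, hcp⟩ := h
  have hpd := sqrtDecay_of_mem_coeffSpan hp
  have hd : ∀ {a : ℂ}, a ^ 4 = 1 → ∀ (q : ℚ), SqrtDecay (q • geomConv a p) :=
    fun ha q => (hpd.geomConv ha).smul q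
  have hm : ∀ {a : ℂ}, a ^ 4 = 1 → ∀ (q : ℚ), q • geomConv a p ∈ coeffSpan (w + 1) :=
    fun ha q => Submodule.smul_mem _ q (geomConv_mem_coeffSpan ha hp)
  have hD : ∀ {a : ℂ}, a ^ 4 = 1 → ∀ (q : ℚ) {t : ℝ}, 0 < t → t < 1 →
      HasDerivAt (powSum (q • geomConv a p)) (q * (a / (1 - a * t) * powSum p t)) t :=
    fun ha q t h0 h1 =>
      hasDerivAt_powSum_smul _ (hasDerivAt_powSum_geomConv ha hpd (norm_ofReal_lt_one h0.le h1))
  refine isTanPolylog_geomConv_one hc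
    (Submodule.add_mem _ (Submodule.add_mem _ (hm (one_pow 4) 2) (hm neg_one_pow_four 2))
      (Submodule.add_mem _ (hm Complex.I_pow_four (-2)) (hm neg_I_pow_four (-2))))
    fun t h0 h1 => ⟨_, hasDerivAt_powSum_add
      ((hd (one_pow 4) 2).add (hd neg_one_pow_four 2))
      ((hd Complex.I_pow_four (-2)).add (hd neg_I_pow_four (-2)))
      (norm_ofReal_lt_one h0.le h1)
      (hasDerivAt_powSum_add (hd (one_pow 4) 2) (hd neg_one_pow_four 2)
        (norm_ofReal_lt_one h0.le h1) (hD (one_pow 4) 2 h0 h1) (hD neg_one_pow_four 2 h0 h1))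
      (hasDerivAt_powSum_add (hd Complex.I_pow_four (-2)) (hd neg_I_pow_four (-2))
        (norm_ofReal_lt_one h0.le h1) (hD Complex.I_pow_four (-2) h0 h1)
        (hD neg_I_pow_four (-2) h0 h1)), ?_⟩
  have hz := one_add_ofReal_sq_ne_zero t
  have hz' := one_sub_ofReal_sq_ne_zero h0 h1
  have hfac : (1 - (t : ℂ)) * (1 + t) = 1 - (t : ℂ) ^ 2 := by ring
  have h1m : 1 - (t : ℂ) ≠ 0 := left_ne_zero_of_mul (hfac ▸ hz')
  have h1p : 1 + (t : ℂ) ≠ 0 := right_ne_zero_of_mul (hfac ▸ hz')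
  have hcos : cosHalf t ≠ 0 := div_ne_zero hz' hz
  have hb : binomSum c t = Complex.I * (2 * t / (1 - (t : ℂ) ^ 2)) * powSum p t := by
    have := hcp t h0.le h1
    rw [← mul_right_inj' hcos, this, sinHalf, cosHalf]
    field_simp
  rw [hb, kernel_I, kernel_neg_I, angleDeriv, one_mul, neg_one_mul, sub_neg_eq_add, ← hfac]
  push_cast
  field_simp
  ring

theorem IsPolylog.divIndex {w : ℕ} (hw : 0 < w) {c : ℕ → ℂ} (h : IsPolylog w c) (hc0 : c 0 = 0) :
    IsPolylog (w + 1) (divIndex c) := by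
  obtain ⟨hc, p, hp, hcp⟩ := h
  have hpd := sqrtDecay_of_mem_coeffSpan hp
  have hd : ∀ {a : ℂ}, a ^ 4 = 1 → SqrtDecay ((2 : ℚ) • geomConv a p) :=
    fun ha => (hpd.geomConv ha).smul 2
  have hm : ∀ {a : ℂ}, a ^ 4 = 1 → (2 : ℚ) • geomConv a p ∈ coeffSpan (w + 1) :=
    fun ha => Submodule.smul_mem _ 2 (geomConv_mem_coeffSpan ha hp)
  have hD : ∀ {a : ℂ}, a ^ 4 = 1 → ∀ {t : ℝ}, 0 < t → t < 1 →
      HasDerivAt (powSum ((2 : ℚ) • geomConv a p))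
        ((2 : ℚ) * (a / (1 - a * t) * powSum p t)) t :=
    fun ha t h0 h1 =>
      hasDerivAt_powSum_smul _ (hasDerivAt_powSum_geomConv ha hpd (norm_ofReal_lt_one h0.le h1))
  refine isPolylog_divIndex hc hc0
    (Submodule.add_mem _ (Submodule.smul_mem _ (2 : ℚ) (divIndex_mem_coeffSpan hw hp))
      (Submodule.add_mem _ (hm Complex.I_pow_four) (hm neg_I_pow_four)))
    fun t h0 h1 => ?_
  have ht : (t : ℂ) ≠ 0 := by exact_mod_cast h0.ne'
  have hn := norm_ofReal_lt_one h0.le h1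
  refine (hasDerivAt_powSum_add (hpd.divIndex.smul 2)
    ((hd Complex.I_pow_four).add (hd neg_I_pow_four)) hn
    (hasDerivAt_powSum_smul 2
      (hasDerivAt_powSum_divIndex hpd (apply_zero_of_mem_coeffSpan hw hp) hn ht))
    (hasDerivAt_powSum_add (hd Complex.I_pow_four) (hd neg_I_pow_four) hn
      (hD Complex.I_pow_four h0 h1) (hD neg_I_pow_four h0 h1))).congr_deriv ?_
  have hz := one_add_ofReal_sq_ne_zero t
  rw [hcp t h0.le h1, kernel_I, kernel_neg_I, angleDeriv, sinHalf, cosHalf]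
  push_cast
  field_simp
  ring

theorem IsTanPolylog.divIndex {w : ℕ} {c : ℕ → ℂ} (h : IsTanPolylog w c) (hc0 : c 0 = 0) :
    IsPolylog (w + 1) (divIndex c) := by
  obtain ⟨hc, p, hp, hcp⟩ := h
  have hpd := sqrtDecay_of_mem_coeffSpan hp
  refine isPolylog_divIndex hc hc0
    (Submodule.add_mem _
      (Submodule.smul_mem _ (2 : ℚ) (geomConv_mem_coeffSpan Complex.I_pow_four hp))
      (Submodule.smul_mem _ (-2 : ℚ) (geomConv_mem_coeffSpan neg_I_pow_four hp)))
    fun t h0 h1 => ?_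
  have hn := norm_ofReal_lt_one h0.le h1
  refine (hasDerivAt_powSum_add
    ((hpd.geomConv Complex.I_pow_four).smul _) ((hpd.geomConv neg_I_pow_four).smul _) hn
    (hasDerivAt_powSum_smul _ (hasDerivAt_powSum_geomConv Complex.I_pow_four hpd hn))
    (hasDerivAt_powSum_smul _ (hasDerivAt_powSum_geomConv neg_I_pow_four hpd hn))).congr_deriv ?_
  have hz := one_add_ofReal_sq_ne_zero t
  have hsin : sinHalf t ≠ 0 := by
    have : (t : ℂ) ≠ 0 := by exact_mod_cast h0.ne'
    simp [sinHalf, hz, this]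
  have hrhs : 2 * (cosHalf t * angleDeriv t) / sinHalf t * binomSum c t =
      2 * angleDeriv t * (Complex.I * powSum p t) := by
    have := hcp t h0.le h1
    field_simp
    linear_combination angleDeriv t * this
  rw [hrhs, kernel_I, kernel_neg_I, angleDeriv]
  push_cast
  field_simp
  ring

theorem isPolylog_multiCoeff_zero (s : Fin 0 → ℕ) (a : Fin 0 → ℂ) :
    IsPolylog 0 (multiCoeff 0 s a) := by
  refine ⟨sqrtDecay_multiCoeff_zero s a, multiCoeff 0 s a,
    Submodule.subset_span ⟨0, s, a, fun i => i.elim0, by simp, fun i => i.elim0, rfl⟩,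
    fun t _ _ => ?_⟩
  have h : ∀ z, powSum (multiCoeff 0 s a) z = 1 := by
    intro z
    rw [powSum, tsum_eq_single 0]
    · simp [multiCoeff]
    · intro n hn
      simp [multiCoeff, hn]
  rw [binomSum, h, ← h (sinHalf t ^ 2)]
  congr 1
  funext n
  rcases eq_or_ne n 0 with rfl | hn
  · simp [overBinom, invBinom]
  · simp [overBinom, multiCoeff, hn]

theorem multiCoeff_one_eq_geomConv {k : ℕ} {s : Fin (k + 1) → ℕ} (hs : s 0 = 1) :
    multiCoeff (k + 1) s (fun _ => 1) =
      geomConv 1 (multiCoeff k (Fin.tail s) fun _ => 1) := by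
  funext n
  have : Fin.tail (fun _ : Fin (k + 1) => (1 : ℂ)) = fun _ => 1 := rfl
  simp [multiCoeff, geomConv, hs, this, div_eq_inv_mul]

theorem isPolylog_or_isTanPolylog_multiCoeff (k : ℕ) (s : Fin k → ℕ) (hs : ∀ i, 0 < s i) :
    IsPolylog (∑ i, s i) (multiCoeff k s fun _ => 1) ∨
      IsTanPolylog (∑ i, s i) (multiCoeff k s fun _ => 1) := by
  induction k with
  | zero => exact .inl (by simpa using isPolylog_multiCoeff_zero s _)
  | succ k ih =>
    obtain ⟨r, hr⟩ : ∃ r, s 0 = r + 1 := ⟨s 0 - 1, by have := hs 0; omega⟩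
    induction r generalizing s with
    | zero =>
      right
      rw [multiCoeff_one_eq_geomConv hr, Fin.sum_univ_succ, hr, zero_add, add_comm 1]
      exact (ih (Fin.tail s) fun i => hs i.succ).elim IsPolylog.geomConv_one
        IsTanPolylog.geomConv_one
    | succ r ihr =>
      left
      have h := ihr (Fin.cons (r + 1) (Fin.tail s))
        (Fin.cases (by simp) fun i => by simpa [Fin.tail] using hs i.succ) (by simp)
      have hmul := divIndex_multiCoeff k (Fin.cons (r + 1) (Fin.tail s)) fun _ => 1
      have hsum : ∑ i, s i =
          (∑ i, (Fin.cons (r + 1) (Fin.tail s) : Fin (k + 1) → ℕ) i) + 1 := by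
        rw [Fin.sum_univ_succ, Fin.sum_univ_succ, hr]
        simp only [Fin.cons_zero, Fin.cons_succ, Fin.tail]
        omega
      rw [Fin.cons_zero, Fin.tail_cons, ← hr, Fin.cons_self_tail] at hmul
      rw [← hmul, hsum]
      refine h.elim (fun h => h.divIndex ?_ (multiCoeff_zero_apply_zero _ _ _))
        fun h => h.divIndex (multiCoeff_zero_apply_zero _ _ _)
      rw [Fin.sum_univ_succ]
      simp

/-- An outermost exponent at least two removes the factor `tan θ`. -/
theorem isPolylog_multiCoeff (k : ℕ) (s : Fin (k + 1) → ℕ) (hs : ∀ i, 0 < s i)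
    (hs0 : 2 ≤ s 0) : IsPolylog (∑ i, s i) (multiCoeff (k + 1) s fun _ => 1) := by
  obtain ⟨r, hr⟩ : ∃ r, s 0 = r + 1 + 1 := ⟨s 0 - 2, by omega⟩
  have h := isPolylog_or_isTanPolylog_multiCoeff (k + 1) (Fin.cons (r + 1) (Fin.tail s))
    (Fin.cases (by simp) fun i => by simpa [Fin.tail] using hs i.succ)
  have hmul := divIndex_multiCoeff k (Fin.cons (r + 1) (Fin.tail s)) fun _ => 1
  have hsum : ∑ i, s i =
      (∑ i, (Fin.cons (r + 1) (Fin.tail s) : Fin (k + 1) → ℕ) i) + 1 := by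
    rw [Fin.sum_univ_succ, Fin.sum_univ_succ, hr]
    simp only [Fin.cons_zero, Fin.cons_succ, Fin.tail]
    omega
  rw [Fin.cons_zero, Fin.tail_cons, ← hr, Fin.cons_self_tail] at hmul
  rw [← hmul, hsum]
  refine h.elim (fun h => h.divIndex ?_ (multiCoeff_zero_apply_zero _ _ _))
    fun h => h.divIndex (multiCoeff_zero_apply_zero _ _ _)
  rw [Fin.sum_univ_succ]
  simp

/-! ### Integrating odd powers of the sine -/

/-- `∫ 2 sin²ⁿ⁺¹ θ dθ` from `0`, as a function of `t = tan (θ / 2)`. -/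
noncomputable def sinPowInt : ℕ → ℝ → ℝ
  | 0, t => 4 * t ^ 2 / (1 + t ^ 2)
  | n + 1, t => (2 * (n + 1) * sinPowInt n t -
      2 * ((1 - t ^ 2) / (1 + t ^ 2) * (2 * t / (1 + t ^ 2)) ^ (2 * n + 2))) / (2 * n + 3)

theorem sinPowInt_zero (n : ℕ) : sinPowInt n 0 = 0 := by
  induction n with
  | zero => simp [sinPowInt]
  | succ n ih => simp [sinPowInt, ih]

theorem sinPowInt_one (n : ℕ) : sinPowInt n 1 = invBinom (n + 1) / (n + 1) := by
  induction n with
  | zero => norm_num [sinPowInt, invBinom, Nat.centralBinom, Nat.choose]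
  | succ n ih =>
    have h := invBinom_succ (n + 1)
    rw [sinPowInt, ih]
    push_cast at h ⊢
    have h1 : (n : ℝ) + 1 ≠ 0 := by positivity
    have h2 : (n : ℝ) + 1 + 1 ≠ 0 := by positivity
    have h3 : 2 * (n : ℝ) + 3 ≠ 0 := by positivity
    field_simp
    linear_combination (-2 : ℝ) * h

theorem hasDerivAt_sinPowInt (n : ℕ) (t : ℝ) :
    HasDerivAt (sinPowInt n) (2 * (2 / (1 + t ^ 2)) * (2 * t / (1 + t ^ 2)) ^ (2 * n + 1)) t := by
  have hz : 1 + t ^ 2 ≠ 0 := by positivity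
  have hden := (hasDerivAt_pow 2 t).const_add 1
  induction n with
  | zero =>
    refine HasDerivAt.congr_deriv (f := sinPowInt 0)
      (((hasDerivAt_pow 2 t).const_mul 4).div hden hz) ?_
    norm_num
    field_simp
    ring
  | succ n ih =>
    have hsin := ((hasDerivAt_id t).const_mul 2).div hden hz
    have hcos := ((hasDerivAt_pow 2 t).const_sub 1).div hden hz
    refine HasDerivAt.congr_deriv (f := sinPowInt (n + 1))
      (((ih.const_mul (2 * ((n : ℝ) + 1))).sub
        ((hcos.mul (hsin.pow (2 * n + 2))).const_mul 2)).div_const (2 * n + 3)) ?_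
    have h3 : 2 * (n : ℝ) + 3 ≠ 0 := by positivity
    simp only [Pi.pow_apply, Pi.div_apply, id]
    have e1 : 2 * n + 2 - 1 = 2 * n + 1 := by omega
    have e2 : 2 * (n + 1) + 1 = 2 * n + 1 + 2 := by ring
    have e3 : 2 * n + 2 = 2 * n + 1 + 1 := by ring
    rw [e1, e2, e3]
    push_cast
    simp only [pow_add, pow_one]
    set p := (2 * t / (1 + t ^ 2)) ^ (2 * n)
    field_simp
    ring

theorem monotoneOn_sinPowInt (n : ℕ) : MonotoneOn (sinPowInt n) (Set.Icc 0 1) := by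
  refine monotoneOn_of_hasDerivWithinAt_nonneg (convex_Icc 0 1)
    (fun t _ => (hasDerivAt_sinPowInt n t).continuousAt.continuousWithinAt)
    (fun t _ => (hasDerivAt_sinPowInt n t).hasDerivWithinAt) fun t ht => ?_
  rw [interior_Icc] at ht
  have := ht.1.le
  positivity

theorem sinPowInt_nonneg (n : ℕ) {t : ℝ} (h0 : 0 ≤ t) (h1 : t ≤ 1) : 0 ≤ sinPowInt n t := by
  rw [← sinPowInt_zero n]
  exact monotoneOn_sinPowInt n ⟨le_rfl, zero_le_one⟩ ⟨h0, h1⟩ h0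

theorem sinPowInt_le (n : ℕ) {t : ℝ} (h0 : 0 ≤ t) (h1 : t ≤ 1) :
    sinPowInt n t ≤ sinPowInt n 1 :=
  monotoneOn_sinPowInt n ⟨h0, h1⟩ ⟨zero_le_one, le_rfl⟩ h1

theorem summable_and_hasDerivAt_tsum_sinPowInt {c : ℕ → ℂ} (hc : SqrtDecay c) {t : ℝ}
    (h0 : 0 ≤ t) (h1 : t < 1) :
    (Summable fun n => overBinom c (n + 1) * (sinPowInt n t : ℂ)) ∧
      HasDerivAt (fun x : ℝ => ∑' n, overBinom c (n + 1) * (sinPowInt n x : ℂ))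
        (2 * angleDeriv t * sinHalf t * shiftedBinomSum c t) t := by
  obtain ⟨r, htr, hr1⟩ := exists_between h1
  have hr0 : 0 < r := h0.trans_lt htr
  set S := Set.Ioo (-r) r
  have hu : Summable fun n => 4 * ‖overBinom c (n + 1) * (sinHalf r ^ 2) ^ n‖ :=
    ((hc.polyBounded_overBinom.shift.summable
      (norm_sinHalf_sq_lt_one hr0.le hr1)).norm).mul_left 4
  have hg : ∀ (n : ℕ) (x : ℝ), x ∈ S →
      HasDerivAt (fun x : ℝ => overBinom c (n + 1) * (sinPowInt n x : ℂ))
        (overBinom c (n + 1) *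
          ((2 * (2 / (1 + x ^ 2)) * (2 * x / (1 + x ^ 2)) ^ (2 * n + 1) : ℝ) : ℂ)) x :=
    fun n x _ => ((hasDerivAt_sinPowInt n x).ofReal_comp).const_mul _
  have hbound : ∀ (n : ℕ) (x : ℝ), x ∈ S →
      ‖overBinom c (n + 1) *
          ((2 * (2 / (1 + x ^ 2)) * (2 * x / (1 + x ^ 2)) ^ (2 * n + 1) : ℝ) : ℂ)‖ ≤
        4 * ‖overBinom c (n + 1) * (sinHalf r ^ 2) ^ n‖ := fun n x hx => by
    have hxr : |x| ≤ r := (abs_lt.2 hx).le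
    have hsr : sinHalf r = ((2 * r / (1 + r ^ 2) : ℝ) : ℂ) := by simp [sinHalf]
    have hle : |2 * x / (1 + x ^ 2)| ≤ 2 * r / (1 + r ^ 2) := by
      rw [abs_div, abs_of_pos (by positivity : (0 : ℝ) < 1 + x ^ 2), abs_mul, abs_two, ← sq_abs x,
        div_le_div_iff₀ (by positivity) (by positivity)]
      nlinarith [mul_nonneg (sub_nonneg.2 hxr)
        (by nlinarith [abs_nonneg x] : 0 ≤ 1 - |x| * r)]
    have hle1 : |2 * x / (1 + x ^ 2)| ≤ 1 := by
      rw [abs_div, abs_of_pos (by positivity : (0 : ℝ) < 1 + x ^ 2), abs_mul, abs_two, ← sq_abs x,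
        div_le_one (by positivity)]
      nlinarith [sq_nonneg (1 - |x|)]
    have hang : |2 / (1 + x ^ 2)| ≤ 2 := by
      rw [abs_of_pos (by positivity)]
      exact div_le_self zero_le_two (by nlinarith [sq_nonneg x])
    rw [norm_mul, norm_mul, Complex.norm_real, norm_pow, norm_pow, hsr, Complex.norm_real,
      Real.norm_eq_abs, Real.norm_of_nonneg (by positivity : 0 ≤ 2 * r / (1 + r ^ 2)), abs_mul,
      abs_mul, abs_pow, abs_two, pow_succ |2 * x / (1 + x ^ 2)|, pow_mul]
    have hpow : (|2 * x / (1 + x ^ 2)| ^ 2) ^ n ≤ ((2 * r / (1 + r ^ 2)) ^ 2) ^ n := by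
      gcongr
    calc _ ≤ ‖overBinom c (n + 1)‖ * (2 * 2 * (((2 * r / (1 + r ^ 2)) ^ 2) ^ n * 1)) := by
          gcongr
      _ = _ := by ring
  have hy0 : (0 : ℝ) ∈ S := ⟨neg_lt_zero.2 hr0, hr0⟩
  have hg0 : Summable fun n => overBinom c (n + 1) * (sinPowInt n 0 : ℂ) := by
    simp [sinPowInt_zero]
  have hy : t ∈ S := ⟨by linarith, htr⟩
  refine ⟨summable_of_summable_hasDerivAt_of_isPreconnected hu isOpen_Ioo isPreconnected_Ioo
    hg hbound hy0 hg0 hy, (hasDerivAt_tsum_of_isPreconnected hu isOpen_Ioo isPreconnected_Ioo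
    hg hbound hy0 hg0 hy).congr_deriv ?_⟩
  rw [shiftedBinomSum, powSum, ← tsum_mul_left]
  refine tsum_congr fun n => ?_
  simp only [sinHalf, angleDeriv]
  push_cast
  generalize 2 * (t : ℂ) / (1 + (t : ℂ) ^ 2) = x
  ring

theorem tsum_sinPowInt_eq {w : ℕ} (hw : 0 < w) {c p : ℕ → ℂ} (hc : SqrtDecay c)
    (hc0 : c 0 = 0) (hp : p ∈ coeffSpan w)
    (hcp : ∀ t : ℝ, 0 ≤ t → t < 1 → binomSum c t = powSum p t) {t : ℝ} (h0 : 0 ≤ t)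
    (h1 : t < 1) : ∑' n, overBinom c (n + 1) * (sinPowInt n t : ℂ) =
      2 * powSum (divIndex p) t := by
  have hpd := sqrtDecay_of_mem_coeffSpan hp
  refine eq_of_hasDerivAt_ofReal_eq
    (f := fun x => ∑' n, overBinom c (n + 1) * (sinPowInt n x : ℂ))
    (g := fun x => 2 * powSum (divIndex p) x)
    (d := fun x => 2 * angleDeriv x * sinHalf x * shiftedBinomSum c x)
    (fun x hx0 hx1 => (summable_and_hasDerivAt_tsum_sinPowInt hc hx0.le hx1).2)
    (fun x hx0 hx1 => ?_)
    (summable_and_hasDerivAt_tsum_sinPowInt hc le_rfl one_pos).2.continuousAt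
    (continuousAt_const.mul
      (continuousAt_comp_ofReal_zero (continuousAt_powSum hpd.divIndex.polyBounded (by simp))))
    (by simp [sinPowInt_zero, powSum_zero]) h0 h1
  have hx : (x : ℂ) ≠ 0 := by exact_mod_cast hx0.ne'
  refine (((hasDerivAt_powSum_divIndex hpd (apply_zero_of_mem_coeffSpan hw hp)
    (norm_ofReal_lt_one hx0.le hx1) hx).comp_ofReal).const_mul 2).congr_deriv ?_
  have hz := one_add_ofReal_sq_ne_zero x
  rw [← hcp x hx0.le hx1, binomSum_eq_sq_mul hc hc0 hx0.le hx1, sinHalf, angleDeriv]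
  field_simp

theorem IsPolylog.summable_and_tsum_mem_CMZV {w : ℕ} (hw : 0 < w) {c : ℕ → ℂ}
    (h : IsPolylog w c) (hc0 : c 0 = 0) {r : ℕ → ℝ} (hr : ∀ n, 0 ≤ r n)
    (hcr : ∀ n, c (n + 1) = r n) :
    (Summable fun n => r n * invBinom (n + 1) ^ 2 / (n + 1)) ∧
      ((∑' n, r n * invBinom (n + 1) ^ 2 / (n + 1) : ℝ) : ℂ) ∈ CMZV 4 (w + 1) := by
  obtain ⟨hc, p, hp, hcp⟩ := h
  have hpd := sqrtDecay_of_mem_coeffSpan hp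
  have hsum := hpd.summable_divIndex
  set q := CentralBinomialSeries.divIndex p
  set F : ℕ → ℝ → ℝ := fun n t => r n * invBinom (n + 1) * sinPowInt n t with hF
  have hF1 : ∀ n, F n 1 = r n * invBinom (n + 1) ^ 2 / (n + 1) := fun n => by
    simp only [hF, sinPowInt_one]
    ring
  simp only [← hF1]
  have hFc : ∀ n t, overBinom c (n + 1) * (sinPowInt n t : ℂ) = (F n t : ℂ) := fun n t => by
    simp [overBinom, hcr, hF]
  have hg : ∀ n, 0 ≤ r n * invBinom (n + 1) := fun n => mul_nonneg (hr n) (invBinom_nonneg _)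
  have hF0 : ∀ n {t : ℝ}, 0 ≤ t → t ≤ 1 → 0 ≤ F n t := fun n t h0 h1 =>
    mul_nonneg (hg n) (sinPowInt_nonneg n h0 h1)
  have hFle : ∀ n {t : ℝ}, 0 ≤ t → t ≤ 1 → F n t ≤ F n 1 := fun n t h0 h1 =>
    mul_le_mul_of_nonneg_left (sinPowInt_le n h0 h1) (hg n)
  have hFs : ∀ {t : ℝ}, 0 ≤ t → t < 1 → Summable fun n => F n t := fun {t} h0 h1 => by
    have := (summable_and_hasDerivAt_tsum_sinPowInt hc h0 h1).1
    simp only [hFc] at this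
    exact Complex.summable_ofReal.1 this
  have hFq : ∀ {t : ℝ}, 0 ≤ t → t < 1 → ((∑' n, F n t : ℝ) : ℂ) = 2 * powSum q t :=
    fun {t} h0 h1 => by
      rw [← tsum_sinPowInt_eq hw hc hc0 hp hcp h0 h1, Complex.ofReal_tsum]
      simp only [hFc]
  have hqle : ∀ {t : ℝ}, 0 ≤ t → t < 1 → ∀ n, ‖q n * (t : ℂ) ^ n‖ ≤ ‖q n‖ :=
    fun {t} h0 h1 n => by
      rw [norm_mul, norm_pow]
      exact mul_le_of_le_one_right (norm_nonneg _)
        (pow_le_one₀ (norm_nonneg _) (norm_ofReal_lt_one h0 h1).le)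
  have hcont : ∀ n, Tendsto (F n) (𝓝[<] 1) (𝓝 (F n 1)) := fun n =>
    ((hasDerivAt_sinPowInt n 1).continuousAt.tendsto.const_mul _).mono_left nhdsWithin_le_nhds
  have hmem : ∀ᶠ t : ℝ in 𝓝[<] 1, 0 ≤ t ∧ t < 1 := by
    filter_upwards [Ioo_mem_nhdsLT zero_lt_one] with t ht using ⟨ht.1.le, ht.2⟩
  have hFsum : Summable fun n => F n 1 := by
    refine summable_of_sum_range_le (c := 2 * ∑' n, ‖q n‖)
      (fun n => hF0 n zero_le_one le_rfl) fun N => ?_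
    refine le_of_tendsto (tendsto_finsetSum _ fun n _ => hcont n) ?_
    filter_upwards [hmem] with t ht
    calc ∑ n ∈ range N, F n t ≤ ∑' n, F n t :=
          (hFs ht.1 ht.2).sum_le_tsum _ fun n _ => hF0 n ht.1 ht.2.le
      _ ≤ ‖((∑' n, F n t : ℝ) : ℂ)‖ := by
          rw [Complex.norm_real]
          exact le_abs_self _
      _ = 2 * ‖powSum q t‖ := by rw [hFq ht.1 ht.2, norm_mul, Complex.norm_ofNat]
      _ ≤ 2 * ∑' n, ‖q n‖ := by
          gcongr
          exact tsum_of_norm_bounded hsum.norm.hasSum (hqle ht.1 ht.2)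
  refine ⟨hFsum, ?_⟩
  have hlimF : Tendsto (fun t => ∑' n, F n t) (𝓝[<] 1) (𝓝 (∑' n, F n 1)) := by
    refine tendsto_tsum_of_dominated_convergence hFsum hcont ?_
    filter_upwards [hmem] with t ht n
    rw [Real.norm_of_nonneg (hF0 n ht.1 ht.2.le)]
    exact hFle n ht.1 ht.2.le
  have hlimq : Tendsto (fun t : ℝ => powSum q t) (𝓝[<] 1) (𝓝 (∑' n, q n)) := by
    refine tendsto_tsum_of_dominated_convergence hsum.norm (fun n => ?_) ?_
    · have hcts : Continuous fun t : ℝ => q n * (t : ℂ) ^ n := by fun_prop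
      simpa using (hcts.tendsto 1).mono_left nhdsWithin_le_nhds
    · filter_upwards [hmem] with t ht using hqle ht.1 ht.2
  have heq : ((∑' n, F n 1 : ℝ) : ℂ) = 2 * ∑' n, q n := by
    refine tendsto_nhds_unique ((Complex.continuous_ofReal.tendsto _).comp hlimF)
      ((hlimq.const_mul 2).congr' ?_)
    filter_upwards [hmem] with t ht using (hFq ht.1 ht.2).symm
  rw [heq, two_mul]
  exact Submodule.add_mem _ (tsum_divIndex_mem_CMZV hw hp) (tsum_divIndex_mem_CMZV hw hp)

end CentralBinomialSeries

open CentralBinomialSeries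

/-- For a tuple `(t₁,…,t_m)` of positive integers with sum `u` and an
integer `s ≥ 3`, the convergent series
`∑_{n=1}^∞ (H_{n-1}^{(t₁,…,t_m)}/n^s) · 16^n · C(2n,n)^{-2}` belongs to `CMZV⁴_{s+u}`. -/
theorem statement6 (m : ℕ) (t : Fin m → ℕ) (ht : ∀ i, 0 < t i) (u : ℕ) (hu : ∑ i, t i = u)
    (s : ℕ) (hs : 3 ≤ s) :
    Summable (fun n : ℕ =>
      multiHarmonic t n / ((n + 1 : ℕ) : ℝ) ^ s * 16 ^ (n + 1)
        / (Nat.choose (2 * (n + 1)) (n + 1) : ℝ) ^ 2) ∧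
    (((∑' n : ℕ, multiHarmonic t n / ((n + 1 : ℕ) : ℝ) ^ s * 16 ^ (n + 1)
        / (Nat.choose (2 * (n + 1)) (n + 1) : ℝ) ^ 2 : ℝ) : ℂ) ∈ CMZV 4 (s + u)) := by
  have hpos : ∀ i, 0 < (Fin.cons (s - 1) t : Fin (m + 1) → ℕ) i :=
    Fin.cases (by simp only [Fin.cons_zero]; omega) fun i => by simpa using ht i
  have hsum : ∑ i, (Fin.cons (s - 1) t : Fin (m + 1) → ℕ) i = s - 1 + u := by
    rw [Fin.sum_univ_succ, Fin.cons_zero]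
    simp only [Fin.cons_succ, hu]
  have hpoly := isPolylog_multiCoeff m (Fin.cons (s - 1) t) hpos
    (by rw [Fin.cons_zero]; omega)
  rw [hsum] at hpoly
  have key := hpoly.summable_and_tsum_mem_CMZV (by omega) (multiCoeff_zero_apply_zero _ _ _)
    (r := fun n => multiHarmonic t n / ((n : ℝ) + 1) ^ (s - 1))
    (fun n => div_nonneg (multiHarmonic_nonneg t n) (by positivity))
    (fun n => by
      have htail : Fin.tail (fun _ : Fin (m + 1) => (1 : ℂ)) = fun _ => 1 := rfl
      push_cast
      rw [ofReal_multiHarmonic, multiCoeff, Fin.tail_cons, Fin.cons_zero, htail, one_pow]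
      push_cast
      ring)
  have hterm : ∀ n : ℕ, multiHarmonic t n / ((n : ℝ) + 1) ^ (s - 1) * invBinom (n + 1) ^ 2 /
      ((n : ℝ) + 1) = multiHarmonic t n / ((n + 1 : ℕ) : ℝ) ^ s * 16 ^ (n + 1)
        / (Nat.choose (2 * (n + 1)) (n + 1) : ℝ) ^ 2 := fun n => by
    have h16 : (16 : ℝ) ^ (n + 1) = (4 ^ (n + 1)) ^ 2 := by
      rw [← pow_mul, mul_comm, pow_mul]
      norm_num
    obtain ⟨r, rfl⟩ : ∃ r, s = r + 1 := ⟨s - 1, by omega⟩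
    rw [invBinom, Nat.centralBinom_eq_two_mul_choose, h16, Nat.add_sub_cancel, pow_succ _ r,
      Nat.cast_add_one, div_pow]
    field_simp
  have hw : s - 1 + u + 1 = s + u := by omega
  simp only [hterm, hw] at key
  exact key
end
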